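/- Let 1 ≤ p ≤ n be integers with n ≥ 2, let Λ₁,…,Λ_p be positive reals with Λ = diag(Λ₁,…,Λ_p), and let x₀, x₁ ∈ ℂ with Im x₀ > 0. Then the generating function Z₁(x₀,x₁) := ∫ det(x₁·1_p − WWᵀ)/det(x₀·1_p − WWᵀ) dμ₁(W), where the integral is over all real p×n matrices W, satisfies: Z₁(x₀,x₁) = (1/8) ∬_{(0,∞)²} dr_a dr_b · |r_a − r_b| (r_a r_b)^{(n−3)/2} e^{−(r_a + r_b)/2} / ∏_{i=1}^{p} ( √(x₀ − Λ_i r_a) · √(x₀ − Λ_i r_b) ) × Σ_{k=0}^{p} (−1)^k x₁^{p−k}/(n−k)! · [ n(n−1) E_k(Λ) + Σ_{j≠l} Λ_j² Λ_l² E_{k−2}(Λ^{ĵl}) r_a r_b / ((x₀ − Λ_j r_a)(x₀ − Λ_l r_b)) + (n−1) Σ_{j=1}^{p} Λ_j² E_{k−1}(Λ^ĵ) ( r_a/(x₀ − Λ_j r_a) + r_b/(x₀ − Λ_j r_b) ) ], where √ denotes the principal branch of the complex square root applied separately to each factor x₀ − Λ_i r_a and x₀ − Λ_i r_b (each of which has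 positive imaginary part), and the double integral converges absolutely. -/

import Mathlib

open MeasureTheory Matrix

/-- The real Wishart measure with parameter `Λ = diag(Λ₁,…,Λ_p)`: the probability
measure on real `p × n` matrices (identified with the pi type `Fin p → Fin n → ℝ`
carrying Lebesgue measure) with density
`P₁(W) = ((2π)^p det Λ)^{-n/2} exp(-(1/2) tr(Wᵀ Λ⁻¹ W))`. -/
noncomputable def wishartMeasureReal (p n : ℕ) (Λ : Fin p → ℝ) :
    Measure (Fin p → Fin n → ℝ) :=
  volume.withDensity fun W =>
    ENNReal.ofReal ((((2 * Real.pi) ^ p * ∏ j, Λ j) ^ (-(n : ℝ) / 2)) *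
      Real.exp (-(1 / 2) *
        ((Matrix.of W)ᵀ * (Matrix.diagonal Λ)⁻¹ * Matrix.of W).trace))

/-- The `k`-th elementary symmetric function of `(v i)_{i ∈ s}` (`E₀ = 1`). -/
noncomputable def esymm {p : ℕ} (s : Finset (Fin p)) (v : Fin p → ℝ) (k : ℕ) : ℝ :=
  ∑ t ∈ s.powersetCard k, ∏ i ∈ t, v i

/-- The integrand of the direct (generalized Hubbard-Stratonovich) twofold-integral
representation of the real Wishart generating function `Z₁(x₀,x₁)`:
`|r_a−r_b| (r_a r_b)^{(n−3)/2} e^{−(r_a+r_b)/2} / ∏_i (√(x₀−Λ_i r_a) √(x₀−Λ_i r_b))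
 · Σ_{k=0}^p (−1)^k x₁^{p−k}/(n−k)! [ n(n−1) E_k(Λ)
   + Σ_{j≠l} Λ_j² Λ_l² E_{k−2}(Λ^{ĵl}) r_a r_b /((x₀−Λ_j r_a)(x₀−Λ_l r_b))
   + (n−1) Σ_j Λ_j² E_{k−1}(Λ^ĵ) (r_a/(x₀−Λ_j r_a) + r_b/(x₀−Λ_j r_b)) ]`,
with `√` the principal branch of the complex square root applied separately to each
factor, and with the convention `E_m = 0` for `m < 0`. -/
noncomputable def directIntegrand (p n : ℕ) (Λ : Fin p → ℝ) (x₀ x₁ : ℂ) (r : ℝ × ℝ) : ℂ :=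
  ((|r.1 - r.2| : ℝ) : ℂ) * (((r.1 * r.2) ^ (((n : ℝ) - 3) / 2) : ℝ) : ℂ) *
      ((Real.exp (-(r.1 + r.2) / 2) : ℝ) : ℂ) /
      (∏ i, ((x₀ - (Λ i : ℂ) * (r.1 : ℂ)) ^ ((1 : ℂ) / 2) *
              (x₀ - (Λ i : ℂ) * (r.2 : ℂ)) ^ ((1 : ℂ) / 2))) *
    ∑ k ∈ Finset.range (p + 1),
      (-1 : ℂ) ^ k * x₁ ^ (p - k) / (Nat.factorial (n - k)) *
        (((n : ℂ) * ((n : ℂ) - 1)) * (esymm Finset.univ Λ k : ℝ) +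
          (∑ j, ∑ l ∈ Finset.univ.erase j,
            ((Λ j : ℂ) ^ 2 * (Λ l : ℂ) ^ 2 *
                ((if 2 ≤ k then esymm ((Finset.univ.erase j).erase l) Λ (k - 2)
                  else 0 : ℝ) : ℂ) * (r.1 : ℂ) * (r.2 : ℂ)) /
              ((x₀ - (Λ j : ℂ) * (r.1 : ℂ)) * (x₀ - (Λ l : ℂ) * (r.2 : ℂ)))) +
          ((n : ℂ) - 1) *
            ∑ j, (Λ j : ℂ) ^ 2 *
              ((if 1 ≤ k then esymm (Finset.univ.erase j) Λ (k - 1) else 0 : ℝ) : ℂ) *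
              ((r.1 : ℂ) / (x₀ - (Λ j : ℂ) * (r.1 : ℂ)) +
                (r.2 : ℂ) / (x₀ - (Λ j : ℂ) * (r.2 : ℂ))))

theorem integrable_sq_mul_cexp_neg_mul_sq {b : ℂ} (hb : 0 < b.re) :
    Integrable fun x : ℝ => (x : ℂ) ^ 2 * Complex.exp (-b * (x : ℂ) ^ 2) := by
  have h := integrable_rpow_mul_exp_neg_mul_sq hb (s := 2) (by norm_num)
  refine (integrable_norm_iff (by fun_prop)).mp (h.congr (Filter.Eventually.of_forall fun x => ?_))
  simp only [norm_mul, norm_pow, Complex.norm_real, Real.norm_eq_abs, sq_abs, Complex.norm_exp]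
  rw [show ((2 : ℝ)) = ((2 : ℕ) : ℝ) by norm_num, Real.rpow_natCast]
  congr 2
  rw [← Complex.ofReal_pow, Complex.re_mul_ofReal]
  simp

theorem integral_sq_mul_cexp_neg_mul_sq {b : ℂ} (hb : 0 < b.re) :
    ∫ x : ℝ, (x : ℂ) ^ 2 * Complex.exp (-b * (x : ℂ) ^ 2)
      = 1 / (2 * b) * (Real.pi / b) ^ (1 / 2 : ℂ) := by
  have hb0 : b ≠ 0 := fun h => by simp [h] at hb
  have hd : ∀ x : ℝ, HasDerivAt (fun x : ℝ => (x : ℂ) * Complex.exp (-b * (x : ℂ) ^ 2))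
      (Complex.exp (-b * (x : ℂ) ^ 2) - 2 * b * ((x : ℂ) ^ 2 * Complex.exp (-b * (x : ℂ) ^ 2))) x := by
    intro x
    have h1 : HasDerivAt (fun z : ℂ => z * Complex.exp (-b * z ^ 2))
        (1 * Complex.exp (-b * (x : ℂ) ^ 2)
          + x * (Complex.exp (-b * (x : ℂ) ^ 2) * (-b * ((2 : ℕ) * (x : ℂ) ^ (2 - 1) * 1)))) x :=
      (hasDerivAt_id (x : ℂ)).mul ((((hasDerivAt_id (x : ℂ)).pow 2).const_mul (-b)).cexp)
    convert h1.comp_ofReal using 1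
    push_cast; ring
  have hi1 : Integrable fun x : ℝ => Complex.exp (-b * (x : ℂ) ^ 2) := integrable_cexp_neg_mul_sq hb
  have hi2 := (integrable_sq_mul_cexp_neg_mul_sq hb).const_mul (2 * b)
  have h := integral_eq_zero_of_hasDerivAt_of_integrable hd (hi1.sub hi2)
    (integrable_mul_cexp_neg_mul_sq hb)
  rw [integral_sub hi1 hi2, integral_const_mul, integral_gaussian_complex hb] at h
  rw [one_div, inv_mul_eq_div, eq_div_iff (mul_ne_zero two_ne_zero hb0)]
  linear_combination -h

theorem integral_mul_cexp_neg_mul_sq_eq_zero (b : ℂ) :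
    ∫ x : ℝ, (x : ℂ) * Complex.exp (-b * (x : ℂ) ^ 2) = 0 := by
  have h := integral_neg_eq_self (fun x : ℝ => (x : ℂ) * Complex.exp (-b * (x : ℂ) ^ 2)) volume
  simp only [Complex.ofReal_neg, neg_mul, even_two.neg_pow, integral_neg] at h
  simp only [neg_mul]
  linear_combination -h / 2

section
variable {ι : Type*} [Fintype ι]

theorem cexp_neg_sum_eq_prod (z : ι → ℂ) (y : ι → ℝ) :
    Complex.exp (-∑ k, z k * (y k : ℂ) ^ 2) = ∏ k, Complex.exp (-z k * (y k : ℂ) ^ 2) := by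
  rw [← Complex.exp_sum, ← Finset.sum_neg_distrib]
  simp

theorem integral_cexp_neg_sum_sq (z : ι → ℂ) (hz : ∀ k, 0 < (z k).re) :
    ∫ y : ι → ℝ, Complex.exp (-∑ k, z k * (y k : ℂ) ^ 2)
      = ∏ k, (Real.pi / z k) ^ (1 / 2 : ℂ) := by
  simp_rw [cexp_neg_sum_eq_prod]
  rw [integral_fintype_prod_volume_eq_prod (fun k (x : ℝ) => Complex.exp (-z k * (x : ℂ) ^ 2))]
  exact Finset.prod_congr rfl fun k _ => integral_gaussian_complex (hz k)

theorem integral_mul_mul_cexp_neg_sum_sq [DecidableEq ι] (z : ι → ℂ) (hz : ∀ k, 0 < (z k).re)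
    (i j : ι) :
    ∫ y : ι → ℝ, (y i : ℂ) * (y j : ℂ) * Complex.exp (-∑ k, z k * (y k : ℂ) ^ 2)
      = if i = j then 1 / (2 * z i) * ∏ k, (Real.pi / z k) ^ (1 / 2 : ℂ) else 0 := by
  have h : ∀ y : ι → ℝ, (y i : ℂ) * (y j : ℂ) * Complex.exp (-∑ k, z k * (y k : ℂ) ^ 2)
      = ∏ k, ((if k = i then (y k : ℂ) else 1) * (if k = j then (y k : ℂ) else 1)
          * Complex.exp (-z k * (y k : ℂ) ^ 2)) := by
    intro y
    rw [cexp_neg_sum_eq_prod, Finset.prod_mul_distrib, Finset.prod_mul_distrib]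
    simp
  simp_rw [h]
  rw [integral_fintype_prod_volume_eq_prod (fun k (x : ℝ) =>
    ((if k = i then (x : ℂ) else 1) * (if k = j then (x : ℂ) else 1)
          * Complex.exp (-z k * (x : ℂ) ^ 2)))]
  split_ifs with hij
  · subst hij
    rw [show 1 / (2 * z i) = ∏ k, (if k = i then 1 / (2 * z k) else 1) by simp,
      ← Finset.prod_mul_distrib]
    refine Finset.prod_congr rfl fun k _ => ?_
    split_ifs with hk
    · rw [← integral_sq_mul_cexp_neg_mul_sq (hz k)]
      simp only [sq]
    · simp only [one_mul]
      exact integral_gaussian_complex (hz k)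
  · refine Finset.prod_eq_zero (Finset.mem_univ i) ?_
    simp only [if_true, hij, if_false, mul_one]
    exact integral_mul_cexp_neg_mul_sq_eq_zero _

theorem integrable_cexp_neg_sum_sq (z : ι → ℂ) (hz : ∀ k, 0 < (z k).re) :
    Integrable fun y : ι → ℝ => Complex.exp (-∑ k, z k * (y k : ℂ) ^ 2) := by
  simp_rw [cexp_neg_sum_eq_prod]
  exact Integrable.fintype_prod (f := fun k (x : ℝ) => Complex.exp (-z k * (x : ℂ) ^ 2))
    fun k => integrable_cexp_neg_mul_sq (hz k)

theorem integral_comp_orthogonal_mulVec [DecidableEq ι] {E : Type*} [NormedAddCommGroup E]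
    [NormedSpace ℝ E] {Q : Matrix ι ι ℝ} (hQ : Qᵀ * Q = 1) (f : (ι → ℝ) → E) :
    ∫ y, f (Q *ᵥ y) = ∫ y, f y := by
  have hdet : Q.det * Q.det = 1 := by
    have := congrArg Matrix.det hQ
    rwa [Matrix.det_mul, Matrix.det_transpose, Matrix.det_one] at this
  have h0 : Q.det ≠ 0 := fun h => by simp [h] at hdet
  have habs : |Q.det| = 1 := by
    rcases mul_self_eq_one_iff.mp hdet with h | h <;> simp [h]
  have hmap := Real.map_matrix_volume_pi_eq_smul_volume_pi h0
  rw [abs_inv, habs, inv_one, ENNReal.ofReal_one, one_smul] at hmap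
  have hu : IsUnit Q := (Matrix.isUnit_iff_isUnit_det Q).mpr (isUnit_iff_ne_zero.mpr h0)
  have hemb : MeasurableEmbedding (toLin' Q) := by
    refine (toLin' Q).continuous_of_finiteDimensional.measurableEmbedding ?_
    exact Matrix.mulVec_injective_of_isUnit hu
  conv_rhs => rw [← hmap, hemb.integral_map]
  rfl

/-- The Gaussian quadratic form `z ∑ yᵢ² + c yᵀ S y`. -/
noncomputable def gaussForm (z c : ℂ) (S : Matrix ι ι ℝ) (y : ι → ℝ) : ℂ :=
  z * ((y ⬝ᵥ y : ℝ) : ℂ) + c * ((y ⬝ᵥ S *ᵥ y : ℝ) : ℂ)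

variable [DecidableEq ι]

theorem exists_orthogonal_diagonalization {S : Matrix ι ι ℝ} (hS : S.IsHermitian) :
    ∃ Q : Matrix ι ι ℝ, Qᵀ * Q = 1 ∧ Q * Qᵀ = 1 ∧ S = Q * diagonal hS.eigenvalues * Qᵀ := by
  refine ⟨hS.eigenvectorUnitary, ?_, ?_, ?_⟩
  · have := Unitary.coe_star_mul_self hS.eigenvectorUnitary
    rwa [Matrix.star_eq_conjTranspose, conjTranspose_eq_transpose_of_trivial] at this
  · have := Unitary.coe_mul_star_self hS.eigenvectorUnitary
    rwa [Unitary.coe_star, Matrix.star_eq_conjTranspose, conjTranspose_eq_transpose_of_trivial] at this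
  · have := hS.spectral_theorem
    rw [Unitary.conjStarAlgAut_apply, Matrix.star_eq_conjTranspose,
      conjTranspose_eq_transpose_of_trivial] at this
    exact this

theorem gaussForm_comp_orthogonal {Q : Matrix ι ι ℝ} (hQ : Qᵀ * Q = 1) (z c : ℂ) (d y : ι → ℝ) :
    gaussForm z c (Q * diagonal d * Qᵀ) (Q *ᵥ y) = ∑ k, (z + c * d k) * (y k : ℂ) ^ 2 := by
  have h1 : (Q *ᵥ y) ⬝ᵥ (Q *ᵥ y) = y ⬝ᵥ y := by
    rw [Matrix.dotProduct_mulVec, ← Matrix.mulVec_transpose, Matrix.mulVec_mulVec, hQ,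
      Matrix.one_mulVec]
  have h2 : (Q *ᵥ y) ⬝ᵥ (Q * diagonal d * Qᵀ) *ᵥ (Q *ᵥ y) = y ⬝ᵥ (diagonal d *ᵥ y) := by
    rw [Matrix.mulVec_mulVec, Matrix.mul_assoc, hQ, Matrix.mul_one, ← Matrix.mulVec_mulVec,
      Matrix.dotProduct_mulVec, ← Matrix.mulVec_transpose, Matrix.mulVec_mulVec, hQ,
      Matrix.one_mulVec]
  rw [gaussForm, h1, h2]
  simp only [dotProduct, Matrix.mulVec_diagonal]
  push_cast
  rw [Finset.mul_sum, Finset.mul_sum, ← Finset.sum_add_distrib]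
  exact Finset.sum_congr rfl fun k _ => by ring

theorem integral_cexp_neg_gaussForm {S : Matrix ι ι ℝ} (hS : S.IsHermitian) (z c : ℂ)
    (hz : ∀ k, 0 < (z + c * hS.eigenvalues k).re) :
    ∫ y, Complex.exp (-gaussForm z c S y)
      = ∏ k, (Real.pi / (z + c * hS.eigenvalues k)) ^ (1 / 2 : ℂ) := by
  obtain ⟨Q, hQ, -, hSQ⟩ := exists_orthogonal_diagonalization hS
  rw [← integral_comp_orthogonal_mulVec hQ, ← integral_cexp_neg_sum_sq _ hz]
  congr 1 with y
  have h := gaussForm_comp_orthogonal hQ z c hS.eigenvalues y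
  rw [← hSQ] at h
  rw [h]

theorem exists_orthogonal_diagonalization_complex {S : Matrix ι ι ℝ} (hS : S.IsHermitian) :
    ∃ Q : Matrix ι ι ℝ, Qᵀ * Q = 1 ∧ S = Q * diagonal hS.eigenvalues * Qᵀ ∧
      (Q.map Complex.ofReal)ᵀ * Q.map Complex.ofReal = 1 ∧
      Q.map Complex.ofReal * (Q.map Complex.ofReal)ᵀ = 1 ∧
      ∀ z c : ℂ, z • (1 : Matrix ι ι ℂ) + c • S.map Complex.ofReal = Q.map Complex.ofReal *
        diagonal (fun k => z + c * hS.eigenvalues k) * (Q.map Complex.ofReal)ᵀ := by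
  obtain ⟨Q, hQ, hQ', hSQ⟩ := exists_orthogonal_diagonalization hS
  set d := hS.eigenvalues
  have hQc : (Q.map Complex.ofReal)ᵀ * Q.map Complex.ofReal = 1 := by
    have := congrArg (fun M : Matrix ι ι ℝ => M.map Complex.ofRealHom) hQ
    simp only [Matrix.map_mul] at this
    rw [Matrix.map_one _ (map_zero _) (map_one _)] at this
    exact this
  have hQc' : Q.map Complex.ofReal * (Q.map Complex.ofReal)ᵀ = 1 := by
    have := congrArg (fun M : Matrix ι ι ℝ => M.map Complex.ofRealHom) hQ'
    simp only [Matrix.map_mul] at this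
    rw [Matrix.map_one _ (map_zero _) (map_one _)] at this
    exact this
  refine ⟨Q, hQ, hSQ, hQc, hQc', fun z c => ?_⟩
  have hdec : z • (1 : Matrix ι ι ℂ) + c • S.map Complex.ofReal
      = Q.map Complex.ofReal * diagonal (fun k => z + c * d k) * (Q.map Complex.ofReal)ᵀ := by
    have h1 : S.map Complex.ofReal = Q.map Complex.ofReal * diagonal (fun k => (d k : ℂ))
        * (Q.map Complex.ofReal)ᵀ := by
      have := congrArg (fun M : Matrix ι ι ℝ => M.map Complex.ofRealHom) hSQ
      simp only [Matrix.map_mul, Matrix.diagonal_map (map_zero Complex.ofRealHom)] at this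
      exact this
    have h2 : diagonal (fun k => z + c * (d k : ℂ))
        = z • (1 : Matrix ι ι ℂ) + c • diagonal (fun k => (d k : ℂ)) := by
      ext a b
      by_cases hab : a = b
      · subst hab; simp
      · simp [hab]
    rw [h2, h1, Matrix.mul_add, Matrix.add_mul]
    simp [hQc', Matrix.mul_assoc]
  exact hdec

theorem det_smul_one_add_smul_map {S : Matrix ι ι ℝ} (hS : S.IsHermitian) (z c : ℂ) :
    (z • (1 : Matrix ι ι ℂ) + c • S.map Complex.ofReal).det
      = ∏ k, (z + c * hS.eigenvalues k) := by
  obtain ⟨Q, -, -, -, hQ', hdec⟩ := exists_orthogonal_diagonalization_complex hS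
  rw [hdec, Matrix.det_mul_right_comm, hQ', Matrix.one_mul, Matrix.det_diagonal]

theorem integral_mul_mul_cexp_neg_gaussForm {S : Matrix ι ι ℝ} (hS : S.IsHermitian) (z c : ℂ)
    (hz : ∀ k, 0 < (z + c * hS.eigenvalues k).re) (i j : ι) :
    ∫ y : ι → ℝ, (y i : ℂ) * (y j : ℂ) * Complex.exp (-gaussForm z c S y)
      = (z • (1 : Matrix ι ι ℂ) + c • S.map Complex.ofReal)⁻¹ i j / 2
        * ∏ k, (Real.pi / (z + c * hS.eigenvalues k)) ^ (1 / 2 : ℂ) := by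
  obtain ⟨Q, hQ, hSQ, hQc, hQc', hdec⟩ := exists_orthogonal_diagonalization_complex hS
  set d := hS.eigenvalues
  have hz0 : ∀ k, z + c * d k ≠ 0 := fun k h => by simpa [h] using hz k
  have hinv : (z • (1 : Matrix ι ι ℂ) + c • S.map Complex.ofReal)⁻¹
      = Q.map Complex.ofReal * diagonal (fun k => (z + c * d k)⁻¹) * (Q.map Complex.ofReal)ᵀ := by
    refine Matrix.inv_eq_right_inv ?_
    rw [hdec]
    calc _ = Q.map Complex.ofReal * (diagonal (fun k => z + c * d k) *
          ((Q.map Complex.ofReal)ᵀ * Q.map Complex.ofReal) * diagonal (fun k => (z + c * d k)⁻¹))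
            * (Q.map Complex.ofReal)ᵀ := by simp only [Matrix.mul_assoc]
      _ = 1 := by
          rw [hQc, Matrix.mul_one, Matrix.diagonal_mul_diagonal]
          simp [hz0, hQc']
  rw [← integral_comp_orthogonal_mulVec hQ, hinv]
  have hexp : ∀ y : ι → ℝ, ((Q *ᵥ y) i : ℂ) * ((Q *ᵥ y) j : ℂ)
      * Complex.exp (-gaussForm z c S (Q *ᵥ y))
      = ∑ a, ∑ b, (Q i a : ℂ) * (Q j b : ℂ) * ((y a : ℂ) * (y b : ℂ)
          * Complex.exp (-∑ k, (z + c * d k) * (y k : ℂ) ^ 2)) := by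
    intro y
    conv_lhs => rw [hSQ, gaussForm_comp_orthogonal hQ]
    simp only [Matrix.mulVec, dotProduct]
    push_cast
    rw [Finset.sum_mul_sum, Finset.sum_mul]
    refine Finset.sum_congr rfl fun a _ => ?_
    rw [Finset.sum_mul]
    exact Finset.sum_congr rfl fun b _ => by ring
  have hint : ∀ a b : ι, Integrable fun y : ι → ℝ => (Q i a : ℂ) * (Q j b : ℂ) *
      ((y a : ℂ) * (y b : ℂ) * Complex.exp (-∑ k, (z + c * d k) * (y k : ℂ) ^ 2)) := by
    intro a b
    refine Integrable.const_mul ?_ _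
    have h : ∀ y : ι → ℝ, (y a : ℂ) * (y b : ℂ) * Complex.exp (-∑ k, (z + c * d k) * (y k : ℂ) ^ 2)
        = ∏ k, ((if k = a then (y k : ℂ) else 1) * (if k = b then (y k : ℂ) else 1)
          * Complex.exp (-(z + c * d k) * (y k : ℂ) ^ 2)) := by
      intro y
      rw [cexp_neg_sum_eq_prod, Finset.prod_mul_distrib, Finset.prod_mul_distrib]
      simp
    simp_rw [h]
    refine Integrable.fintype_prod (f := fun k (x : ℝ) =>
      ((if k = a then (x : ℂ) else 1) * (if k = b then (x : ℂ) else 1)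
          * Complex.exp (-(z + c * d k) * (x : ℂ) ^ 2))) fun k => ?_
    split_ifs
    · simpa only [sq] using integrable_sq_mul_cexp_neg_mul_sq (hz k)
    · simpa only [mul_one] using integrable_mul_cexp_neg_mul_sq (hz k)
    · simpa only [one_mul] using integrable_mul_cexp_neg_mul_sq (hz k)
    · simpa only [one_mul] using integrable_cexp_neg_mul_sq (hz k)
  simp_rw [hexp]
  rw [integral_finsetSum _ fun a _ => integrable_finsetSum _ fun b _ => hint a b]
  simp_rw [integral_finsetSum _ fun b _ => hint _ b, integral_const_mul,
    integral_mul_mul_cexp_neg_sum_sq _ hz]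
  rw [Matrix.mul_apply]
  simp only [mul_ite, mul_zero, Finset.sum_ite_eq, Finset.mem_univ, if_true,
    Matrix.mul_diagonal, Matrix.transpose_apply, Matrix.map_apply]
  rw [Finset.sum_div, Finset.sum_mul]
  refine Finset.sum_congr rfl fun a _ => ?_
  have := hz0 a
  field_simp


theorem prod_eigenvalues_mul_transpose {κ : Type*} [Fintype κ] [DecidableEq κ]
    {U : Matrix ι κ ℝ} {b : κ → ℝ} (hU : Uᵀ * U = diagonal b)
    (hS : (U * Uᵀ).IsHermitian) (f : ℝ → ℂ) :
    f 0 ^ Fintype.card κ * ∏ k, f (hS.eigenvalues k)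
      = f 0 ^ Fintype.card ι * ∏ k, f (b k) := by
  have h := congrArg Polynomial.roots (Matrix.charpoly_mul_comm' U Uᵀ)
  have hne : ∀ {m : Type _} [Fintype m] [DecidableEq m] (N : ℕ) (M : Matrix m m ℝ),
      Polynomial.X ^ N * M.charpoly ≠ 0 := fun N M =>
    mul_ne_zero (pow_ne_zero _ Polynomial.X_ne_zero) M.charpoly_monic.ne_zero
  have hne' : ∀ {m : Type _} [Fintype m] [DecidableEq m] (N : ℕ) (M : Matrix m m ℝ),
      Polynomial.X ^ N * M.charpoly ≠ 0 := fun N M =>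
    mul_ne_zero (pow_ne_zero _ Polynomial.X_ne_zero) M.charpoly_monic.ne_zero
  rw [Polynomial.roots_mul (hne _ _), Polynomial.roots_mul (hne' _ _), hS.roots_charpoly_eq_eigenvalues,
    hU, Matrix.charpoly_diagonal, Polynomial.roots_pow, Polynomial.roots_pow, Polynomial.roots_X,
    show ∏ i, (Polynomial.X - Polynomial.C (b i))
      = ((Finset.univ.val.map b).map fun a => Polynomial.X - Polynomial.C a).prod by
        rw [Multiset.map_map]; rfl,
    Polynomial.roots_multiset_prod_X_sub_C] at h
  have h2 := congrArg (fun s : Multiset ℝ => (s.map f).prod) h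
  simpa [Multiset.map_nsmul, Multiset.prod_nsmul, Function.comp_def] using h2

theorem integral_prod_cexp_neg_gaussForm {S : Matrix ι ι ℝ} (hS : S.IsHermitian) {x₀ : ℂ}
    (h₀ : 0 < x₀.im) :
    ∫ U : (ι → ℝ) × (ι → ℝ), Complex.exp (-gaussForm (-Complex.I * x₀) Complex.I S U.1)
        * Complex.exp (-gaussForm (-Complex.I * x₀) Complex.I S U.2)
      = (Real.pi * Complex.I) ^ Fintype.card ι
        / (x₀ • (1 : Matrix ι ι ℂ) - S.map Complex.ofReal).det := by
  have hre : ∀ k, 0 < (-Complex.I * x₀ + Complex.I * hS.eigenvalues k).re := by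
    intro k; simpa using h₀
  have hd : (x₀ • (1 : Matrix ι ι ℂ) - S.map Complex.ofReal).det
      = ∏ k, (x₀ + (-1) * hS.eigenvalues k) := by
    rw [← det_smul_one_add_smul_map hS, neg_one_smul, sub_eq_add_neg]
  rw [Measure.volume_eq_prod,
    integral_prod_mul (fun u => Complex.exp (-gaussForm (-Complex.I * x₀) Complex.I S u))
    (fun u => Complex.exp (-gaussForm (-Complex.I * x₀) Complex.I S u)),
    integral_cexp_neg_gaussForm hS _ _ hre, ← Finset.prod_mul_distrib, hd,
    ← Finset.card_univ, ← Finset.prod_const, ← Finset.prod_div_distrib]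
  refine Finset.prod_congr rfl fun k _ => ?_
  have h1 : x₀ + -1 * (hS.eigenvalues k : ℂ) ≠ 0 := by
    intro h
    have := congrArg Complex.im h
    simp at this
    exact h₀.ne' this
  rw [← sq, ← Complex.cpow_nat_mul, show (((2 : ℕ) : ℂ) * (1 / 2)) = 1 by norm_num, Complex.cpow_one,
    show -Complex.I * x₀ + Complex.I * (hS.eigenvalues k : ℂ)
      = -Complex.I * (x₀ + -1 * (hS.eigenvalues k : ℂ)) by ring]
  rw [div_eq_div_iff (mul_ne_zero (by simp) h1) h1]
  linear_combination (Real.pi : ℂ) * (x₀ + -1 * (hS.eigenvalues k : ℂ)) * Complex.I_mul_I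

end

theorem lintegral_comp_mul_left_eq {f : ℝ → ENNReal} (hf : Measurable f) {a : ℝ} (ha : a ≠ 0) :
    ENNReal.ofReal |a| * ∫⁻ x, f (a * x) = ∫⁻ x, f x := by
  rw [← lintegral_map hf (measurable_const_mul a), Real.map_volume_mul_left ha,
    lintegral_smul_measure, smul_eq_mul, ← mul_assoc, ← ENNReal.ofReal_mul (abs_nonneg a), ← abs_mul,
    mul_inv_cancel₀ ha]
  simp

theorem lintegral_lintegral_add_sub {K : ℝ → ℝ → ENNReal}
    (hK : Measurable (Function.uncurry K)) :
    ∫⁻ a, ∫⁻ b, K a b = 2 * ∫⁻ s, ∫⁻ ρ, K (s + ρ) (s - ρ) := by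
  have h1 : ∀ a, ∫⁻ b, K a b = 2 * ∫⁻ ρ, K a (a - 2 * ρ) := by
    intro a
    have hm : Measurable fun b => K a (a - b) := by
      exact hK.comp (measurable_const.prodMk (by fun_prop))
    have h := lintegral_comp_mul_left_eq hm (two_ne_zero)
    rw [lintegral_sub_left_eq_self (fun b => K a b) a] at h
    rw [← h]
    simp
  have hm2 : Measurable (Function.uncurry fun a ρ => K a (a - 2 * ρ)) :=
    hK.comp (f := fun x : ℝ × ℝ => (x.1, x.1 - 2 * x.2)) (by fun_prop)
  have hm3 : Measurable (Function.uncurry fun s ρ => K (s + ρ) (s - ρ)) :=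
    hK.comp (Measurable.prodMk (by fun_prop) (by fun_prop))
  simp_rw [h1]
  rw [lintegral_const_mul _ (Measurable.lintegral_prod_right hm2),
    lintegral_lintegral_swap hm2.aemeasurable, lintegral_lintegral_swap hm3.aemeasurable]
  congr 2 with ρ
  rw [← lintegral_add_right_eq_self _ ρ]
  congr 1 with s
  congr 1
  ring

theorem lintegral_polar_signed {g : ℝ → ℝ → ENNReal} (hg : Measurable (Function.uncurry g)) :
    ∫⁻ ρ, ∫⁻ θ in Set.Ioo (-Real.pi) Real.pi,
        ENNReal.ofReal |ρ| * g (ρ * Real.cos θ) (ρ * Real.sin θ)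
      = 2 * ∫⁻ x, ∫⁻ c, g x c := by
  have key : ∀ {g : ℝ → ℝ → ENNReal}, Measurable (Function.uncurry g) →
      ∫⁻ ρ in Set.Ioi (0 : ℝ), ∫⁻ θ in Set.Ioo (-Real.pi) Real.pi,
        ENNReal.ofReal |ρ| * g (ρ * Real.cos θ) (ρ * Real.sin θ) = ∫⁻ x, ∫⁻ c, g x c := by
    intro g hg
    have h := lintegral_comp_polarCoord_symm (Function.uncurry g)
    have hmeas : Measurable (Function.uncurry fun ρ θ : ℝ =>
        ENNReal.ofReal |ρ| * g (ρ * Real.cos θ) (ρ * Real.sin θ)) := by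
      have : Measurable fun x : ℝ × ℝ => g (x.1 * Real.cos x.2) (x.1 * Real.sin x.2) :=
        hg.comp (Measurable.prodMk (by fun_prop) (by fun_prop))
      unfold Function.uncurry
      fun_prop
    rw [polarCoord_target, Measure.volume_eq_prod, ← Measure.prod_restrict,
      lintegral_prod _ hg.aemeasurable] at h
    refine Eq.trans ?_ h
    rw [lintegral_prod]
    · refine setLIntegral_congr_fun measurableSet_Ioi fun ρ hρ => ?_
      simp only [polarCoord_symm_apply, Function.uncurry, smul_eq_mul, abs_of_pos (Set.mem_Ioi.mp hρ)]
    · refine (AEMeasurable.congr hmeas.aemeasurable ?_)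
      rw [Measure.prod_restrict]
      refine ae_restrict_of_forall_mem (measurableSet_Ioi.prod measurableSet_Ioo) fun x hx => ?_
      simp only [polarCoord_symm_apply, Function.uncurry, smul_eq_mul,
        abs_of_pos (Set.mem_Ioi.mp hx.1)]
  have hneg : Measurable (Function.uncurry fun x c => g (-x) (-c)) :=
    hg.comp (Measurable.prodMk (by fun_prop) (by fun_prop))
  rw [← lintegral_add_compl _ (measurableSet_Ioi (a := (0 : ℝ))), key hg, Set.compl_Ioi,
    two_mul]
  congr 1
  calc _ = ∫⁻ ρ in Set.Iio (0 : ℝ), ∫⁻ θ in Set.Ioo (-Real.pi) Real.pi,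
        ENNReal.ofReal |ρ| * g (ρ * Real.cos θ) (ρ * Real.sin θ) := by
        rw [Measure.restrict_congr_set Iio_ae_eq_Iic]
    _ = ∫⁻ ρ in Set.Ioi (0 : ℝ), ∫⁻ θ in Set.Ioo (-Real.pi) Real.pi,
        ENNReal.ofReal |ρ| * g (-(ρ * Real.cos θ)) (-(ρ * Real.sin θ)) := by
        have hmp : MeasurePreserving (fun x : ℝ => -x) volume volume :=
          Measure.measurePreserving_neg volume
        have := hmp.setLIntegral_comp_preimage_emb (Homeomorph.neg ℝ).measurableEmbedding
          (fun ρ => ∫⁻ θ in Set.Ioo (-Real.pi) Real.pi,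
            ENNReal.ofReal |ρ| * g (ρ * Real.cos θ) (ρ * Real.sin θ)) (Set.Iio (0 : ℝ))
        rw [← this]
        simp
    _ = ∫⁻ x, ∫⁻ c, g (-x) (-c) := key hneg
    _ = ∫⁻ x, ∫⁻ c, g x c := by
        have : ∀ x, ∫⁻ c, g (-x) (-c) = ∫⁻ c, g (-x) c := fun x =>
          lintegral_neg_eq_self (fun c => g (-x) c)
        simp_rw [this]
        exact lintegral_neg_eq_self (fun x => ∫⁻ c, g x c)

/-- Entries `(R₁₁, R₂₂, R₁₂)` of the symmetric matrix with eigenvalues `r` and eigenframe rotated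
by `θ / 2`. -/
noncomputable def spectralEntries (x : (ℝ × ℝ) × ℝ) : ℝ × ℝ × ℝ :=
  ((x.1.1 + x.1.2) / 2 + (x.1.1 - x.1.2) / 2 * Real.cos x.2,
    (x.1.1 + x.1.2) / 2 - (x.1.1 - x.1.2) / 2 * Real.cos x.2,
    (x.1.1 - x.1.2) / 2 * Real.sin x.2)

/-- Entries `(R₁₁, R₂₂, R₁₂)` of the symmetric matrix with diagonal `x.1` and correlation `x.2`. -/
noncomputable def correlationEntries (x : (ℝ × ℝ) × ℝ) : ℝ × ℝ × ℝ :=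
  (x.1.1, x.1.2, √(x.1.1 * x.1.2) * x.2)

theorem measurable_spectralEntries : Measurable spectralEntries := by
  unfold spectralEntries; fun_prop

theorem measurable_correlationEntries : Measurable correlationEntries := by
  unfold correlationEntries; fun_prop

/-- Joint eigenvalue density of a real `2 × 2` Wishart matrix, up to normalization. -/
noncomputable def eigenDensity (m : ℝ) (r : ℝ × ℝ) : ℝ :=
  |r.1 - r.2| * (r.1 * r.2) ^ m * Real.exp (-(r.1 + r.2) / 2)

/-- The density `eigenDensity` in the coordinates of `correlationEntries`, up to normalization. -/
noncomputable def correlationDensity (m : ℝ) (x : (ℝ × ℝ) × ℝ) : ℝ :=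
  (x.1.1 * x.1.2) ^ (m + 1 / 2) * Real.exp (-(x.1.1 + x.1.2) / 2) * (1 - x.2 ^ 2) ^ m

theorem measurable_eigenDensity (m : ℝ) : Measurable (eigenDensity m) := by
  unfold eigenDensity; fun_prop

theorem measurable_correlationDensity (m : ℝ) : Measurable (correlationDensity m) := by
  unfold correlationDensity; fun_prop

/-- Lebesgue measure on pairs of positive eigenvalues and frame angles. -/
noncomputable def eigenMeasure : Measure ((ℝ × ℝ) × ℝ) :=
  (volume.restrict (Set.Ioi (0 : ℝ) ×ˢ Set.Ioi (0 : ℝ))).prod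
    (volume.restrict (Set.Ioo (-Real.pi) Real.pi))

/-- Lebesgue measure on pairs of positive diagonal entries and correlations. -/
noncomputable def correlationMeasure : Measure ((ℝ × ℝ) × ℝ) :=
  (volume.restrict (Set.Ioi (0 : ℝ) ×ˢ Set.Ioi (0 : ℝ))).prod
    (volume.restrict (Set.Ioo (-1 : ℝ) 1))

/-- The common integrand in half trace `s`, half diagonal difference `x`, off-diagonal entry `c`. -/
noncomputable def coneIntegrand (m : ℝ) (f : ℝ × ℝ × ℝ → ENNReal) (s x c : ℝ) : ENNReal :=
  {y : ℝ × ℝ × ℝ | 0 < y.1 ∧ y.2.1 ^ 2 + y.2.2 ^ 2 < y.1 ^ 2}.indicator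
    (fun y => ENNReal.ofReal ((y.1 ^ 2 - y.2.1 ^ 2 - y.2.2 ^ 2) ^ m * Real.exp (-y.1))
      * f (y.1 + y.2.1, y.1 - y.2.1, y.2.2)) (s, x, c)

theorem measurable_coneIntegrand (m : ℝ) {f : ℝ × ℝ × ℝ → ENNReal} (hf : Measurable f) :
    Measurable fun y : ℝ × ℝ × ℝ => coneIntegrand m f y.1 y.2.1 y.2.2 := by
  unfold coneIntegrand
  refine Measurable.indicator (f := fun y : ℝ × ℝ × ℝ =>
    ENNReal.ofReal ((y.1 ^ 2 - y.2.1 ^ 2 - y.2.2 ^ 2) ^ m * Real.exp (-y.1))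
      * f (y.1 + y.2.1, y.1 - y.2.1, y.2.2)) ?_ ?_
  · have : Measurable fun y : ℝ × ℝ × ℝ => f (y.1 + y.2.1, y.1 - y.2.1, y.2.2) :=
      hf.comp (f := fun y : ℝ × ℝ × ℝ => (y.1 + y.2.1, y.1 - y.2.1, y.2.2)) (by fun_prop)
    fun_prop
  · have h1 : MeasurableSet {y : ℝ × ℝ × ℝ | 0 < y.1} := measurableSet_lt (by fun_prop) (by fun_prop)
    have h2 : MeasurableSet {y : ℝ × ℝ × ℝ | y.2.1 ^ 2 + y.2.2 ^ 2 < y.1 ^ 2} :=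
      measurableSet_lt (by fun_prop) (by fun_prop)
    exact h1.inter h2

theorem lintegral_eigenMeasure (m : ℝ) {f : ℝ × ℝ × ℝ → ENNReal} (hf : Measurable f) :
    ∫⁻ x, ENNReal.ofReal (eigenDensity m x.1) * f (spectralEntries x) ∂eigenMeasure
      = 8 * ∫⁻ s, ∫⁻ x, ∫⁻ c, coneIntegrand m f s x c := by
  have hG := measurable_coneIntegrand m hf
  have hm1 : Measurable fun x : (ℝ × ℝ) × ℝ =>
      ENNReal.ofReal (eigenDensity m x.1) * f (spectralEntries x) := by
    exact ((measurable_eigenDensity m).comp measurable_fst).ennreal_ofReal.mul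
      (hf.comp measurable_spectralEntries)
  have hK : Measurable fun x : ℝ × ℝ × ℝ => ENNReal.ofReal |x.1 - x.2.1| *
        coneIntegrand m f ((x.1 + x.2.1) / 2) ((x.1 - x.2.1) / 2 * Real.cos x.2.2)
          ((x.1 - x.2.1) / 2 * Real.sin x.2.2) := by
    have : Measurable fun x : ℝ × ℝ × ℝ =>
      coneIntegrand m f ((x.1 + x.2.1) / 2) ((x.1 - x.2.1) / 2 * Real.cos x.2.2)
          ((x.1 - x.2.1) / 2 * Real.sin x.2.2) :=
      hG.comp (f := fun x : ℝ × ℝ × ℝ => ((x.1 + x.2.1) / 2, (x.1 - x.2.1) / 2 * Real.cos x.2.2,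
          (x.1 - x.2.1) / 2 * Real.sin x.2.2)) (by fun_prop)
    fun_prop
  have hstep : ∫⁻ x, ENNReal.ofReal (eigenDensity m x.1) * f (spectralEntries x) ∂eigenMeasure
      = ∫⁻ a, ∫⁻ b, ∫⁻ θ in Set.Ioo (-Real.pi) Real.pi, ENNReal.ofReal |a - b| *
        coneIntegrand m f ((a + b) / 2) ((a - b) / 2 * Real.cos θ) ((a - b) / 2 * Real.sin θ) := by
    rw [eigenMeasure, lintegral_prod _ hm1.aemeasurable,
      ← lintegral_indicator (measurableSet_Ioi.prod measurableSet_Ioi), Measure.volume_eq_prod,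
      lintegral_prod _ ((Measurable.lintegral_prod_right' hm1).indicator
        (measurableSet_Ioi.prod measurableSet_Ioi)).aemeasurable]
    refine lintegral_congr fun a => lintegral_congr fun b => ?_
    have hiff : ∀ θ, (0 < (a + b) / 2 ∧ ((a - b) / 2 * Real.cos θ) ^ 2
        + ((a - b) / 2 * Real.sin θ) ^ 2 < ((a + b) / 2) ^ 2) ↔ (0 < a ∧ 0 < b) := by
      intro θ
      have : ((a - b) / 2 * Real.cos θ) ^ 2 + ((a - b) / 2 * Real.sin θ) ^ 2 = ((a - b) / 2) ^ 2 := by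
        linear_combination ((a - b) / 2) ^ 2 * Real.sin_sq_add_cos_sq θ
      rw [this]
      constructor
      · rintro ⟨h1, h2⟩
        have h3 : 0 < a * b := by nlinarith
        rcases pos_and_pos_or_neg_and_neg_of_mul_pos h3 with h | h
        · exact h
        · linarith
      · rintro ⟨h1, h2⟩
        exact ⟨by linarith, by nlinarith [mul_pos h1 h2]⟩
    by_cases hab : 0 < a ∧ 0 < b
    · rw [Set.indicator_of_mem (by exact hab)]
      refine lintegral_congr fun θ => ?_
      rw [coneIntegrand, Set.indicator_of_mem (by exact (hiff θ).mpr hab), ← mul_assoc,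
        ← ENNReal.ofReal_mul (abs_nonneg _)]
      have : ((a + b) / 2) ^ 2 - ((a - b) / 2 * Real.cos θ) ^ 2 - ((a - b) / 2 * Real.sin θ) ^ 2
          = a * b := by
        linear_combination -((a - b) / 2) ^ 2 * Real.sin_sq_add_cos_sq θ
      simp only [this, eigenDensity, spectralEntries]
      rw [neg_div]
      congr 2
      ring
    · rw [Set.indicator_of_notMem (by exact hab)]
      symm
      refine (lintegral_congr fun θ => ?_).trans lintegral_zero
      rw [coneIntegrand, Set.indicator_of_notMem (by exact fun h => hab ((hiff θ).mp h)), mul_zero]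
  have hK2 : Measurable (Function.uncurry fun a b => ∫⁻ θ in Set.Ioo (-Real.pi) Real.pi,
      ENNReal.ofReal |a - b| * coneIntegrand m f ((a + b) / 2) ((a - b) / 2 * Real.cos θ)
        ((a - b) / 2 * Real.sin θ)) := by
    refine Measurable.lintegral_prod_right' (f := fun x : (ℝ × ℝ) × ℝ => ENNReal.ofReal |x.1.1 - x.1.2|
      * coneIntegrand m f ((x.1.1 + x.1.2) / 2) ((x.1.1 - x.1.2) / 2 * Real.cos x.2)
          ((x.1.1 - x.1.2) / 2 * Real.sin x.2)) ?_
    exact hK.comp (f := fun x : (ℝ × ℝ) × ℝ => (x.1.1, x.1.2, x.2)) (by fun_prop)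
  have hG3 : Measurable fun s => ∫⁻ x, ∫⁻ c, coneIntegrand m f s x c := by
    refine Measurable.lintegral_prod_right' (f := fun y : ℝ × ℝ => ∫⁻ c, coneIntegrand m f y.1 y.2 c) ?_
    refine Measurable.lintegral_prod_right'
      (f := fun y : (ℝ × ℝ) × ℝ => coneIntegrand m f y.1.1 y.1.2 y.2) ?_
    exact hG.comp (f := fun x : (ℝ × ℝ) × ℝ => (x.1.1, x.1.2, x.2)) (by fun_prop)
  rw [hstep, lintegral_lintegral_add_sub hK2]
  have hinner : ∀ s, ∫⁻ ρ, ∫⁻ θ in Set.Ioo (-Real.pi) Real.pi,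
      ENNReal.ofReal |(s + ρ) - (s - ρ)| * coneIntegrand m f (((s + ρ) + (s - ρ)) / 2)
        (((s + ρ) - (s - ρ)) / 2 * Real.cos θ) (((s + ρ) - (s - ρ)) / 2 * Real.sin θ)
      = 4 * ∫⁻ x, ∫⁻ c, coneIntegrand m f s x c := by
    intro s
    have hgs : Measurable (Function.uncurry fun x c => 2 * coneIntegrand m f s x c) := by
      have : Measurable fun y : ℝ × ℝ => coneIntegrand m f s y.1 y.2 :=
        hG.comp (f := fun y : ℝ × ℝ => (s, y.1, y.2)) (by fun_prop)
      exact this.const_mul 2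
    have h := lintegral_polar_signed hgs
    calc _ = ∫⁻ ρ, ∫⁻ θ in Set.Ioo (-Real.pi) Real.pi, ENNReal.ofReal |ρ| *
          (2 * coneIntegrand m f s (ρ * Real.cos θ) (ρ * Real.sin θ)) := by
          refine lintegral_congr fun ρ => lintegral_congr fun θ => ?_
          rw [show (s + ρ) - (s - ρ) = ρ * 2 by ring, show ((s + ρ) + (s - ρ)) / 2 = s by ring,
            abs_mul, ENNReal.ofReal_mul (abs_nonneg ρ), mul_div_cancel_right₀ _ (two_ne_zero)]
          simp [mul_assoc]
      _ = 2 * ∫⁻ x, ∫⁻ c, 2 * coneIntegrand m f s x c := h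
      _ = 4 * ∫⁻ x, ∫⁻ c, coneIntegrand m f s x c := by
          have : ∀ x, ∫⁻ c, 2 * coneIntegrand m f s x c = 2 * ∫⁻ c, coneIntegrand m f s x c := fun x =>
            lintegral_const_mul' _ _ (by simp)
          simp_rw [this]
          rw [lintegral_const_mul' _ _ (by simp), ← mul_assoc]
          norm_num
  simp_rw [hinner]
  rw [lintegral_const_mul' _ _ (by simp), ← mul_assoc]
  norm_num

theorem lintegral_correlationMeasure (m : ℝ) {f : ℝ × ℝ × ℝ → ENNReal} (hf : Measurable f) :
    ∫⁻ x, ENNReal.ofReal (correlationDensity m x) * f (correlationEntries x) ∂correlationMeasure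
      = 2 * ∫⁻ s, ∫⁻ x, ∫⁻ c, coneIntegrand m f s x c := by
  have hG := measurable_coneIntegrand m hf
  have hm1 : Measurable fun x : (ℝ × ℝ) × ℝ =>
      ENNReal.ofReal (correlationDensity m x) * f (correlationEntries x) := by
    exact (measurable_correlationDensity m).ennreal_ofReal.mul
      (hf.comp measurable_correlationEntries)
  have hK : Measurable (Function.uncurry fun a b =>
      ∫⁻ c, coneIntegrand m f ((a + b) / 2) ((a - b) / 2) c) := by
    refine Measurable.lintegral_prod_right' (f := fun x : (ℝ × ℝ) × ℝ =>
      coneIntegrand m f ((x.1.1 + x.1.2) / 2) ((x.1.1 - x.1.2) / 2) x.2) ?_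
    exact hG.comp (f := fun x : (ℝ × ℝ) × ℝ => ((x.1.1 + x.1.2) / 2, (x.1.1 - x.1.2) / 2, x.2))
      (by fun_prop)
  have h2 := lintegral_lintegral_add_sub hK
  have : ∀ s x : ℝ, ((s + x) + (s - x)) / 2 = s ∧ ((s + x) - (s - x)) / 2 = x := fun s x =>
    ⟨by ring, by ring⟩
  simp only [this] at h2
  rw [← h2, correlationMeasure, lintegral_prod _ hm1.aemeasurable,
      ← lintegral_indicator (measurableSet_Ioi.prod measurableSet_Ioi), Measure.volume_eq_prod,
      lintegral_prod _ ((Measurable.lintegral_prod_right' hm1).indicator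
        (measurableSet_Ioi.prod measurableSet_Ioi)).aemeasurable]
  refine lintegral_congr fun a => lintegral_congr fun b => ?_
  by_cases hab : 0 < a ∧ 0 < b
  · have hab' : 0 < a * b := mul_pos hab.1 hab.2
    have hs : 0 < √(a * b) := Real.sqrt_pos.mpr hab'
    have hm : Measurable fun c => coneIntegrand m f ((a + b) / 2) ((a - b) / 2) c :=
      hG.comp (f := fun c : ℝ => ((a + b) / 2, (a - b) / 2, c)) (by fun_prop)
    rw [Set.indicator_of_mem (by exact hab), ← lintegral_comp_mul_left_eq hm hs.ne',
      ← lintegral_const_mul' _ _ (by simp), ← lintegral_indicator measurableSet_Ioo]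
    refine lintegral_congr fun t => ?_
    have hsq : √(a * b) ^ 2 = a * b := Real.sq_sqrt hab'.le
    have hdet : ((a + b) / 2) ^ 2 - ((a - b) / 2) ^ 2 - (√(a * b) * t) ^ 2 = a * b * (1 - t ^ 2) := by
      rw [mul_pow, hsq]; ring
    have hiff : (0 < (a + b) / 2 ∧ ((a - b) / 2) ^ 2 + (√(a * b) * t) ^ 2 < ((a + b) / 2) ^ 2)
        ↔ t ∈ Set.Ioo (-1 : ℝ) 1 := by
      have h1 : 0 < (a + b) / 2 := by linarith [hab.1, hab.2]
      have h2 : ((a - b) / 2) ^ 2 + (√(a * b) * t) ^ 2 < ((a + b) / 2) ^ 2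
          ↔ 0 < a * b * (1 - t ^ 2) := by
        rw [← hdet]; constructor <;> intro h <;> linarith
      rw [h2, mul_pos_iff_of_pos_left hab', sub_pos, sq_lt_one_iff_abs_lt_one, abs_lt]
      simp [h1]
    by_cases ht : t ∈ Set.Ioo (-1 : ℝ) 1
    · have ht' : 0 < 1 - t ^ 2 := by
        have := (sq_lt_one_iff_abs_lt_one t).mpr (abs_lt.mpr ht)
        linarith
      rw [Set.indicator_of_mem ht, coneIntegrand, Set.indicator_of_mem (by exact hiff.mpr ht),
        ← mul_assoc, ← ENNReal.ofReal_mul (abs_nonneg _)]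
      simp only [hdet, correlationDensity, correlationEntries]
      rw [show (a + b) / 2 + (a - b) / 2 = a by ring, show (a + b) / 2 - (a - b) / 2 = b by ring,
        Real.mul_rpow hab'.le ht'.le, Real.rpow_add hab', ← Real.sqrt_eq_rpow, abs_of_pos hs, neg_div]
      congr 2
      ring
    · rw [Set.indicator_of_notMem ht, coneIntegrand,
        Set.indicator_of_notMem (by exact fun h => ht (hiff.mp h)), mul_zero]
  · rw [Set.indicator_of_notMem (by exact hab)]
    symm
    refine (lintegral_congr fun c => ?_).trans lintegral_zero
    rw [coneIntegrand, Set.indicator_of_notMem]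
    rintro ⟨h1, h2⟩
    simp only at h1 h2
    have h3 : 0 < a * b := by nlinarith [sq_nonneg c]
    rcases pos_and_pos_or_neg_and_neg_of_mul_pos h3 with h | h
    · exact hab h
    · linarith

theorem map_spectralEntries_eq (m : ℝ) :
    (eigenMeasure.withDensity fun x => ENNReal.ofReal (eigenDensity m x.1)).map spectralEntries
      = (4 : ENNReal) • (correlationMeasure.withDensity
          fun x => ENNReal.ofReal (correlationDensity m x)).map correlationEntries := by
  refine Measure.ext_of_lintegral _ fun f hf => ?_
  have hd1 : Measurable fun x : (ℝ × ℝ) × ℝ => ENNReal.ofReal (eigenDensity m x.1) :=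
    ((measurable_eigenDensity m).comp measurable_fst).ennreal_ofReal
  have hd2 := (measurable_correlationDensity m).ennreal_ofReal
  have hf1 : Measurable fun x => f (spectralEntries x) := hf.comp measurable_spectralEntries
  have hf2 : Measurable fun x => f (correlationEntries x) := hf.comp measurable_correlationEntries
  rw [lintegral_smul_measure, lintegral_map hf measurable_spectralEntries,
    lintegral_map hf measurable_correlationEntries,
    lintegral_withDensity_eq_lintegral_mul _ hd1 hf1,
    lintegral_withDensity_eq_lintegral_mul _ hd2 hf2]
  refine (lintegral_eigenMeasure m hf).trans ?_
  refine Eq.trans ?_ (congrArg (4 * ·) (lintegral_correlationMeasure m hf).symm)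
  simp only [← mul_assoc]
  norm_num

theorem integral_eigenMeasure (m : ℝ) {g : ℝ × ℝ × ℝ → ℂ} (hg : Measurable g) :
    ∫ x, (eigenDensity m x.1 : ℂ) * g (spectralEntries x) ∂eigenMeasure
      = 4 * ∫ x, (correlationDensity m x : ℂ) * g (correlationEntries x) ∂correlationMeasure := by
  have hd1 : Measurable fun x : (ℝ × ℝ) × ℝ => ENNReal.ofReal (eigenDensity m x.1) :=
    ((measurable_eigenDensity m).comp measurable_fst).ennreal_ofReal
  have h := congrArg (fun μ => ∫ y, g y ∂μ) (map_spectralEntries_eq m)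
  simp only [integral_smul_measure] at h
  rw [integral_map measurable_spectralEntries.aemeasurable hg.aestronglyMeasurable,
    integral_map measurable_correlationEntries.aemeasurable hg.aestronglyMeasurable,
    integral_withDensity_eq_integral_toReal_smul hd1 (by simp),
    integral_withDensity_eq_integral_toReal_smul
      (measurable_correlationDensity m).ennreal_ofReal (by simp)] at h
  have e1 : ∫ x, (eigenDensity m x.1 : ℂ) * g (spectralEntries x) ∂eigenMeasure
      = ∫ x, (ENNReal.ofReal (eigenDensity m x.1)).toReal • g (spectralEntries x) ∂eigenMeasure := by
    refine integral_congr_ae ?_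
    rw [eigenMeasure, Measure.prod_restrict]
    refine ae_restrict_of_forall_mem
      ((measurableSet_Ioi.prod measurableSet_Ioi).prod measurableSet_Ioo) fun x hx => ?_
    have h1 : (0 : ℝ) < x.1.1 := hx.1.1
    have h2 : (0 : ℝ) < x.1.2 := hx.1.2
    have : 0 ≤ eigenDensity m x.1 := by unfold eigenDensity; positivity
    simp [ENNReal.toReal_ofReal this]
  have e2 : ∫ x, (correlationDensity m x : ℂ) * g (correlationEntries x) ∂correlationMeasure
      = ∫ x, (ENNReal.ofReal (correlationDensity m x)).toReal • g (correlationEntries x)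
          ∂correlationMeasure := by
    refine integral_congr_ae ?_
    rw [correlationMeasure, Measure.prod_restrict]
    refine ae_restrict_of_forall_mem
      ((measurableSet_Ioi.prod measurableSet_Ioi).prod measurableSet_Ioo) fun x hx => ?_
    have h1 : (0 : ℝ) < x.1.1 := hx.1.1
    have h2 : (0 : ℝ) < x.1.2 := hx.1.2
    have h3 : 0 ≤ 1 - x.2 ^ 2 := by
      have := (sq_lt_one_iff_abs_lt_one x.2).mpr (abs_lt.mpr hx.2)
      linarith
    have : 0 ≤ correlationDensity m x := by unfold correlationDensity; positivity
    simp [ENNReal.toReal_ofReal this]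
  rw [e1, e2, h]
  simp

theorem integrableOn_rpow_mul_cexp {s : ℝ} (hs : -1 < s) {z : ℂ} (hz : 0 < z.re) :
    IntegrableOn (fun a : ℝ => ((a ^ s : ℝ) : ℂ) * Complex.exp (-z * a)) (Set.Ioi 0) := by
  have h := integrableOn_rpow_mul_exp_neg_mul_rpow hs one_pos hz
  refine Integrable.mono' h (by fun_prop) (ae_restrict_of_forall_mem measurableSet_Ioi ?_)
  intro a ha
  rw [norm_mul, Complex.norm_exp, Complex.norm_real, Real.norm_of_nonneg
    (Real.rpow_nonneg (le_of_lt ha) _)]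
  simp

theorem integral_rpow_mul_cexp {n : ℕ} (hn : n ≠ 0) {z : ℂ} (hz : 0 < z.re) :
    ∫ a in Set.Ioi (0 : ℝ), ((a ^ ((n : ℝ) / 2 - 1) : ℝ) : ℂ) * Complex.exp (-z * a)
      = (Real.Gamma (n / 2) / Real.pi ^ ((n : ℝ) / 2) : ℝ) * ((Real.pi / z) ^ (1 / 2 : ℂ)) ^ n := by
  have : NeZero n := ⟨hn⟩
  have : Nonempty (Fin n) := ⟨0⟩
  obtain ⟨K, hK⟩ : ∃ K : ℝ, ∀ z : ℂ, 0 < z.re →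
      (K : ℂ) * ∫ a in Set.Ioi (0 : ℝ), ((a ^ ((n : ℝ) / 2 - 1) : ℝ) : ℂ) * Complex.exp (-z * a)
        = (Real.pi / z) ^ ((n : ℂ) / 2) := by
    refine ⟨n * volume.real (Metric.ball (0 : EuclideanSpace ℝ (Fin n)) 1) / 2, fun z hz => ?_⟩
    have h1 := GaussianFourier.integral_cexp_neg_mul_sq_norm (V := EuclideanSpace ℝ (Fin n)) hz
    have h2 := integral_fun_norm_addHaar (volume : Measure (EuclideanSpace ℝ (Fin n)))
      (fun y => Complex.exp (-z * (y : ℂ) ^ 2))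
    rw [h1] at h2
    have h3 := integral_comp_rpow_Ioi_of_pos (p := 2)
      (g := fun a : ℝ => ((a ^ ((n : ℝ) / 2 - 1) : ℝ) : ℂ) * Complex.exp (-z * a)) two_pos
    simp only [finrank_euclideanSpace, Fintype.card_fin] at h2
    rw [h2, ← h3]
    simp only [nsmul_eq_mul, Complex.real_smul]
    push_cast
    rw [mul_div_assoc, mul_assoc, div_eq_mul_inv, mul_assoc, ← mul_assoc]
    rw [← integral_const_mul (2 : ℂ)⁻¹, mul_assoc]
    congr 2
    refine setIntegral_congr_fun measurableSet_Ioi fun y hy => ?_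
    have hy' : (0 : ℝ) < y := hy
    have e1 : y ^ (n - 1) = y * (y ^ (2 : ℝ)) ^ ((n : ℝ) / 2 - 1) := by
      rw [← Real.rpow_mul hy'.le]
      nth_rw 2 [← Real.rpow_one y]
      rw [← Real.rpow_add hy', ← Real.rpow_natCast, Nat.cast_sub (Nat.one_le_iff_ne_zero.mpr hn)]
      congr 1
      push_cast
      ring
    have e2 : (((y ^ (2 : ℝ) : ℝ)) : ℂ) = (y : ℂ) ^ 2 := by
      rw [Real.rpow_two]; push_cast; ring
    have e3 : (2 : ℝ) - 1 = 1 := by norm_num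
    simp only [e3, Real.rpow_one]
    rw [← Complex.ofReal_pow y (n - 1), e1]
    push_cast [e2]
    ring
  have hz0 : z ≠ 0 := by rintro rfl; simp at hz
  have h1 := hK 1 (by simp)
  have hg : ∫ a in Set.Ioi (0 : ℝ), ((a ^ ((n : ℝ) / 2 - 1) : ℝ) : ℂ) * Complex.exp (-1 * a)
      = (Real.Gamma (n / 2) : ℝ) := by
    rw [Real.Gamma_eq_integral (by positivity), ← integral_complex_ofReal]
    congr 1 with a
    push_cast
    rw [mul_comm]
    simp
  have hpi : ((Real.pi / 1 : ℂ)) ^ ((n : ℂ) / 2) = (Real.pi ^ ((n : ℝ) / 2) : ℝ) := by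
    rw [Complex.ofReal_cpow Real.pi_pos.le]
    simp
  rw [hg, hpi] at h1
  have h2 := hK z hz
  have hpos : (Real.pi ^ ((n : ℝ) / 2) : ℝ) ≠ 0 := (Real.rpow_pos_of_pos Real.pi_pos _).ne'
  have hKne : (K : ℂ) ≠ 0 := by
    intro h0
    rw [h0, zero_mul] at h1
    exact hpos (by exact_mod_cast h1.symm)
  have e4 : ((Real.pi / z) ^ (1 / 2 : ℂ)) ^ n = (Real.pi / z) ^ ((n : ℂ) / 2) := by
    rw [← Complex.cpow_nat_mul]
    congr 1
    ring
  rw [e4, ← h2]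
  have hpos' : ((Real.pi ^ ((n : ℝ) / 2) : ℝ) : ℂ) ≠ 0 := by exact_mod_cast hpos
  push_cast at hpos' h1 ⊢
  rw [div_mul_eq_mul_div, eq_div_iff hpos', ← h1]
  ring

theorem integral_one_sub_sq_rpow {s : ℝ} (hs : 0 < s) :
    ∫ t in Set.Ioo (-1 : ℝ) 1, (1 - t ^ 2) ^ (s - 1)
      = 2 ^ (2 * s - 1) * (Real.Gamma s ^ 2 / Real.Gamma (2 * s)) := by
  have h := Complex.Gamma_mul_Gamma_eq_betaIntegral (s := s) (t := s) (by simpa) (by simpa)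
  have hb : Complex.betaIntegral s s = ((∫ x in (0 : ℝ)..1, (x * (1 - x)) ^ (s - 1) : ℝ) : ℂ) := by
    rw [Complex.betaIntegral, ← intervalIntegral.integral_ofReal]
    refine intervalIntegral.integral_congr fun x hx => ?_
    rw [Set.uIcc_of_le zero_le_one] at hx
    rw [Real.mul_rpow hx.1 (by linarith [hx.2])]
    push_cast
    rw [Complex.ofReal_cpow hx.1, Complex.ofReal_cpow (by linarith [hx.2])]
    push_cast
    rfl
  rw [hb] at h
  have hr : Real.Gamma s * Real.Gamma s
      = Real.Gamma (2 * s) * ∫ x in (0 : ℝ)..1, (x * (1 - x)) ^ (s - 1) := by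
    rw [two_mul]
    rw [← Complex.ofReal_add, Complex.Gamma_ofReal, Complex.Gamma_ofReal] at h
    exact_mod_cast h
  rw [← integral_Ioc_eq_integral_Ioo, ← intervalIntegral.integral_of_le (by norm_num)]
  have hsub := intervalIntegral.integral_comp_mul_sub (a := 0) (b := 1) (c := (2 : ℝ))
    (f := fun t => (1 - t ^ 2) ^ (s - 1)) two_ne_zero 1
  have e : (∫ x in (0 : ℝ)..1, (1 - (2 * x - 1) ^ 2) ^ (s - 1))
      = 4 ^ (s - 1) * ∫ x in (0 : ℝ)..1, (x * (1 - x)) ^ (s - 1) := by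
    rw [← intervalIntegral.integral_const_mul]
    refine intervalIntegral.integral_congr fun x hx => ?_
    rw [Set.uIcc_of_le zero_le_one] at hx
    rw [← Real.mul_rpow (by norm_num) (mul_nonneg hx.1 (by linarith [hx.2]))]
    congr 1
    ring
  rw [e] at hsub
  norm_num at hsub
  have hG : Real.Gamma (2 * s) ≠ 0 := (Real.Gamma_pos_of_pos (by positivity)).ne'
  have h4 : (2 : ℝ) ^ (2 * s - 1) = 2 * 4 ^ (s - 1) := by
    rw [show (4 : ℝ) = 2 ^ (2 : ℝ) by norm_num, ← Real.rpow_mul (by norm_num),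
      show 2 * s - 1 = 1 + 2 * (s - 1) by ring, Real.rpow_add (by norm_num), Real.rpow_one]
  rw [h4, sq, hr, mul_div_cancel_left₀ _ hG]
  linarith

theorem integral_one_sub_sq_rpow_mul_Gamma_sq {n : ℕ} (hn : 2 ≤ n) :
    (∫ t in Set.Ioo (-1 : ℝ) 1, (1 - t ^ 2) ^ (((n : ℝ) - 3) / 2)) * Real.Gamma (n / 2) ^ 2
      = 4 * Real.pi * (Nat.factorial (n - 2)) / 2 ^ n := by
  have hn' : (2 : ℝ) ≤ n := by exact_mod_cast hn
  have h := integral_one_sub_sq_rpow (s := ((n : ℝ) - 1) / 2) (by linarith)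
  rw [show ((n : ℝ) - 1) / 2 - 1 = ((n : ℝ) - 3) / 2 by ring,
    show 2 * (((n : ℝ) - 1) / 2) - 1 = n - 2 by ring,
    show 2 * (((n : ℝ) - 1) / 2) = n - 1 by ring] at h
  have hd := Real.Gamma_mul_Gamma_add_half (((n : ℝ) - 1) / 2)
  rw [show ((n : ℝ) - 1) / 2 + 1 / 2 = (n : ℝ) / 2 by ring,
    show 2 * (((n : ℝ) - 1) / 2) = n - 1 by ring] at hd
  have hf : Real.Gamma ((n : ℝ) - 1) = Nat.factorial (n - 2) := by
    rw [← Real.Gamma_nat_eq_factorial]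
    congr 1
    push_cast [Nat.cast_sub hn]
    ring
  have hfne : (Nat.factorial (n - 2) : ℝ) ≠ 0 := by positivity
  rw [h, hf]
  rw [hf] at hd
  have hs : √Real.pi ^ 2 = Real.pi := Real.sq_sqrt Real.pi_pos.le
  have hp1 : (2 : ℝ) ^ ((n : ℝ) - 2) = 2 ^ n / 4 := by
    rw [Real.rpow_sub (by norm_num), Real.rpow_natCast]; norm_num
  have hp2 : (2 : ℝ) ^ (1 - ((n : ℝ) - 1)) = 4 / 2 ^ n := by
    rw [show 1 - ((n : ℝ) - 1) = 2 - n by ring, Real.rpow_sub (by norm_num), Real.rpow_natCast]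
    norm_num
  rw [hp2] at hd
  rw [hp1]
  have : (2 : ℝ) ^ n / 4 * (Real.Gamma ((n - 1) / 2) ^ 2 / (Nat.factorial (n - 2)))
      * Real.Gamma (n / 2) ^ 2 = 2 ^ n / 4 *
        (Real.Gamma ((n - 1) / 2) * Real.Gamma (n / 2)) ^ 2 / (Nat.factorial (n - 2)) := by ring
  rw [this, hd, mul_pow, hs]
  field_simp

theorem integrableOn_one_sub_sq_rpow {n : ℕ} (hn : 2 ≤ n) :
    IntegrableOn (fun t : ℝ => (1 - t ^ 2) ^ (((n : ℝ) - 3) / 2)) (Set.Ioo (-1) 1) := by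
  have h := integral_one_sub_sq_rpow_mul_Gamma_sq hn
  refine Integrable.of_integral_ne_zero fun h0 => ?_
  rw [h0, zero_mul] at h
  have : 0 < 4 * Real.pi * (Nat.factorial (n - 2)) / 2 ^ n := by positivity
  exact this.ne h

theorem integral_mul_one_sub_sq_rpow (s : ℝ) :
    ∫ t in Set.Ioo (-1 : ℝ) 1, t * (1 - t ^ 2) ^ s = 0 := by
  rw [← integral_Ioc_eq_integral_Ioo, ← intervalIntegral.integral_of_le (by norm_num)]
  have h := intervalIntegral.integral_comp_neg (a := -1) (b := 1)
    (fun t : ℝ => t * (1 - t ^ 2) ^ s)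
  simp only [neg_mul, neg_neg, even_two.neg_pow, intervalIntegral.integral_neg] at h
  linarith

theorem integrable_correlationMeasure_mul {f₁ f₂ f₃ : ℝ → ℂ} (h₁ : IntegrableOn f₁ (Set.Ioi 0))
    (h₂ : IntegrableOn f₂ (Set.Ioi 0)) (h₃ : IntegrableOn f₃ (Set.Ioo (-1) 1)) (C : ℂ) :
    Integrable (fun x => C * (f₁ x.1.1 * f₂ x.1.2 * f₃ x.2)) correlationMeasure := by
  unfold correlationMeasure
  rw [Measure.volume_eq_prod, ← Measure.prod_restrict]
  exact ((h₁.mul_prod h₂).mul_prod h₃).const_mul C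

theorem integral_correlationMeasure_mul (f₁ f₂ f₃ : ℝ → ℂ) (C : ℂ) :
    ∫ x, C * (f₁ x.1.1 * f₂ x.1.2 * f₃ x.2) ∂correlationMeasure
      = C * ((∫ a in Set.Ioi 0, f₁ a) * (∫ b in Set.Ioi 0, f₂ b)
          * ∫ t in Set.Ioo (-1) 1, f₃ t) := by
  unfold correlationMeasure
  rw [Measure.volume_eq_prod, ← Measure.prod_restrict, integral_const_mul,
    integral_prod_mul (fun y : ℝ × ℝ => f₁ y.1 * f₂ y.2), integral_prod_mul]

/-- A quadratic polynomial in the entries `(R₁₁, R₂₂, R₁₂)` of a symmetric matrix, times the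
character `exp (-i (b₁ R₁₁ + b₂ R₂₂))`. -/
noncomputable def twistedQuadratic (b₁ b₂ : ℝ) (C₀ C₁ C₂ C₃ C₄ : ℂ) (y : ℝ × ℝ × ℝ) : ℂ :=
  Complex.exp (-Complex.I * (y.1 * b₁ + y.2.1 * b₂)) *
    (C₀ + C₁ * y.1 + C₂ * y.2.1 + C₃ * y.2.2 + C₄ * (y.1 * y.2.1 - y.2.2 ^ 2))

theorem integral_eigenMeasure_quadratic {n : ℕ} (hn : 2 ≤ n) (b₁ b₂ : ℝ) (C₀ C₁ C₂ C₃ C₄ : ℂ) :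
    ∫ x, (eigenDensity (((n : ℝ) - 3) / 2) x.1 : ℂ) *
        twistedQuadratic b₁ b₂ C₀ C₁ C₂ C₃ C₄ (spectralEntries x) ∂eigenMeasure
      = 16 * Real.pi * (Nat.factorial (n - 2)) / (2 * Real.pi) ^ n *
        ((Real.pi / (1 / 2 + Complex.I * b₁)) ^ (1 / 2 : ℂ)) ^ n *
        ((Real.pi / (1 / 2 + Complex.I * b₂)) ^ (1 / 2 : ℂ)) ^ n *
        (C₀ + C₁ * n / (1 + 2 * Complex.I * b₁) + C₂ * n / (1 + 2 * Complex.I * b₂)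
          + C₄ * (n * (n - 1)) / ((1 + 2 * Complex.I * b₁) * (1 + 2 * Complex.I * b₂))) := by
  rw [integral_eigenMeasure _ (by unfold twistedQuadratic; fun_prop)]
  set z₁ : ℂ := 1 / 2 + Complex.I * b₁ with hz₁
  set z₂ : ℂ := 1 / 2 + Complex.I * b₂ with hz₂
  have hz₁' : 0 < z₁.re := by simp [hz₁]
  have hz₂' : 0 < z₂.re := by simp [hz₂]
  have hz₁0 : z₁ ≠ 0 := fun h => by simp [h] at hz₁'
  have hz₂0 : z₂ ≠ 0 := fun h => by simp [h] at hz₂'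
  have hn' : (2 : ℝ) ≤ n := by exact_mod_cast hn
  have hn2 : (-1 : ℝ) < (((n + 2 : ℕ) : ℝ)) / 2 - 1 := by push_cast; linarith
  have hn0 : (-1 : ℝ) < (n : ℝ) / 2 - 1 := by linarith
  have hnh : (-1 : ℝ) < (n : ℝ) / 2 - 1 / 2 := by linarith
  let f : ℝ → ℂ → ℝ → ℂ := fun s z a => ((a ^ s : ℝ) : ℂ) * Complex.exp (-z * a)
  let k : ℝ → ℝ → ℂ := fun s t => (((1 - t ^ 2) ^ s : ℝ) : ℂ)
  let k' : ℝ → ℂ := fun t => ((t * (1 - t ^ 2) ^ (((n : ℝ) - 3) / 2) : ℝ) : ℂ)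
  have hk0 : IntegrableOn (k (((n : ℝ) - 3) / 2)) (Set.Ioo (-1) 1) :=
    (integrableOn_one_sub_sq_rpow hn).ofReal
  have hk2 : IntegrableOn (k ((((n + 2 : ℕ) : ℝ) - 3) / 2)) (Set.Ioo (-1) 1) :=
    (integrableOn_one_sub_sq_rpow (n := n + 2) (by omega)).ofReal
  have hk1 : IntegrableOn k' (Set.Ioo (-1) 1) := by
    refine Integrable.ofReal (𝕜 := ℂ) (f := fun t : ℝ => t * (1 - t ^ 2) ^ (((n : ℝ) - 3) / 2)) ?_
    refine Integrable.mono (integrableOn_one_sub_sq_rpow hn) (by fun_prop)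
      (ae_restrict_of_forall_mem measurableSet_Ioo fun t ht => ?_)
    rw [norm_mul]
    refine mul_le_of_le_one_left (norm_nonneg _) ?_
    rw [Real.norm_eq_abs, abs_le]
    exact ⟨ht.1.le, ht.2.le⟩
  have hf : ∀ s, -1 < s → ∀ z : ℂ, 0 < z.re → IntegrableOn (f s z) (Set.Ioi 0) :=
    fun s hs z hz => integrableOn_rpow_mul_cexp hs hz
  have i0 := integrable_correlationMeasure_mul (hf _ hn0 _ hz₁') (hf _ hn0 _ hz₂') hk0 C₀
  have i1 := integrable_correlationMeasure_mul (hf _ hn2 _ hz₁') (hf _ hn0 _ hz₂') hk0 C₁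
  have i2 := integrable_correlationMeasure_mul (hf _ hn0 _ hz₁') (hf _ hn2 _ hz₂') hk0 C₂
  have i3 := integrable_correlationMeasure_mul (hf _ hnh _ hz₁') (hf _ hnh _ hz₂') hk1 C₃
  have i4 := integrable_correlationMeasure_mul (hf _ hn2 _ hz₁') (hf _ hn2 _ hz₂') hk2 C₄
  have hcongr : ∫ x, (correlationDensity (((n : ℝ) - 3) / 2) x : ℂ) *
        twistedQuadratic b₁ b₂ C₀ C₁ C₂ C₃ C₄ (correlationEntries x) ∂correlationMeasure
      = ∫ x, (C₀ * (f (n / 2 - 1) z₁ x.1.1 * f (n / 2 - 1) z₂ x.1.2 * k (((n : ℝ) - 3) / 2) x.2)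
        + C₁ * (f (((n + 2 : ℕ) : ℝ) / 2 - 1) z₁ x.1.1 * f (n / 2 - 1) z₂ x.1.2
            * k (((n : ℝ) - 3) / 2) x.2)
        + C₂ * (f (n / 2 - 1) z₁ x.1.1 * f (((n + 2 : ℕ) : ℝ) / 2 - 1) z₂ x.1.2
            * k (((n : ℝ) - 3) / 2) x.2)
        + C₃ * (f (n / 2 - 1 / 2) z₁ x.1.1 * f (n / 2 - 1 / 2) z₂ x.1.2 * k' x.2)
        + C₄ * (f (((n + 2 : ℕ) : ℝ) / 2 - 1) z₁ x.1.1 * f (((n + 2 : ℕ) : ℝ) / 2 - 1) z₂ x.1.2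
            * k ((((n + 2 : ℕ) : ℝ) - 3) / 2) x.2)) ∂correlationMeasure := by
    refine integral_congr_ae ?_
    unfold correlationMeasure
    rw [Measure.prod_restrict]
    refine ae_restrict_of_forall_mem
      ((measurableSet_Ioi.prod measurableSet_Ioi).prod measurableSet_Ioo) ?_
    rintro ⟨⟨a, b⟩, t⟩ ⟨⟨ha, hb⟩, ht⟩
    simp only [Set.mem_Ioi, Set.mem_Ioo] at ha hb ht
    have ht2 : 0 < 1 - t ^ 2 := by nlinarith
    have r1 : ∀ a : ℝ, 0 < a → a ^ (((n + 2 : ℕ) : ℝ) / 2 - 1) = a * a ^ ((n : ℝ) / 2 - 1) := by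
      intro a ha
      rw [← Real.rpow_one_add' ha.le (by linarith)]
      congr 1; push_cast; ring
    have r2 : ∀ a : ℝ, 0 < a → a ^ ((n : ℝ) / 2 - 1 / 2) = √a * a ^ ((n : ℝ) / 2 - 1) := by
      intro a ha
      rw [Real.sqrt_eq_rpow, ← Real.rpow_add ha]
      congr 1; ring
    have r3 : (1 - t ^ 2) ^ ((((n + 2 : ℕ) : ℝ) - 3) / 2)
        = (1 - t ^ 2) * (1 - t ^ 2) ^ (((n : ℝ) - 3) / 2) := by
      nth_rw 2 [← Real.rpow_one (1 - t ^ 2)]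
      rw [← Real.rpow_add ht2]
      congr 1; push_cast; ring
    have r4 : (a * b) ^ (((n : ℝ) - 3) / 2 + 1 / 2)
        = a ^ ((n : ℝ) / 2 - 1) * b ^ ((n : ℝ) / 2 - 1) := by
      rw [← Real.mul_rpow ha.le hb.le]
      congr 1; ring
    have r5 : √(a * b) = √a * √b := Real.sqrt_mul ha.le b
    have r6 : ((√a * √b * t : ℝ) : ℂ) ^ 2 = a * b * t ^ 2 := by
      rw [← Complex.ofReal_pow, mul_pow, mul_pow, Real.sq_sqrt ha.le, Real.sq_sqrt hb.le]
      push_cast; ring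
    have he : (Real.exp (-(a + b) / 2) : ℂ) * Complex.exp (-Complex.I * (a * b₁ + b * b₂))
        = Complex.exp (-z₁ * a) * Complex.exp (-z₂ * b) := by
      rw [Complex.ofReal_exp, ← Complex.exp_add, ← Complex.exp_add]
      congr 1
      rw [hz₁, hz₂]; push_cast; ring
    simp only [correlationDensity, correlationEntries, twistedQuadratic, f, k, k',
      r1 a ha, r1 b hb, r2 a ha,
      r2 b hb, r3, r4, r5, r6]
    push_cast
    rw [Complex.ofReal_exp] at he
    push_cast at he
    linear_combination ((a ^ ((n : ℝ) / 2 - 1) : ℝ) : ℂ) * ((b ^ ((n : ℝ) / 2 - 1) : ℝ) : ℂ) *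
      (((1 - t ^ 2) ^ (((n : ℝ) - 3) / 2) : ℝ) : ℂ) *
      (C₀ + C₁ * a + C₂ * b + C₃ * (√a * √b * t) + C₄ * (a * b - a * b * t ^ 2)) * he
  rw [hcongr, integral_add (((i0.fun_add i1).fun_add i2).fun_add i3) i4,
    integral_add ((i0.fun_add i1).fun_add i2) i3, integral_add (i0.fun_add i1) i2,
    integral_add i0 i1]
  simp only [integral_correlationMeasure_mul]
  have v0 : ∀ z : ℂ, 0 < z.re → ∫ a in Set.Ioi 0, f (n / 2 - 1) z a = _ :=
    fun z hz => integral_rpow_mul_cexp (by omega) hz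
  have v2 : ∀ z : ℂ, 0 < z.re → ∫ a in Set.Ioi 0, f (((n + 2 : ℕ) : ℝ) / 2 - 1) z a
      = (Real.Gamma (n / 2) / Real.pi ^ ((n : ℝ) / 2) : ℝ) * ((Real.pi / z) ^ (1 / 2 : ℂ)) ^ n
        * (n / (2 * z)) := by
    intro z hz
    have hz0 : z ≠ 0 := fun h => by simp [h] at hz
    have hpi : (Real.pi : ℂ) ≠ 0 := by exact_mod_cast Real.pi_ne_zero
    refine (integral_rpow_mul_cexp (n := n + 2) (by omega) hz).trans ?_
    rw [show (((n + 2 : ℕ) : ℝ)) / 2 = n / 2 + 1 by push_cast; ring,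
      Real.Gamma_add_one (by positivity), Real.rpow_add_one Real.pi_ne_zero, pow_add,
      ← Complex.cpow_nat_mul _ 2]
    norm_num
    field_simp
  have w0 : ∫ t in Set.Ioo (-1) 1, k (((n : ℝ) - 3) / 2) t
      = ((∫ t in Set.Ioo (-1 : ℝ) 1, (1 - t ^ 2) ^ (((n : ℝ) - 3) / 2) : ℝ) : ℂ) :=
    integral_ofReal
  have w1 : ∫ t in Set.Ioo (-1) 1, k' t
      = ((∫ t in Set.Ioo (-1 : ℝ) 1, t * (1 - t ^ 2) ^ (((n : ℝ) - 3) / 2) : ℝ) : ℂ) :=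
    integral_ofReal
  have w2 : ∫ t in Set.Ioo (-1) 1, k ((((n + 2 : ℕ) : ℝ) - 3) / 2) t
      = ((∫ t in Set.Ioo (-1 : ℝ) 1, (1 - t ^ 2) ^ ((((n + 2 : ℕ) : ℝ) - 3) / 2) : ℝ) : ℂ) :=
    integral_ofReal
  rw [v0 z₁ hz₁', v0 z₂ hz₂', v2 z₁ hz₁', v2 z₂ hz₂', w0, w1, w2, integral_mul_one_sub_sq_rpow]
  have K0 := integral_one_sub_sq_rpow_mul_Gamma_sq hn
  have K2 := integral_one_sub_sq_rpow_mul_Gamma_sq (n := n + 2) (by omega)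
  rw [show (((n + 2 : ℕ) : ℝ)) / 2 = n / 2 + 1 by push_cast; ring,
      Real.Gamma_add_one (by positivity)] at K2
  set κ₀ := ∫ t in Set.Ioo (-1 : ℝ) 1, (1 - t ^ 2) ^ (((n : ℝ) - 3) / 2)
  set κ₂ := ∫ t in Set.Ioo (-1 : ℝ) 1, (1 - t ^ 2) ^ ((((n + 2 : ℕ) : ℝ) - 3) / 2)
  have hfac : (Nat.factorial (n + 2 - 2) : ℝ) = n * (n - 1) * Nat.factorial (n - 2) := by
    obtain ⟨q, rfl⟩ := Nat.exists_eq_add_of_le hn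
    simp only [Nat.add_sub_cancel, Nat.add_sub_cancel_left]
    rw [add_comm 2 q, Nat.factorial_succ, Nat.factorial_succ]
    push_cast; ring
  rw [hfac] at K2
  have hnn : (n : ℝ) ≠ 0 := by linarith
  have K2' : κ₂ * Real.Gamma (n / 2) ^ 2 * n = κ₀ * Real.Gamma (n / 2) ^ 2 * (n - 1) := by
    rw [K0]
    have h2n : (2 : ℝ) ^ (n + 2) = 4 * 2 ^ n := by ring
    rw [h2n] at K2
    have h2 : (2 : ℝ) ^ n ≠ 0 := by positivity
    rw [eq_div_iff (by positivity)] at K2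
    rw [div_mul_eq_mul_div, eq_div_iff h2]
    have : (n : ℝ) * (κ₂ * Real.Gamma (n / 2) ^ 2 * n * 2 ^ n) =
      n * (4 * Real.pi * (Nat.factorial (n - 2)) * (n - 1)) := by
      linear_combination K2
    exact mul_left_cancel₀ hnn this
  have hpin : (Real.pi ^ ((n : ℝ) / 2)) * Real.pi ^ ((n : ℝ) / 2) = Real.pi ^ n := by
    rw [← Real.rpow_add Real.pi_pos, ← Real.rpow_natCast]
    congr 1; ring
  rw [show 1 + 2 * Complex.I * b₁ = 2 * z₁ by rw [hz₁]; ring,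
    show 1 + 2 * Complex.I * b₂ = 2 * z₂ by rw [hz₂]; ring]
  set G₁ := ((Real.pi / z₁) ^ (1 / 2 : ℂ)) ^ n
  set G₂ := ((Real.pi / z₂) ^ (1 / 2 : ℂ)) ^ n
  set P := Real.pi ^ ((n : ℝ) / 2)
  have hP : (P : ℂ) ≠ 0 := by
    have : P ≠ 0 := (Real.rpow_pos_of_pos Real.pi_pos _).ne'
    exact_mod_cast this
  set g := Real.Gamma (n / 2)
  have K0c : (κ₀ : ℂ) * g ^ 2 * 2 ^ n = 4 * Real.pi * (Nat.factorial (n - 2)) := by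
    have h2 : (2 : ℝ) ^ n ≠ 0 := by positivity
    have := (eq_div_iff h2).mp K0
    exact_mod_cast this
  have K2c : (κ₂ : ℂ) * g ^ 2 * n = κ₀ * g ^ 2 * (n - 1) := by exact_mod_cast K2'
  have hpc : (Real.pi : ℂ) ^ n = P * P := by exact_mod_cast hpin.symm
  have h2c : (2 : ℂ) ^ n ≠ 0 := pow_ne_zero _ two_ne_zero
  rw [mul_pow, hpc]
  push_cast
  have hgoal : (16 * Real.pi * (Nat.factorial (n - 2)) / (2 ^ n * (P * P)) : ℂ)
      = 4 * (κ₀ * g ^ 2 / (P * P)) := by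
    field_simp
    linear_combination -4 * K0c
  have hgoal2 : (κ₂ * g ^ 2 : ℂ) * (n * n) = κ₀ * g ^ 2 * (n * (n - 1)) := by
    linear_combination (n : ℂ) * K2c
  rw [hgoal]
  have t4 : C₄ * (g / P * G₁ * (n / (2 * z₁)) * (g / P * G₂ * (n / (2 * z₂))) * κ₂)
      = C₄ * G₁ * G₂ / (P * P) / (2 * z₁ * (2 * z₂)) * ((κ₂ * g ^ 2 : ℂ) * (n * n)) := by
    field_simp
  rw [t4, hgoal2]
  field_simp
  ring

section Determinants

variable {ι : Type*} [Fintype ι]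

theorem sum_mul_sum_sub_sq (e a b : ι → ℂ) :
    (∑ j, a j ^ 2 * e j) * (∑ j, b j ^ 2 * e j) - (∑ j, a j * b j * e j) ^ 2
      = 1 / 2 * ∑ j, ∑ l, (a j * b l - a l * b j) ^ 2 * (e j * e l) := by
  have h1 : (∑ j, a j ^ 2 * e j) * (∑ j, b j ^ 2 * e j)
      = ∑ j, ∑ l, a j ^ 2 * b l ^ 2 * (e j * e l) := by
    rw [Finset.sum_mul_sum]
    exact Finset.sum_congr rfl fun j _ => Finset.sum_congr rfl fun l _ => by ring
  have h2 : (∑ j, a j ^ 2 * e j) * (∑ j, b j ^ 2 * e j)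
      = ∑ j, ∑ l, a l ^ 2 * b j ^ 2 * (e j * e l) := by
    rw [h1, Finset.sum_comm]
    exact Finset.sum_congr rfl fun j _ => Finset.sum_congr rfl fun l _ => by ring
  have h3 : (∑ j, a j * b j * e j) ^ 2
      = ∑ j, ∑ l, a j * b j * (a l * b l) * (e j * e l) := by
    rw [sq, Finset.sum_mul_sum]
    exact Finset.sum_congr rfl fun j _ => Finset.sum_congr rfl fun l _ => by ring
  have h4 : ∑ j, ∑ l, (a j * b l - a l * b j) ^ 2 * (e j * e l)
      = ∑ j, ∑ l, a j ^ 2 * b l ^ 2 * (e j * e l) + ∑ j, ∑ l, a l ^ 2 * b j ^ 2 * (e j * e l)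
        - 2 * ∑ j, ∑ l, a j * b j * (a l * b l) * (e j * e l) := by
    simp only [Finset.mul_sum, ← Finset.sum_add_distrib, ← Finset.sum_sub_distrib]
    exact Finset.sum_congr rfl fun j _ => Finset.sum_congr rfl fun l _ => by ring
  rw [h4, ← h1, ← h2, ← h3]
  ring

variable [DecidableEq ι]

theorem derivative_det (M : Matrix ι ι (Polynomial ℂ)) :
    Polynomial.derivative M.det
      = ∑ i, ∑ k, M.adjugate i k * Polynomial.derivative (M k i) := by
  have h : ∀ i, ∑ k, M.adjugate i k * Polynomial.derivative (M k i)
      = (M.updateCol i fun k => Polynomial.derivative (M k i)).det := by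
    intro i
    rw [← cramer_apply, cramer_eq_adjugate_mulVec]
    rfl
  simp_rw [h, det_apply', map_sum]
  rw [Finset.sum_comm]
  refine Finset.sum_congr rfl fun σ _ => ?_
  rw [Polynomial.derivative_intCast_mul, Polynomial.derivative_prod_finset, Finset.mul_sum]
  refine Finset.sum_congr rfl fun i _ => ?_
  rw [← Finset.mul_prod_erase Finset.univ _ (Finset.mem_univ i), mul_comm (Finset.prod _ _)]
  congr 2
  · simp
  · refine Finset.prod_congr rfl fun j hj => ?_
    rw [updateCol_ne (Finset.ne_of_mem_erase hj)]

theorem det_add_smul_one_ne_zero (A : Matrix ι ι ℂ) :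
    ∀ᶠ t : ℂ in nhdsWithin 0 {0}ᶜ, (A + t • (1 : Matrix ι ι ℂ)).det ≠ 0 := by
  have h : ∀ t : ℂ, (A + t • (1 : Matrix ι ι ℂ)).det = (charpoly (-A)).eval t := by
    intro t
    rw [eval_charpoly]
    congr 1
    rw [scalar_apply, smul_one_eq_diagonal, sub_neg_eq_add, add_comm]
  simp_rw [h]
  have hfin : {t : ℂ | (charpoly (-A)).eval t = 0}.Finite := by
    refine ((charpoly (-A)).roots.toFinset.finite_toSet).subset fun t ht => ?_
    simp only [Finset.mem_coe, Multiset.mem_toFinset]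
    exact (Polynomial.mem_roots (charpoly_monic _).ne_zero).mpr ht
  have hopen : (({t : ℂ | (charpoly (-A)).eval t = 0} \ {0})ᶜ) ∈ nhds (0 : ℂ) :=
    (hfin.subset Set.sdiff_subset).isClosed.isOpen_compl.mem_nhds (by simp)
  filter_upwards [mem_nhdsWithin_of_mem_nhds hopen, self_mem_nhdsWithin] with t ht ht0 h0
  exact ht ⟨h0, ht0⟩

theorem det_sub_vecMulVec (A : Matrix ι ι ℂ) (w : ι → ℂ) :
    (A - vecMulVec w w).det = A.det - ∑ i, ∑ k, A.adjugate i k * (w k * w i) := by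
  have hunit : ∀ B : Matrix ι ι ℂ, B.det ≠ 0 →
      (B - vecMulVec w w).det = B.det - ∑ i, ∑ k, B.adjugate i k * (w k * w i) := by
    intro B hB
    have h := det_add_replicateCol_mul_replicateRow (ι := Unit) (A := B) hB.isUnit (-w) w
    have e : B + replicateCol Unit (-w) * replicateRow Unit w = B - vecMulVec w w := by
      ext i j
      simp [mul_apply, vecMulVec_apply, sub_eq_add_neg]
    rw [e] at h
    rw [h]
    have e2 : ((1 : Matrix Unit Unit ℂ) + replicateRow Unit w * B⁻¹ * replicateCol Unit (-w)).det
        = 1 - ∑ i, ∑ k, B⁻¹ i k * (w k * w i) := by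
      rw [det_unique]
      simp only [Matrix.add_apply, one_apply_eq, mul_apply, replicateRow_apply,
        replicateCol_apply, Pi.neg_apply, mul_neg, Finset.sum_neg_distrib, ← sub_eq_add_neg]
      congr 1
      rw [Finset.sum_comm]
      refine Finset.sum_congr rfl fun i _ => ?_
      rw [Finset.sum_mul]
      refine Finset.sum_congr rfl fun k _ => ?_
      ring
    rw [e2, mul_sub, mul_one, Finset.mul_sum]
    congr 1
    refine Finset.sum_congr rfl fun i _ => ?_
    rw [Finset.mul_sum]
    refine Finset.sum_congr rfl fun k _ => ?_
    rw [Matrix.inv_def, Matrix.smul_apply, Ring.inverse_eq_inv', smul_eq_mul]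
    field_simp
  have c1 : Continuous fun t : ℂ => (A + t • (1 : Matrix ι ι ℂ) - vecMulVec w w).det := by
    fun_prop
  have cA : Continuous fun t : ℂ => A + t • (1 : Matrix ι ι ℂ) := by fun_prop
  have c2 : Continuous fun t : ℂ => (A + t • (1 : Matrix ι ι ℂ)).det
      - ∑ i, ∑ k, (A + t • (1 : Matrix ι ι ℂ)).adjugate i k * (w k * w i) := by
    refine cA.matrix_det.sub (continuous_finsetSum _ fun i _ => continuous_finsetSum _ fun k _ =>
      Continuous.mul ?_ continuous_const)
    exact (cA.matrix_adjugate).matrix_elem i k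
  have l1 := (c1.tendsto 0).mono_left (nhdsWithin_le_nhds (s := {0}ᶜ))
  have l2 := (c2.tendsto 0).mono_left (nhdsWithin_le_nhds (s := {0}ᶜ))
  have := tendsto_nhds_unique (l1.congr'
    ((det_add_smul_one_ne_zero A).mono fun t ht => hunit _ ht)) l2
  simpa using this

/-- The polynomial `det (A + X C)`. -/
noncomputable def detPencil (A C : Matrix ι ι ℂ) : Polynomial ℂ :=
  (A.map Polynomial.C + (Polynomial.X : Polynomial ℂ) • C.map Polynomial.C).det

theorem eval_detPencil (A C : Matrix ι ι ℂ) (t : ℂ) :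
    (detPencil A C).eval t = (A + t • C).det := by
  rw [detPencil, ← Polynomial.coe_evalRingHom, RingHom.map_det]
  congr 1
  ext i j
  simp
  ring

theorem detPencil_sub_vecMulVec (A C : Matrix ι ι ℂ) (w : ι → ℂ) :
    detPencil (A - vecMulVec w w) C = detPencil A C
      - ∑ i, ∑ k, (A.map Polynomial.C
        + (Polynomial.X : Polynomial ℂ) • C.map Polynomial.C).adjugate i k
          * Polynomial.C (w k * w i) := by
  refine Polynomial.funext fun t => ?_
  rw [Polynomial.eval_sub, eval_detPencil, eval_detPencil, add_comm, ← add_sub_assoc, add_comm,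
    det_sub_vecMulVec, Polynomial.eval_finsetSum]
  congr 1
  refine Finset.sum_congr rfl fun i _ => ?_
  rw [Polynomial.eval_finsetSum]
  refine Finset.sum_congr rfl fun k _ => ?_
  rw [Polynomial.eval_mul, Polynomial.eval_C]
  congr 1
  have h := RingHom.map_adjugate (Polynomial.evalRingHom t)
    (A.map Polynomial.C + (Polynomial.X : Polynomial ℂ) • C.map Polynomial.C)
  have h2 := congrFun (congrFun h i) k
  rw [RingHom.mapMatrix_apply, map_apply, Polynomial.coe_evalRingHom] at h2
  rw [h2]
  congr 2
  ext i j
  simp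
  ring

theorem derivative_detPencil (A C : Matrix ι ι ℂ) :
    Polynomial.derivative (detPencil A C)
      = ∑ i, ∑ k, (A.map Polynomial.C
        + (Polynomial.X : Polynomial ℂ) • C.map Polynomial.C).adjugate i k
          * Polynomial.C (C k i) := by
  rw [detPencil, derivative_det]
  simp

theorem det_diagonal_add_rank_two {d : ι → ℂ} (hd : ∀ j, d j ≠ 0) (α β : ℂ) (a b : ι → ℂ) :
    (diagonal d + α • vecMulVec a a + β • vecMulVec b b).det
      = ∏ j, d j + α * ∑ j, a j ^ 2 * ∏ i ∈ Finset.univ.erase j, d i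
        + β * ∑ j, b j ^ 2 * ∏ i ∈ Finset.univ.erase j, d i
        + α * β / 2 * ∑ j, ∑ l ∈ Finset.univ.erase j,
          (a j * b l - a l * b j) ^ 2 * ∏ i ∈ (Finset.univ.erase j).erase l, d i := by
  let V : Matrix ι (Fin 2) ℂ := of fun j => ![α * a j, β * b j]
  let R : Matrix (Fin 2) ι ℂ := of ![fun j => a j / d j, fun j => b j / d j]
  have e1 : diagonal d + α • vecMulVec a a + β • vecMulVec b b
      = (1 + V * R) * diagonal d := by
    rw [add_mul, one_mul, add_assoc]
    congr 1
    ext i j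
    rw [mul_diagonal]
    simp only [V, R, Matrix.add_apply, Matrix.smul_apply, vecMulVec_apply, mul_apply,
      Fin.sum_univ_two, of_apply, cons_val_zero, cons_val_one, smul_eq_mul]
    have := hd j
    field_simp
  have s1 : ∀ j, ∏ i ∈ Finset.univ.erase j, d i = (∏ i, d i) * (d j)⁻¹ := by
    intro j
    rw [← Finset.mul_prod_erase Finset.univ d (Finset.mem_univ j)]
    have := hd j
    field_simp
  have s2 : ∀ j, ∀ l ∈ Finset.univ.erase j, ∏ i ∈ (Finset.univ.erase j).erase l, d i
      = (∏ i, d i) * ((d j)⁻¹ * (d l)⁻¹) := by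
    intro j l hl
    have h1 := Finset.mul_prod_erase _ d hl
    rw [s1 j] at h1
    have := hd l
    rw [← mul_assoc, ← h1]
    field_simp
  rw [e1, det_mul, det_one_add_mul_comm, det_diagonal, det_fin_two]
  have l1 : ∑ j, ∑ l ∈ Finset.univ.erase j,
        (a j * b l - a l * b j) ^ 2 * ∏ i ∈ (Finset.univ.erase j).erase l, d i
      = (∏ i, d i) * ∑ j, ∑ l, (a j * b l - a l * b j) ^ 2 * ((d j)⁻¹ * (d l)⁻¹) := by
    rw [Finset.mul_sum]
    refine Finset.sum_congr rfl fun j _ => ?_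
    rw [Finset.mul_sum, ← Finset.add_sum_erase Finset.univ _ (Finset.mem_univ j)]
    rw [mul_comm (a j) (b j), sub_self]
    simp only [ne_eq, OfNat.ofNat_ne_zero, not_false_eq_true, zero_pow, zero_mul, mul_zero,
      zero_add]
    refine Finset.sum_congr rfl fun l hl => ?_
    rw [s2 j l hl]; ring
  have l2 : ∀ c : ι → ℂ, ∑ j, c j ^ 2 * ∏ i ∈ Finset.univ.erase j, d i
      = (∏ i, d i) * ∑ j, c j ^ 2 * (d j)⁻¹ := by
    intro c
    rw [Finset.mul_sum]
    refine Finset.sum_congr rfl fun j _ => ?_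
    rw [s1]; ring
  rw [l1, l2, l2]
  have hl := sum_mul_sum_sub_sq (fun j => (d j)⁻¹) a b
  have m00 : (1 + R * V : Matrix (Fin 2) (Fin 2) ℂ) 0 0 = 1 + α * ∑ j, a j ^ 2 * (d j)⁻¹ := by
    simp only [V, R, Matrix.add_apply, mul_apply, of_apply, cons_val_zero, one_apply_eq,
      Finset.mul_sum]
    congr 1
    exact Finset.sum_congr rfl fun j _ => by ring
  have m11 : (1 + R * V : Matrix (Fin 2) (Fin 2) ℂ) 1 1 = 1 + β * ∑ j, b j ^ 2 * (d j)⁻¹ := by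
    simp only [V, R, Matrix.add_apply, mul_apply, of_apply, cons_val_one, one_apply_eq,
      Finset.mul_sum]
    congr 1
    exact Finset.sum_congr rfl fun j _ => by simp; ring
  have m01 : (1 + R * V : Matrix (Fin 2) (Fin 2) ℂ) 0 1 = β * ∑ j, a j * b j * (d j)⁻¹ := by
    simp only [V, R, Matrix.add_apply, mul_apply, of_apply, cons_val_one, cons_val_zero,
      Finset.mul_sum]
    rw [one_apply_ne (by decide), zero_add]
    exact Finset.sum_congr rfl fun j _ => by ring
  have m10 : (1 + R * V : Matrix (Fin 2) (Fin 2) ℂ) 1 0 = α * ∑ j, a j * b j * (d j)⁻¹ := by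
    simp only [V, R, Matrix.add_apply, mul_apply, of_apply, cons_val_one, cons_val_zero,
      Finset.mul_sum]
    rw [one_apply_ne (by decide), zero_add]
    exact Finset.sum_congr rfl fun j _ => by ring
  rw [m00, m11, m01, m10]
  linear_combination (α * β * ∏ i, d i) * hl

end Determinants

/-- The linear functional `P ↦ ((1 - d/dX) ^ n P)(0)`. -/
noncomputable def laguerreFunctional (n : ℕ) : Polynomial ℂ →ₗ[ℂ] ℂ :=
  Polynomial.leval 0 ∘ₗ ((1 : Module.End ℂ (Polynomial ℂ)) - Polynomial.derivative) ^ n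

theorem laguerreFunctional_succ (n : ℕ) (P : Polynomial ℂ) :
    laguerreFunctional (n + 1) P
      = laguerreFunctional n P - laguerreFunctional n (Polynomial.derivative P) := by
  rw [laguerreFunctional, pow_succ, ← map_sub]
  rfl

theorem laguerreFunctional_X_pow (n k : ℕ) :
    laguerreFunctional n (Polynomial.X ^ k) = (-1) ^ k * (n.descFactorial k : ℂ) := by
  induction n generalizing k with
  | zero => cases k <;> simp [laguerreFunctional]
  | succ n ih =>
    rw [laguerreFunctional_succ, ih]
    cases k with
    | zero => simp
    | succ k =>
      rw [Polynomial.derivative_X_pow, ← Polynomial.smul_eq_C_mul, map_smul, Nat.add_sub_cancel,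
        ih, Nat.succ_descFactorial_succ]
      have h : ((n.descFactorial (k + 1) : ℕ) : ℂ) = (n - k) * n.descFactorial k := by
        rw [Nat.descFactorial_succ]
        rcases le_or_gt k n with hk | hk
        · push_cast [Nat.cast_sub hk]; ring
        · rw [Nat.descFactorial_eq_zero_iff_lt.mpr hk]; simp
      rw [h]
      push_cast
      ring

theorem laguerreFunctional_mul_C (n : ℕ) (P : Polynomial ℂ) (c : ℂ) :
    laguerreFunctional n (P * Polynomial.C c) = laguerreFunctional n P * c := by
  rw [mul_comm, ← Polynomial.smul_eq_C_mul, map_smul, smul_eq_mul, mul_comm]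

theorem one_add_pow_le_exp {q : ℝ} (hq : 0 ≤ q) (k : ℕ) :
    (1 + q) ^ k ≤ (4 * (k + 1)) ^ k * Real.exp (q / 4) := by
  have h0 : (0 : ℝ) < 4 * (k + 1) := by positivity
  have h1 : 1 + q ≤ 4 * (k + 1) * Real.exp (q / (4 * (k + 1))) := by
    have h := Real.add_one_le_exp (q / (4 * (k + 1)))
    have h2 : 1 + q ≤ 4 * (k + 1) * (q / (4 * (k + 1)) + 1) := by
      rw [mul_add, mul_div_cancel₀ _ h0.ne']
      have : (0 : ℝ) ≤ k := Nat.cast_nonneg k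
      linarith
    exact h2.trans (mul_le_mul_of_nonneg_left h h0.le)
  calc (1 + q) ^ k ≤ (4 * (k + 1) * Real.exp (q / (4 * (k + 1)))) ^ k :=
        pow_le_pow_left₀ (by positivity) h1 k
    _ = (4 * (k + 1)) ^ k * Real.exp (k * (q / (4 * (k + 1)))) := by
        rw [mul_pow, Real.exp_nat_mul]
    _ ≤ _ := by
        refine mul_le_mul_of_nonneg_left (Real.exp_le_exp.mpr ?_) (by positivity)
        rw [mul_div_assoc', div_le_div_iff₀ h0 (by norm_num)]
        nlinarith

section Columns

variable {ι : Type*}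

/-- The matrix of the map `(Y₁, …, Y_m) ↦ A - ∑ (s Y_c)(s Y_c)ᵀ`. -/
noncomputable def columnShift {m : ℕ} (s : ι → ℝ) (A : Matrix ι ι ℂ) (Y : Fin m → ι → ℝ) :
    Matrix ι ι ℂ :=
  A - ∑ c, vecMulVec (fun i => ((s i * Y c i : ℝ) : ℂ)) (fun i => ((s i * Y c i : ℝ) : ℂ))

theorem columnShift_cons {m : ℕ} (s : ι → ℝ) (A : Matrix ι ι ℂ) (y : ι → ℝ)
    (Y : Fin m → ι → ℝ) :
    columnShift s A (Fin.cons y Y : Fin (m + 1) → ι → ℝ)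
      = columnShift s (A - vecMulVec (fun i => ((s i * y i : ℝ) : ℂ))
          (fun i => ((s i * y i : ℝ) : ℂ))) Y := by
  rw [columnShift, columnShift, Fin.sum_univ_succ, sub_sub]
  simp

variable [Fintype ι]

theorem integrable_exp_neg_sum_sum_sq (m : ℕ) {b : ℝ} (hb : 0 < b) :
    Integrable fun Y : Fin m → ι → ℝ => Real.exp (-b * ∑ c, ∑ i, Y c i ^ 2) := by
  have e : ∀ Y : Fin m → ι → ℝ, Real.exp (-b * ∑ c, ∑ i, Y c i ^ 2)
      = ∏ c, ∏ i, Real.exp (-b * Y c i ^ 2) := by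
    intro Y
    simp_rw [Finset.mul_sum, Real.exp_sum]
  simp_rw [e]
  have h : Integrable fun y : ι → ℝ => ∏ i, Real.exp (-b * y i ^ 2) :=
    Integrable.fintype_prod (f := fun _ t => Real.exp (-b * t ^ 2)) fun _ =>
      integrable_exp_neg_mul_sq hb
  exact Integrable.fintype_prod (E := ι → ℝ)
    (f := fun _ y => ∏ i, Real.exp (-b * y i ^ 2)) fun _ => h

variable [DecidableEq ι]

theorem integral_prod_mul_det_columnShift {g : (ι → ℝ) → ℂ} {N : ℂ} {C : Matrix ι ι ℂ}
    {s : ι → ℝ} (hg : Integrable g) (hN : ∫ y, g y = N)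
    (hg2 : ∀ k i, Integrable fun y => g y * (((s k * y k : ℝ) : ℂ) * ((s i * y i : ℝ) : ℂ)))
    (hC : ∀ k i, ∫ y, g y * (((s k * y k : ℝ) : ℂ) * ((s i * y i : ℝ) : ℂ)) = N * C k i)
    (hint : ∀ (m : ℕ) (A : Matrix ι ι ℂ), Integrable fun Y : Fin m → ι → ℝ =>
      (∏ c, g (Y c)) * (columnShift s A Y).det)
    (m : ℕ) (A : Matrix ι ι ℂ) :
    ∫ Y : Fin m → ι → ℝ, (∏ c, g (Y c)) * (columnShift s A Y).det
      = N ^ m * laguerreFunctional m (detPencil A C) := by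
  induction m generalizing A with
  | zero =>
    rw [volume_pi, Measure.pi_of_empty (x := fun i => i.elim0), integral_dirac]
    simp [columnShift, laguerreFunctional, Polynomial.leval, eval_detPencil]
  | succ m ih =>
    have mp := volume_preserving_piFinSuccAbove (fun _ : Fin (m + 1) => ι → ℝ) 0
    have e : ∀ z : (ι → ℝ) × (Fin m → ι → ℝ),
        (∏ c, g ((MeasurableEquiv.piFinSuccAbove (fun _ : Fin (m + 1) => ι → ℝ) 0).symm z c))
          * (columnShift s A
            ((MeasurableEquiv.piFinSuccAbove (fun _ : Fin (m + 1) => ι → ℝ) 0).symm z)).det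
        = g z.1 * ((∏ c, g (z.2 c)) * (columnShift s (A - vecMulVec
            (fun i => ((s i * z.1 i : ℝ) : ℂ)) (fun i => ((s i * z.1 i : ℝ) : ℂ))) z.2).det) := by
      intro z
      have hz : (MeasurableEquiv.piFinSuccAbove (fun _ : Fin (m + 1) => ι → ℝ) 0).symm z
          = (Fin.cons z.1 z.2 : Fin (m + 1) → ι → ℝ) := by
        simp [MeasurableEquiv.piFinSuccAbove, Fin.insertNthEquiv]
      rw [hz, columnShift_cons, Fin.prod_univ_succ]
      simp only [Fin.cons_zero, Fin.cons_succ]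
      ring
    have hi := (mp.symm.integrable_comp_emb
      (MeasurableEquiv.piFinSuccAbove (fun _ : Fin (m + 1) => ι → ℝ) 0).symm.measurableEmbedding).mpr
      (hint (m + 1) A)
    rw [← mp.symm.integral_comp
      (MeasurableEquiv.piFinSuccAbove (fun _ : Fin (m + 1) => ι → ℝ) 0).symm.measurableEmbedding]
    simp_rw [Function.comp_def, e] at hi
    simp_rw [e]
    rw [Measure.volume_eq_prod] at hi ⊢
    rw [integral_prod _ hi]
    simp_rw [integral_const_mul, ih, detPencil_sub_vecMulVec, map_sub, map_sum,
      laguerreFunctional_mul_C]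
    set a : ι → ι → ℂ := fun i k => laguerreFunctional m ((A.map Polynomial.C
        + (Polynomial.X : Polynomial ℂ) • C.map Polynomial.C).adjugate i k) with ha
    have h1 : ∀ y : ι → ℝ, g y * (N ^ m * (laguerreFunctional m (detPencil A C)
        - ∑ i, ∑ k, a i k * (((s k * y k : ℝ) : ℂ) * ((s i * y i : ℝ) : ℂ))))
        = N ^ m * laguerreFunctional m (detPencil A C) * g y
          - ∑ i, ∑ k, N ^ m * a i k * (g y * (((s k * y k : ℝ) : ℂ) * ((s i * y i : ℝ) : ℂ))) := by
      intro y
      rw [mul_sub, mul_sub, Finset.mul_sum, Finset.mul_sum]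
      congr 1
      · ring
      · refine Finset.sum_congr rfl fun i _ => ?_
        rw [Finset.mul_sum, Finset.mul_sum]
        refine Finset.sum_congr rfl fun k _ => by ring
    refine (integral_congr_ae (ae_of_all _ fun y => h1 y)).trans ?_
    rw [integral_sub (hg.const_mul _) (integrable_finsetSum _ fun i _ =>
        integrable_finsetSum _ fun k _ => (hg2 k i).const_mul _), integral_const_mul, hN,
      integral_finsetSum _ fun i _ => integrable_finsetSum _ fun k _ => (hg2 k i).const_mul _]
    have h2 : ∀ i, ∫ y, ∑ k, N ^ m * a i k
        * (g y * (((s k * y k : ℝ) : ℂ) * ((s i * y i : ℝ) : ℂ)))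
        = ∑ k, N ^ m * a i k * (N * C k i) := by
      intro i
      rw [integral_finsetSum _ fun k _ => (hg2 k i).const_mul _]
      simp_rw [integral_const_mul, hC]
    simp_rw [h2]
    rw [laguerreFunctional_succ, derivative_detPencil, map_sum]
    simp_rw [map_sum, laguerreFunctional_mul_C]
    rw [mul_sub, Finset.mul_sum]
    congr 1
    · ring
    · refine Finset.sum_congr rfl fun i _ => ?_
      rw [Finset.mul_sum]
      refine Finset.sum_congr rfl fun k _ => by simp only [ha]; ring

theorem exists_norm_det_columnShift_le (m : ℕ) (s : ι → ℝ) (A : Matrix ι ι ℂ) :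
    ∃ K : ℝ, 0 ≤ K ∧ ∀ Y : Fin m → ι → ℝ,
      ‖(columnShift s A Y).det‖ ≤ K * Real.exp ((∑ c, ∑ i, Y c i ^ 2) / 4) := by
  set a : ℝ := ∑ i, ∑ j, ‖A i j‖ with ha
  set σ : ℝ := ∑ i, ∑ j, |s i * s j| with hσ
  have ha0 : 0 ≤ a := by positivity
  have hσ0 : 0 ≤ σ := by positivity
  refine ⟨(Fintype.card ι).factorial * ((a + σ) ^ Fintype.card ι
    * (4 * (Fintype.card ι + 1)) ^ Fintype.card ι), by positivity, fun Y => ?_⟩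
  set Q : ℝ := ∑ c, ∑ i, Y c i ^ 2 with hQ
  have hQ0 : 0 ≤ Q := by positivity
  have hentry : ∀ i j, ‖columnShift s A Y i j‖ ≤ (a + σ) * (1 + Q) := by
    intro i j
    have hA : ‖A i j‖ ≤ a :=
      (Finset.single_le_sum (f := fun j => ‖A i j‖) (fun _ _ => norm_nonneg _)
        (Finset.mem_univ j)).trans (Finset.single_le_sum (f := fun i => ∑ j, ‖A i j‖)
          (fun _ _ => by positivity) (Finset.mem_univ i))
    have hs : |s i * s j| ≤ σ :=
      (Finset.single_le_sum (f := fun j => |s i * s j|) (fun _ _ => abs_nonneg _)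
        (Finset.mem_univ j)).trans (Finset.single_le_sum (f := fun i => ∑ j, |s i * s j|)
          (fun _ _ => by positivity) (Finset.mem_univ i))
    have hc : ∀ c, ‖((s i * Y c i : ℝ) : ℂ) * ((s j * Y c j : ℝ) : ℂ)‖
        ≤ σ * ∑ i, Y c i ^ 2 := by
      intro c
      rw [← Complex.ofReal_mul, Complex.norm_real, Real.norm_eq_abs,
        show s i * Y c i * (s j * Y c j) = s i * s j * (Y c i * Y c j) by ring, abs_mul]
      refine mul_le_mul hs ?_ (abs_nonneg _) hσ0
      have h1 := Finset.single_le_sum (f := fun i => Y c i ^ 2) (fun _ _ => sq_nonneg _)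
        (Finset.mem_univ i)
      have h2 := Finset.single_le_sum (f := fun i => Y c i ^ 2) (fun _ _ => sq_nonneg _)
        (Finset.mem_univ j)
      rw [abs_le]
      constructor <;> nlinarith [sq_nonneg (Y c i + Y c j), sq_nonneg (Y c i - Y c j)]
    rw [columnShift, Matrix.sub_apply, Matrix.sum_apply]
    simp_rw [vecMulVec_apply]
    calc _ ≤ ‖A i j‖ + ‖∑ c, ((s i * Y c i : ℝ) : ℂ) * ((s j * Y c j : ℝ) : ℂ)‖ := norm_sub_le _ _
      _ ≤ a + σ * Q := by
          refine add_le_add hA ((norm_sum_le _ _).trans ?_)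
          rw [hQ, Finset.mul_sum]
          exact Finset.sum_le_sum fun c _ => hc c
      _ ≤ _ := by nlinarith [mul_nonneg ha0 hQ0]
  have h := Matrix.det_le (abv := NormedField.toAbsoluteValue ℂ)
    (A := columnShift s A Y) (x := (a + σ) * (1 + Q)) hentry
  rw [nsmul_eq_mul] at h
  refine h.trans ?_
  rw [mul_assoc, mul_pow, mul_assoc ((a + σ) ^ _)]
  gcongr
  exact one_add_pow_le_exp hQ0 _

theorem continuous_det_columnShift (m : ℕ) (s : ι → ℝ) (A : Matrix ι ι ℂ) :
    Continuous fun Y : Fin m → ι → ℝ => (columnShift s A Y).det := by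
  refine Continuous.matrix_det ?_
  unfold columnShift
  refine continuous_const.sub (continuous_finsetSum _ fun c _ => ?_)
  refine Continuous.matrix_vecMulVec ?_ ?_ <;> fun_prop

end Columns

theorem trace_transpose_mul_inv_diagonal_mul {p n : ℕ} {Λ : Fin p → ℝ} (hΛ : ∀ j, 0 < Λ j)
    (W : Fin p → Fin n → ℝ) :
    ((of W)ᵀ * (diagonal Λ)⁻¹ * of W).trace = ∑ c, ∑ j, W j c ^ 2 / Λ j := by
  have hinv : (diagonal Λ)⁻¹ = diagonal fun j => (Λ j)⁻¹ := by
    refine inv_eq_left_inv ?_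
    rw [diagonal_mul_diagonal, ← diagonal_one]
    congr 1
    funext j
    exact inv_mul_cancel₀ (hΛ j).ne'
  rw [hinv, trace]
  refine Finset.sum_congr rfl fun c _ => ?_
  rw [diag_apply, mul_apply]
  refine Finset.sum_congr rfl fun j _ => ?_
  rw [mul_diagonal, transpose_apply, of_apply, div_eq_mul_inv]
  ring

/-- The linear change of variables `y ↦ (√Λ_j y_{cj})_{jc}`. -/
noncomputable def sqrtScale {p n : ℕ} (Λ : Fin p → ℝ) (y : Fin n → Fin p → ℝ) :
    Fin p → Fin n → ℝ :=
  fun j c => √(Λ j) * y c j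

theorem exists_integral_comp_sqrtScale {p n : ℕ} {Λ : Fin p → ℝ} (hΛ : ∀ j, 0 < Λ j) :
    ∃ C : ℝ, ∀ F : (Fin p → Fin n → ℝ) → ℂ,
      ∫ y : Fin n → Fin p → ℝ, F (sqrtScale Λ y) = C * ∫ W, F W := by
  have hs : ∀ j, √(Λ j) ≠ 0 := fun j => (Real.sqrt_pos.mpr (hΛ j)).ne'
  let T : (Fin n → Fin p → ℝ) ≃ₗ[ℝ] (Fin p → Fin n → ℝ) :=
    { toFun := sqrtScale Λ
      invFun := fun W c j => (√(Λ j))⁻¹ * W j c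
      map_add' := fun x y => by funext j c; simp [sqrtScale, mul_add]
      map_smul' := fun r y => by funext j c; simp [sqrtScale, mul_left_comm]
      left_inv := fun y => by funext c j; simp [sqrtScale, hs]
      right_inv := fun W => by funext c j; simp [sqrtScale, hs] }
  have hv : ∀ a b : ℕ, (volume : Measure (Fin a → Fin b → ℝ)).IsAddHaarMeasure := by
    intro a b
    have h : (volume : Measure (Fin b → ℝ)).IsAddHaarMeasure := by
      rw [volume_pi]
      infer_instance
    rw [volume_pi]
    infer_instance
  have hv₁ := hv n p
  have hv₂ := hv p n
  have h : (volume.map T.toContinuousLinearEquiv).IsAddHaarMeasure :=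
    T.toContinuousLinearEquiv.isAddHaarMeasure_map volume
  have hm := Measure.isAddLeftInvariant_eq_smul (volume.map T.toContinuousLinearEquiv)
    (volume : Measure (Fin p → Fin n → ℝ))
  obtain ⟨C, hC⟩ : ∃ C : NNReal, volume.map T.toContinuousLinearEquiv
      = C • (volume : Measure (Fin p → Fin n → ℝ)) := ⟨_, hm⟩
  refine ⟨C, fun F => ?_⟩
  have h1 : ∫ y : Fin n → Fin p → ℝ, F (sqrtScale Λ y)
      = ∫ W, F W ∂(volume.map T.toContinuousLinearEquiv) :=
    (T.toContinuousLinearEquiv.toHomeomorph.measurableEmbedding.integral_map F).symm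
  rw [h1, hC, integral_smul_nnreal_measure]
  rfl

theorem integral_cexp_neg_half_sum_sum_sq (p n : ℕ) :
    ∫ y : Fin n → Fin p → ℝ, Complex.exp (-(1 / 2) * ((∑ c, ∑ j, y c j ^ 2 : ℝ) : ℂ))
      = ((√(2 * Real.pi) : ℝ) : ℂ) ^ (p * n) := by
  have e : ∀ y : Fin n → Fin p → ℝ,
      Complex.exp (-(1 / 2) * ((∑ c, ∑ j, y c j ^ 2 : ℝ) : ℂ))
        = ∏ c, ∏ j, ((Real.exp (-(1 / 2) * y c j ^ 2) : ℝ) : ℂ) := by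
    intro y
    push_cast
    simp_rw [Finset.mul_sum, Complex.exp_sum]
  simp_rw [e]
  rw [integral_fintype_prod_volume_eq_prod
    (fun (_ : Fin n) (t : Fin p → ℝ) => ∏ j, ((Real.exp (-(1 / 2) * t j ^ 2) : ℝ) : ℂ))]
  rw [integral_fintype_prod_volume_eq_prod
    (fun (_ : Fin p) (t : ℝ) => ((Real.exp (-(1 / 2) * t ^ 2) : ℝ) : ℂ))]
  have h1 : ∫ t : ℝ, ((Real.exp (-(1 / 2) * t ^ 2) : ℝ) : ℂ) = ((√(2 * Real.pi) : ℝ) : ℂ) := by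
    rw [integral_complex_ofReal, integral_gaussian]
    congr 3
    ring
  rw [h1]
  simp [pow_mul]

theorem integral_cexp_neg_half_sum_sum_sq_div {p n : ℕ} {Λ : Fin p → ℝ} (hΛ : ∀ j, 0 < Λ j) :
    ∫ W : Fin p → Fin n → ℝ, Complex.exp (-(1 / 2) * ((∑ c, ∑ j, W j c ^ 2 / Λ j : ℝ) : ℂ))
      = (∏ j, ((√(2 * Real.pi * Λ j) : ℝ) : ℂ)) ^ n := by
  have e : ∀ W : Fin p → Fin n → ℝ,
      Complex.exp (-(1 / 2) * ((∑ c, ∑ j, W j c ^ 2 / Λ j : ℝ) : ℂ))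
        = ∏ j, ∏ c, ((Real.exp (-(1 / (2 * Λ j)) * W j c ^ 2) : ℝ) : ℂ) := by
    intro W
    rw [Finset.prod_comm]
    push_cast
    simp_rw [Finset.mul_sum, Complex.exp_sum]
    refine Finset.prod_congr rfl fun c _ => Finset.prod_congr rfl fun j _ => ?_
    congr 1
    have : (Λ j : ℂ) ≠ 0 := Complex.ofReal_ne_zero.mpr (hΛ j).ne'
    field_simp
  simp_rw [e]
  rw [integral_fintype_prod_volume_eq_prod
    (fun (j : Fin p) (t : Fin n → ℝ) =>
      ∏ c, ((Real.exp (-(1 / (2 * Λ j)) * t c ^ 2) : ℝ) : ℂ))]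
  rw [← Finset.prod_pow]
  refine Finset.prod_congr rfl fun j _ => ?_
  rw [integral_fintype_prod_volume_eq_prod
    (fun (_ : Fin n) (t : ℝ) => ((Real.exp (-(1 / (2 * Λ j)) * t ^ 2) : ℝ) : ℂ))]
  have h1 : ∫ t : ℝ, ((Real.exp (-(1 / (2 * Λ j)) * t ^ 2) : ℝ) : ℂ)
      = ((√(2 * Real.pi * Λ j) : ℝ) : ℂ) := by
    rw [integral_complex_ofReal, integral_gaussian]
    congr 3
    have := (hΛ j).ne'
    field_simp
  rw [h1]
  simp

theorem integral_wishartMeasureReal {p n : ℕ} {Λ : Fin p → ℝ} (hΛ : ∀ j, 0 < Λ j)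
    (F : (Fin p → Fin n → ℝ) → ℂ) :
    ∫ W, F W ∂(wishartMeasureReal p n Λ)
      = (((√(2 * Real.pi) : ℝ) : ℂ) ^ (p * n))⁻¹ * ∫ y : Fin n → Fin p → ℝ,
          Complex.exp (-(1 / 2) * ((∑ c, ∑ j, y c j ^ 2 : ℝ) : ℂ)) * F (sqrtScale Λ y) := by
  obtain ⟨C, hC⟩ := exists_integral_comp_sqrtScale (n := n) hΛ
  have hq : ∀ y : Fin n → Fin p → ℝ,
      ∑ c, ∑ j, sqrtScale Λ y j c ^ 2 / Λ j = ∑ c, ∑ j, y c j ^ 2 := by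
    intro y
    refine Finset.sum_congr rfl fun c _ => Finset.sum_congr rfl fun j _ => ?_
    rw [sqrtScale, mul_pow, Real.sq_sqrt (hΛ j).le, mul_div_cancel_left₀ _ (hΛ j).ne']
  have hdet : 0 < (2 * Real.pi) ^ p * ∏ j, Λ j :=
    mul_pos (by positivity) (Finset.prod_pos fun j _ => hΛ j)
  have hκ : (((2 * Real.pi) ^ p * ∏ j, Λ j) ^ (-(n : ℝ) / 2))
      = ((∏ j, √(2 * Real.pi * Λ j)) ^ n)⁻¹ := by
    rw [← Real.sqrt_prod _ (fun j _ => by have := hΛ j; positivity), Finset.prod_mul_distrib,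
      Finset.prod_const, Finset.card_univ, Fintype.card_fin, neg_div, Real.rpow_neg hdet.le,
      Real.sqrt_eq_rpow, ← Real.rpow_mul_natCast hdet.le]
    congr 2
    ring
  set κ : ℝ := ((2 * Real.pi) ^ p * ∏ j, Λ j) ^ (-(n : ℝ) / 2)
  have hκ0 : 0 < κ := Real.rpow_pos_of_pos hdet _
  have hmass := hC fun W => Complex.exp (-(1 / 2) * ((∑ c, ∑ j, W j c ^ 2 / Λ j : ℝ) : ℂ))
  have hmain := hC fun W => Complex.exp (-(1 / 2) * ((∑ c, ∑ j, W j c ^ 2 / Λ j : ℝ) : ℂ)) * F W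
  simp_rw [hq] at hmass hmain
  rw [integral_cexp_neg_half_sum_sum_sq, integral_cexp_neg_half_sum_sum_sq_div hΛ] at hmass
  have hκc : (∏ j, ((√(2 * Real.pi * Λ j) : ℝ) : ℂ)) ^ n = ((κ : ℝ) : ℂ)⁻¹ := by
    rw [hκ]
    push_cast
    rw [inv_inv]
  have hs : ((√(2 * Real.pi) : ℝ) : ℂ) ^ (p * n) ≠ 0 :=
    pow_ne_zero _ (Complex.ofReal_ne_zero.mpr (Real.sqrt_pos.mpr (by positivity)).ne')
  rw [hmain, wishartMeasureReal, integral_withDensity_eq_integral_toReal_smul]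
  rotate_left
  · refine ENNReal.measurable_ofReal.comp ?_
    simp_rw [trace_transpose_mul_inv_diagonal_mul hΛ]
    fun_prop
  · exact ae_of_all _ fun _ => ENNReal.ofReal_lt_top
  have e : ∀ W : Fin p → Fin n → ℝ, (ENNReal.ofReal (κ * Real.exp (-(1 / 2) *
      ((of W)ᵀ * (diagonal Λ)⁻¹ * of W).trace))).toReal • F W
      = κ * (Complex.exp (-(1 / 2) * ((∑ c, ∑ j, W j c ^ 2 / Λ j : ℝ) : ℂ)) * F W) := by
    intro W
    rw [ENNReal.toReal_ofReal (by positivity), trace_transpose_mul_inv_diagonal_mul hΛ,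
      Complex.real_smul]
    push_cast
    ring
  rw [integral_congr_ae (ae_of_all _ e), integral_const_mul]
  have hC0 : (C : ℂ) ≠ 0 := by
    rintro h
    rw [h, zero_mul] at hmass
    exact hs hmass
  have hκ0' : (κ : ℂ) ≠ 0 := Complex.ofReal_ne_zero.mpr hκ0.ne'
  rw [hmass, hκc]
  field_simp

section GaussianColumns

variable {ι : Type*} [Fintype ι]

theorem norm_cexp_neg_gaussForm_half (S : Matrix ι ι ℝ) (y : ι → ℝ) :
    ‖Complex.exp (-gaussForm (1 / 2) Complex.I S y)‖ = Real.exp (-(1 / 2) * ∑ i, y i ^ 2) := by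
  rw [Complex.norm_exp, gaussForm]
  congr 1
  simp [dotProduct, sq]

theorem continuous_gaussForm (z c : ℂ) (S : Matrix ι ι ℝ) :
    Continuous fun y => gaussForm z c S y := by
  unfold gaussForm
  simp only [dotProduct, mulVec]
  fun_prop

theorem integrable_cexp_neg_gaussForm_mul_mul (S : Matrix ι ι ℝ) (s : ι → ℝ) (k i : ι) :
    Integrable fun y : ι → ℝ => Complex.exp (-gaussForm (1 / 2) Complex.I S y)
      * (((s k * y k : ℝ) : ℂ) * ((s i * y i : ℝ) : ℂ)) := by
  have hg : Integrable fun y : ι → ℝ => Real.exp (-(1 / 4) * ∑ i, y i ^ 2) := by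
    simp_rw [Finset.mul_sum, Real.exp_sum]
    exact Integrable.fintype_prod (f := fun _ t => Real.exp (-(1 / 4) * t ^ 2)) fun _ =>
      integrable_exp_neg_mul_sq (by norm_num)
  refine (hg.const_mul (|s k * s i| * 8)).mono' (Continuous.aestronglyMeasurable ?_)
    (ae_of_all _ fun y => ?_)
  · exact (Complex.continuous_exp.comp (continuous_gaussForm _ _ S).neg).mul (by fun_prop)
  · rw [norm_mul, norm_cexp_neg_gaussForm_half, ← Complex.ofReal_mul, Complex.norm_real,
      Real.norm_eq_abs, show s k * y k * (s i * y i) = s k * s i * (y k * y i) by ring, abs_mul]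
    set Q := ∑ i, y i ^ 2 with hQ
    have hQ0 : 0 ≤ Q := by positivity
    have h1 : |y k * y i| ≤ Q := by
      have h1 := Finset.single_le_sum (f := fun i => y i ^ 2) (fun _ _ => sq_nonneg _)
        (Finset.mem_univ k)
      have h2 := Finset.single_le_sum (f := fun i => y i ^ 2) (fun _ _ => sq_nonneg _)
        (Finset.mem_univ i)
      rw [abs_le]
      constructor <;> nlinarith [sq_nonneg (y k + y i), sq_nonneg (y k - y i)]
    have h2 : Q ≤ 8 * Real.exp (Q / 4) := by
      have := Real.add_one_le_exp (Q / 4)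
      linarith
    calc Real.exp (-(1 / 2) * Q) * (|s k * s i| * |y k * y i|)
        ≤ Real.exp (-(1 / 2) * Q) * (|s k * s i| * (8 * Real.exp (Q / 4))) := by
          gcongr
          exact h1.trans h2
      _ = |s k * s i| * 8 * (Real.exp (-(1 / 2) * Q) * Real.exp (Q / 4)) := by ring
      _ = _ := by
          rw [← Real.exp_add]
          congr 2
          ring

variable [DecidableEq ι]

theorem norm_prod_mul_det_columnShift_le (m : ℕ) (s : ι → ℝ) (A : Matrix ι ι ℂ) :
    ∃ K : ℝ, 0 ≤ K ∧ ∀ (S : Matrix ι ι ℝ) (Y : Fin m → ι → ℝ),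
      ‖(∏ c, Complex.exp (-gaussForm (1 / 2) Complex.I S (Y c))) * (columnShift s A Y).det‖
        ≤ K * Real.exp (-(1 / 4) * ∑ c, ∑ i, Y c i ^ 2) := by
  obtain ⟨K, hK0, hK⟩ := exists_norm_det_columnShift_le m s A
  refine ⟨K, hK0, fun S Y => ?_⟩
  rw [norm_mul, norm_prod]
  simp_rw [norm_cexp_neg_gaussForm_half]
  rw [← Real.exp_sum, ← Finset.mul_sum]
  calc _ ≤ Real.exp (-(1 / 2) * ∑ c, ∑ i, Y c i ^ 2)
        * (K * Real.exp ((∑ c, ∑ i, Y c i ^ 2) / 4)) :=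
        mul_le_mul_of_nonneg_left (hK Y) (Real.exp_nonneg _)
    _ = K * (Real.exp (-(1 / 2) * ∑ c, ∑ i, Y c i ^ 2)
        * Real.exp ((∑ c, ∑ i, Y c i ^ 2) / 4)) := by ring
    _ = _ := by
        rw [← Real.exp_add]
        congr 2
        ring

theorem integrable_prod_mul_det_columnShift (m : ℕ) (s : ι → ℝ) (A : Matrix ι ι ℂ)
    (S : Matrix ι ι ℝ) :
    Integrable fun Y : Fin m → ι → ℝ =>
      (∏ c, Complex.exp (-gaussForm (1 / 2) Complex.I S (Y c))) * (columnShift s A Y).det := by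
  obtain ⟨K, -, hK⟩ := norm_prod_mul_det_columnShift_le m s A
  refine ((integrable_exp_neg_sum_sum_sq m (by norm_num : (0 : ℝ) < 1 / 4)).const_mul K).mono'
    (Continuous.aestronglyMeasurable ?_) (ae_of_all _ (hK S))
  refine (continuous_finsetProd _ fun c _ => ?_).mul (continuous_det_columnShift m s A)
  exact Complex.continuous_exp.comp
    ((continuous_gaussForm _ _ S).comp (continuous_apply c)).neg

theorem integral_cexp_neg_gaussForm_mul_det_columnShift {S : Matrix ι ι ℝ} (hS : S.IsHermitian)
    (m : ℕ) (s : ι → ℝ) (A : Matrix ι ι ℂ) :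
    ∫ Y : Fin m → ι → ℝ,
      (∏ c, Complex.exp (-gaussForm (1 / 2) Complex.I S (Y c))) * (columnShift s A Y).det
      = (∏ k, (Real.pi / (1 / 2 + Complex.I * hS.eigenvalues k)) ^ (1 / 2 : ℂ)) ^ m
        * laguerreFunctional m (detPencil A (of fun k i => (s k : ℂ) * s i
          * (((1 / 2 : ℂ) • (1 : Matrix ι ι ℂ) + Complex.I • S.map Complex.ofReal)⁻¹ k i / 2))) := by
  have hz : ∀ k, 0 < (1 / 2 + Complex.I * hS.eigenvalues k : ℂ).re := by
    intro k
    simp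
  have h0 : Integrable fun y : ι → ℝ => Complex.exp (-gaussForm (1 / 2) Complex.I S y) := by
    have hg : Integrable fun y : ι → ℝ => Real.exp (-(1 / 2) * ∑ i, y i ^ 2) := by
      simp_rw [Finset.mul_sum, Real.exp_sum]
      exact Integrable.fintype_prod (f := fun _ t => Real.exp (-(1 / 2) * t ^ 2)) fun _ =>
        integrable_exp_neg_mul_sq (by norm_num)
    exact hg.mono' (Complex.continuous_exp.comp (continuous_gaussForm _ _ S).neg).aestronglyMeasurable
      (ae_of_all _ fun y => (norm_cexp_neg_gaussForm_half S y).le)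
  refine integral_prod_mul_det_columnShift h0 (integral_cexp_neg_gaussForm hS _ _ hz)
    (integrable_cexp_neg_gaussForm_mul_mul S s) (fun k i => ?_)
    (fun m A => integrable_prod_mul_det_columnShift m s A S) m A
  have e : ∀ y : ι → ℝ, Complex.exp (-gaussForm (1 / 2) Complex.I S y)
      * (((s k * y k : ℝ) : ℂ) * ((s i * y i : ℝ) : ℂ))
      = (s k : ℂ) * s i * ((y k : ℂ) * (y i : ℂ)
        * Complex.exp (-gaussForm (1 / 2) Complex.I S y)) := by
    intro y
    push_cast
    ring
  simp_rw [e]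
  rw [integral_const_mul, integral_mul_mul_cexp_neg_gaussForm hS _ _ hz, of_apply]
  ring

end GaussianColumns

section LaguerreMoments

variable {p : ℕ}

/-- The alternating sums `∑_k (-1)^k x₁^{p-k} E_{k-e} / (n-k)!`. -/
noncomputable def laguerreMoment (n : ℕ) (Λ : Fin p → ℝ) (x₁ : ℂ) (e : ℕ) (s : Finset (Fin p)) :
    ℂ :=
  ∑ k ∈ Finset.range (p + 1), (-1 : ℂ) ^ k * x₁ ^ (p - k) / (Nat.factorial (n - k))
    * ((if e ≤ k then esymm s Λ (k - e) else 0 : ℝ) : ℂ)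

/-- The polynomial `∏_{i ∈ s} (x₁ + Λ_i X)`. -/
noncomputable def linearProd (Λ : Fin p → ℝ) (x₁ : ℂ) (s : Finset (Fin p)) : Polynomial ℂ :=
  ∏ i ∈ s, (Polynomial.X * Polynomial.C (Λ i : ℂ) + Polynomial.C x₁)

theorem eval_linearProd (Λ : Fin p → ℝ) (x₁ : ℂ) (s : Finset (Fin p)) (t : ℂ) :
    (linearProd Λ x₁ s).eval t = ∏ i ∈ s, (t * Λ i + x₁) := by
  rw [linearProd, Polynomial.eval_prod]
  simp [mul_comm t]

theorem laguerreFunctional_X_pow_mul_linearProd {n : ℕ} (hpn : p ≤ n) (Λ : Fin p → ℝ) (x₁ : ℂ)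
    (e : ℕ) (s : Finset (Fin p)) (hs : s.card + e = p) :
    laguerreFunctional n (Polynomial.X ^ e * linearProd Λ x₁ s)
      = n.factorial * laguerreMoment n Λ x₁ e s := by
  have h1 : Polynomial.X ^ e * linearProd Λ x₁ s
      = ∑ j ∈ Finset.range (s.card + 1), Polynomial.C ((esymm s Λ j : ℝ) * x₁ ^ (s.card - j) : ℂ)
        * Polynomial.X ^ (j + e) := by
    rw [linearProd, Finset.prod_add, Finset.sum_powerset, Finset.mul_sum]
    refine Finset.sum_congr rfl fun j _ => ?_
    rw [esymm, Complex.ofReal_sum, Finset.sum_mul, map_sum, Finset.sum_mul, Finset.mul_sum]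
    refine Finset.sum_congr rfl fun t ht => ?_
    obtain ⟨hts, htc⟩ := Finset.mem_powersetCard.mp ht
    rw [Finset.prod_const, Finset.prod_mul_distrib, Finset.prod_const, htc,
      Finset.card_sdiff_of_subset hts, htc, ← map_prod, ← map_pow, map_mul, Complex.ofReal_prod]
    ring
  rw [h1, map_sum, laguerreMoment, show p + 1 = e + (s.card + 1) by omega, Finset.sum_range_add _ e (s.card + 1),
    Finset.sum_eq_zero (s := Finset.range e), zero_add, Finset.mul_sum]
  · refine Finset.sum_congr rfl fun j hj => ?_
    have hj' : j ≤ s.card := Nat.lt_succ_iff.mp (Finset.mem_range.mp hj)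
    rw [if_pos (Nat.le_add_right e j), Nat.add_sub_cancel_left, ← Polynomial.smul_eq_C_mul,
      map_smul, laguerreFunctional_X_pow, smul_eq_mul, show p - (e + j) = s.card - j by omega,
      add_comm j e, ← Nat.factorial_mul_descFactorial (show e + j ≤ n by omega)]
    have := Nat.cast_ne_zero (R := ℂ).mpr (Nat.factorial_ne_zero (n - (e + j)))
    push_cast
    field_simp
  · intro k hk
    rw [if_neg (by have := Finset.mem_range.mp hk; omega)]
    simp

/-- The coefficient of order zero in the eigenvalue representation. -/
noncomputable def coeffZero (n : ℕ) (Λ : Fin p → ℝ) (x₁ : ℂ) : ℂ :=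
  n * (n - 1) * laguerreMoment n Λ x₁ 0 Finset.univ

/-- The coefficients of order one in the eigenvalue representation. -/
noncomputable def coeffOne (n : ℕ) (Λ : Fin p → ℝ) (x₁ : ℂ) (j : Fin p) : ℂ :=
  (n - 1) * (Λ j : ℂ) ^ 2 * laguerreMoment n Λ x₁ 1 (Finset.univ.erase j)

/-- The coefficients of order two in the eigenvalue representation. -/
noncomputable def coeffTwo (n : ℕ) (Λ : Fin p → ℝ) (x₁ : ℂ) (j l : Fin p) : ℂ :=
  (Λ j : ℂ) ^ 2 * (Λ l : ℂ) ^ 2 * laguerreMoment n Λ x₁ 2 ((Finset.univ.erase j).erase l)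

theorem detPencil_eq_linearProd {Λ : Fin p → ℝ} (hΛ : ∀ j, 0 < Λ j) (x₁ α β : ℂ)
    (a b : Fin p → ℂ) :
    detPencil (x₁ • (1 : Matrix (Fin p) (Fin p) ℂ))
        (diagonal (fun j => (Λ j : ℂ)) + α • vecMulVec a a + β • vecMulVec b b)
      = Polynomial.X ^ 0 * linearProd Λ x₁ Finset.univ
        + α • ∑ j, a j ^ 2 • (Polynomial.X ^ 1 * linearProd Λ x₁ (Finset.univ.erase j))
        + β • ∑ j, b j ^ 2 • (Polynomial.X ^ 1 * linearProd Λ x₁ (Finset.univ.erase j))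
        + (α * β / 2) • ∑ j, ∑ l ∈ Finset.univ.erase j, (a j * b l - a l * b j) ^ 2
          • (Polynomial.X ^ 2 * linearProd Λ x₁ ((Finset.univ.erase j).erase l)) := by
  refine Polynomial.eq_of_infinite_eval_eq _ _ ?_
  have hfin : (⋃ j, {t : ℂ | t * Λ j + x₁ = 0}).Finite := by
    refine Set.finite_iUnion fun j => (Set.finite_singleton (-x₁ / Λ j)).subset fun t ht => ?_
    have h0 : (Λ j : ℂ) ≠ 0 := Complex.ofReal_ne_zero.mpr (hΛ j).ne'
    rw [Set.mem_singleton_iff, eq_div_iff h0]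
    exact eq_neg_of_add_eq_zero_left ht
  refine hfin.infinite_compl.mono fun t ht => ?_
  have ht' : ∀ j, t * Λ j + x₁ ≠ 0 := fun j h => ht (Set.mem_iUnion.mpr ⟨j, h⟩)
  have e : x₁ • (1 : Matrix (Fin p) (Fin p) ℂ)
      + t • (diagonal (fun j => (Λ j : ℂ)) + α • vecMulVec a a + β • vecMulVec b b)
      = diagonal (fun j => t * Λ j + x₁) + (t * α) • vecMulVec a a + (t * β) • vecMulVec b b := by
    ext i j
    simp only [Matrix.add_apply, Matrix.smul_apply, smul_eq_mul, one_apply, diagonal_apply]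
    split_ifs <;> ring
  rw [Set.mem_ofPred_eq, eval_detPencil, e, det_diagonal_add_rank_two ht']
  simp only [Polynomial.eval_add, Polynomial.eval_smul, Polynomial.eval_finsetSum,
    Polynomial.eval_mul, Polynomial.eval_pow, Polynomial.eval_X, eval_linearProd, smul_eq_mul,
    pow_zero, one_mul, pow_one, Finset.mul_sum]
  congr 1
  · congr 1
    · congr 1
      exact Finset.sum_congr rfl fun j _ => by ring
    · exact Finset.sum_congr rfl fun j _ => by ring
  · exact Finset.sum_congr rfl fun j _ => Finset.sum_congr rfl fun l _ => by ring

theorem laguerreFunctional_detPencil {n : ℕ} (hn : 2 ≤ n) (hpn : p ≤ n) {Λ : Fin p → ℝ}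
    (hΛ : ∀ j, 0 < Λ j) (x₁ α β : ℂ) (u v : Fin p → ℂ) :
    laguerreFunctional n (detPencil (x₁ • (1 : Matrix (Fin p) (Fin p) ℂ))
        (diagonal (fun j => (Λ j : ℂ)) + α • vecMulVec (fun j => Λ j * u j) (fun j => Λ j * u j)
          + β • vecMulVec (fun j => Λ j * v j) (fun j => Λ j * v j)))
      = (n - 2).factorial * (coeffZero n Λ x₁
        + n * (α * ∑ j, coeffOne n Λ x₁ j * u j ^ 2)
        + n * (β * ∑ j, coeffOne n Λ x₁ j * v j ^ 2)
        + n * (n - 1) * (α * β / 2 * ∑ j, ∑ l ∈ Finset.univ.erase j,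
          coeffTwo n Λ x₁ j l * (u j * v l - u l * v j) ^ 2)) := by
  have hfac : (n.factorial : ℂ) = (n - 2).factorial * (n * (n - 1)) := by
    obtain ⟨m, rfl⟩ := Nat.exists_eq_add_of_le hn
    rw [add_comm 2 m, Nat.add_sub_cancel, Nat.factorial_succ, Nat.factorial_succ]
    push_cast
    ring
  have c1 : ∀ j : Fin p, (Finset.univ.erase j).card + 1 = p := by
    intro j
    rw [Finset.card_erase_add_one (Finset.mem_univ j), Finset.card_univ, Fintype.card_fin]
  have c2 : ∀ j : Fin p, ∀ l ∈ Finset.univ.erase j, ((Finset.univ.erase j).erase l).card + 2 = p := by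
    intro j l hl
    have := Finset.card_erase_add_one hl
    have := c1 j
    omega
  rw [detPencil_eq_linearProd hΛ]
  simp only [map_add, map_smul, map_sum, smul_eq_mul]
  rw [laguerreFunctional_X_pow_mul_linearProd hpn _ _ _ _ (by simp), hfac]
  have e1 : ∀ w : Fin p → ℂ, ∑ j, (Λ j * w j) ^ 2 * laguerreFunctional n
      (Polynomial.X ^ 1 * linearProd Λ x₁ (Finset.univ.erase j))
      = (n - 2).factorial * n * ∑ j, coeffOne n Λ x₁ j * w j ^ 2 := by
    intro w
    rw [Finset.mul_sum]
    refine Finset.sum_congr rfl fun j _ => ?_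
    rw [laguerreFunctional_X_pow_mul_linearProd hpn _ _ _ _ (c1 j), hfac, coeffOne]
    ring
  have e2 : ∑ j, ∑ l ∈ Finset.univ.erase j,
      (Λ j * u j * (Λ l * v l) - Λ l * u l * (Λ j * v j)) ^ 2 * laguerreFunctional n
        (Polynomial.X ^ 2 * linearProd Λ x₁ ((Finset.univ.erase j).erase l))
      = (n - 2).factorial * (n * (n - 1)) * ∑ j, ∑ l ∈ Finset.univ.erase j,
          coeffTwo n Λ x₁ j l * (u j * v l - u l * v j) ^ 2 := by
    rw [Finset.mul_sum]
    refine Finset.sum_congr rfl fun j _ => ?_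
    rw [Finset.mul_sum]
    refine Finset.sum_congr rfl fun l hl => ?_
    rw [laguerreFunctional_X_pow_mul_linearProd hpn _ _ _ _ (c2 j l hl), hfac, coeffTwo]
    ring
  rw [e1, e1, e2, coeffZero]
  ring

end LaguerreMoments

section PairKernel

variable {p : ℕ}

/-- The `p × 2` matrix with columns `√Λ u` and `√Λ v`. -/
noncomputable def pairMatrix (Λ : Fin p → ℝ) (U : (Fin p → ℝ) × (Fin p → ℝ)) :
    Matrix (Fin p) (Fin 2) ℝ :=
  of fun j => ![√(Λ j) * U.1 j, √(Λ j) * U.2 j]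

theorem isHermitian_pairMatrix_mul_transpose (Λ : Fin p → ℝ) (U : (Fin p → ℝ) × (Fin p → ℝ)) :
    (pairMatrix Λ U * (pairMatrix Λ U)ᵀ).IsHermitian := by
  rw [IsHermitian, conjTranspose_eq_transpose_of_trivial, transpose_mul, transpose_transpose]

/-- The average of the shifted determinant against the Gaussian twisted by a pair of vectors. -/
noncomputable def pairAverage (n : ℕ) (Λ : Fin p → ℝ) (x₁ : ℂ)
    (U : (Fin p → ℝ) × (Fin p → ℝ)) : ℂ :=
  ∫ Y : Fin n → Fin p → ℝ, (∏ c, Complex.exp (-gaussForm (1 / 2) Complex.I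
      (pairMatrix Λ U * (pairMatrix Λ U)ᵀ) (Y c)))
    * (columnShift (fun j => √(Λ j)) (x₁ • 1) Y).det

/-- The bilinear form `∑ Λ_j u_j v_j`. -/
noncomputable def scaledDot (Λ : Fin p → ℝ) (u v : Fin p → ℝ) : ℝ := ∑ j, Λ j * (u j * v j)

theorem transpose_mul_pairMatrix {Λ : Fin p → ℝ} (hΛ : ∀ j, 0 < Λ j)
    {U : (Fin p → ℝ) × (Fin p → ℝ)} (hU : scaledDot Λ U.1 U.2 = 0) :
    (pairMatrix Λ U)ᵀ * pairMatrix Λ U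
      = diagonal ![scaledDot Λ U.1 U.1, scaledDot Λ U.2 U.2] := by
  have e : ∀ j a b, √(Λ j) * a * (√(Λ j) * b) = Λ j * (a * b) := by
    intro j a b
    have := Real.mul_self_sqrt (hΛ j).le
    linear_combination (a * b) * this
  have hU' : scaledDot Λ U.2 U.1 = 0 := by
    rw [← hU]
    exact Finset.sum_congr rfl fun j _ => by ring
  unfold scaledDot at *
  ext i j
  fin_cases i <;> fin_cases j <;> simp [mul_apply, pairMatrix, e, hU, hU']

theorem one_add_two_I_mul_ne_zero (b : ℝ) : (1 + 2 * Complex.I * b : ℂ) ≠ 0 := by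
  intro h
  have := congrArg Complex.re h
  simp at this

theorem inv_half_add_pairMatrix {Λ : Fin p → ℝ} (hΛ : ∀ j, 0 < Λ j)
    {U : (Fin p → ℝ) × (Fin p → ℝ)} (hU : scaledDot Λ U.1 U.2 = 0) (k i : Fin p) :
    ((1 / 2 : ℂ) • (1 : Matrix (Fin p) (Fin p) ℂ) + Complex.I
      • (pairMatrix Λ U * (pairMatrix Λ U)ᵀ).map Complex.ofReal)⁻¹ k i
      = 2 * ((1 : Matrix (Fin p) (Fin p) ℂ) k i
        - 2 * Complex.I / (1 + 2 * Complex.I * scaledDot Λ U.1 U.1)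
          * ((√(Λ k) * U.1 k : ℝ) * (√(Λ i) * U.1 i : ℝ))
        - 2 * Complex.I / (1 + 2 * Complex.I * scaledDot Λ U.2 U.2)
          * ((√(Λ k) * U.2 k : ℝ) * (√(Λ i) * U.2 i : ℝ))) := by
  set w₁ : Fin p → ℂ := fun j => ((√(Λ j) * U.1 j : ℝ) : ℂ) with hw₁
  set w₂ : Fin p → ℂ := fun j => ((√(Λ j) * U.2 j : ℝ) : ℂ) with hw₂
  set b₁ := scaledDot Λ U.1 U.1
  set b₂ := scaledDot Λ U.2 U.2
  have hβ₁ := one_add_two_I_mul_ne_zero b₁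
  have hβ₂ := one_add_two_I_mul_ne_zero b₂
  have hS : (pairMatrix Λ U * (pairMatrix Λ U)ᵀ).map Complex.ofReal
      = vecMulVec w₁ w₁ + vecMulVec w₂ w₂ := by
    ext i j
    simp [mul_apply, pairMatrix, vecMulVec_apply, hw₁, hw₂]
  have hd := transpose_mul_pairMatrix hΛ hU
  have d₁₁ : w₁ ⬝ᵥ w₁ = b₁ := by
    have h := congrArg (fun x : ℝ => (x : ℂ)) (congrFun (congrFun hd 0) 0)
    simpa [mul_apply, pairMatrix, dotProduct, hw₁] using h
  have d₂₂ : w₂ ⬝ᵥ w₂ = b₂ := by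
    have h := congrArg (fun x : ℝ => (x : ℂ)) (congrFun (congrFun hd 1) 1)
    simpa [mul_apply, pairMatrix, dotProduct, hw₂] using h
  have d₁₂ : w₁ ⬝ᵥ w₂ = 0 := by
    have h := congrArg (fun x : ℝ => (x : ℂ)) (congrFun (congrFun hd 0) 1)
    simpa [mul_apply, pairMatrix, dotProduct, hw₁, hw₂] using h
  have d₂₁ : w₂ ⬝ᵥ w₁ = 0 := by rw [dotProduct_comm, d₁₂]
  have hinv : ((1 / 2 : ℂ) • (1 : Matrix (Fin p) (Fin p) ℂ) + Complex.I
      • (pairMatrix Λ U * (pairMatrix Λ U)ᵀ).map Complex.ofReal)⁻¹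
      = (2 : ℂ) • ((1 : Matrix (Fin p) (Fin p) ℂ)
        - (2 * Complex.I / (1 + 2 * Complex.I * b₁)) • vecMulVec w₁ w₁
        - (2 * Complex.I / (1 + 2 * Complex.I * b₂)) • vecMulVec w₂ w₂) := by
    refine inv_eq_right_inv ?_
    rw [hS]
    simp only [add_mul, mul_sub, smul_add, smul_sub, mul_one, one_mul, Matrix.smul_mul,
      Matrix.mul_smul, vecMulVec_mul_vecMulVec, d₁₁, d₂₂, d₁₂, d₂₁]
    ext i j
    simp only [Matrix.add_apply, Matrix.sub_apply, Matrix.smul_apply, vecMulVec_apply,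
      smul_eq_mul, Pi.smul_apply, zero_smul, Pi.zero_apply]
    field_simp
    ring
  rw [hinv]
  simp [vecMulVec_apply, hw₁, hw₂]

theorem pairAverage_of_scaledDot_eq_zero {n : ℕ} (hn : 2 ≤ n) (hpn : p ≤ n) {Λ : Fin p → ℝ}
    (hΛ : ∀ j, 0 < Λ j) (x₁ : ℂ) {U : (Fin p → ℝ) × (Fin p → ℝ)}
    (hU : scaledDot Λ U.1 U.2 = 0) :
    pairAverage n Λ x₁ U = ((√(2 * Real.pi) : ℝ) : ℂ) ^ (p * n) / (2 * Real.pi) ^ n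
      * ((Real.pi / (1 / 2 + Complex.I * scaledDot Λ U.1 U.1)) ^ (1 / 2 : ℂ)) ^ n
      * ((Real.pi / (1 / 2 + Complex.I * scaledDot Λ U.2 U.2)) ^ (1 / 2 : ℂ)) ^ n
      * ((n - 2).factorial * (coeffZero n Λ x₁
        + n * (-(2 * Complex.I) / (1 + 2 * Complex.I * scaledDot Λ U.1 U.1)
          * ∑ j, coeffOne n Λ x₁ j * (U.1 j : ℂ) ^ 2)
        + n * (-(2 * Complex.I) / (1 + 2 * Complex.I * scaledDot Λ U.2 U.2)
          * ∑ j, coeffOne n Λ x₁ j * (U.2 j : ℂ) ^ 2)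
        + n * (n - 1) * (-(2 * Complex.I) / (1 + 2 * Complex.I * scaledDot Λ U.1 U.1)
          * (-(2 * Complex.I) / (1 + 2 * Complex.I * scaledDot Λ U.2 U.2)) / 2
          * ∑ j, ∑ l ∈ Finset.univ.erase j, coeffTwo n Λ x₁ j l
            * ((U.1 j : ℂ) * U.2 l - U.1 l * U.2 j) ^ 2))) := by
  have hC : (of fun k i => ((√(Λ k) : ℝ) : ℂ) * (√(Λ i) : ℝ)
      * (((1 / 2 : ℂ) • (1 : Matrix (Fin p) (Fin p) ℂ) + Complex.I
        • (pairMatrix Λ U * (pairMatrix Λ U)ᵀ).map Complex.ofReal)⁻¹ k i / 2))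
      = diagonal (fun j => (Λ j : ℂ))
        + (-(2 * Complex.I) / (1 + 2 * Complex.I * scaledDot Λ U.1 U.1))
          • vecMulVec (fun j => (Λ j : ℂ) * U.1 j) (fun j => (Λ j : ℂ) * U.1 j)
        + (-(2 * Complex.I) / (1 + 2 * Complex.I * scaledDot Λ U.2 U.2))
          • vecMulVec (fun j => (Λ j : ℂ) * U.2 j) (fun j => (Λ j : ℂ) * U.2 j) := by
    have hs : ∀ j, ((√(Λ j) : ℝ) : ℂ) * (√(Λ j) : ℝ) = Λ j := by
      intro j
      rw [← Complex.ofReal_mul, Real.mul_self_sqrt (hΛ j).le]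
    ext k i
    rw [of_apply, inv_half_add_pairMatrix hΛ hU]
    simp only [Matrix.add_apply, Matrix.smul_apply, vecMulVec_apply, smul_eq_mul, diagonal_apply,
      one_apply]
    rw [← hs k, ← hs i]
    push_cast
    split_ifs with h
    · subst h; ring
    · ring
  have hN : ∏ k, (Real.pi / (1 / 2 + Complex.I
        * (isHermitian_pairMatrix_mul_transpose Λ U).eigenvalues k)) ^ (1 / 2 : ℂ)
      = ((√(2 * Real.pi) : ℝ) : ℂ) ^ p / (2 * Real.pi)
        * (Real.pi / (1 / 2 + Complex.I * scaledDot Λ U.1 U.1)) ^ (1 / 2 : ℂ)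
        * (Real.pi / (1 / 2 + Complex.I * scaledDot Λ U.2 U.2)) ^ (1 / 2 : ℂ) := by
    have h := prod_eigenvalues_mul_transpose (transpose_mul_pairMatrix hΛ hU)
      (isHermitian_pairMatrix_mul_transpose Λ U)
      (fun t => (Real.pi / (1 / 2 + Complex.I * t)) ^ (1 / 2 : ℂ))
    have h0 : ((Real.pi : ℂ) / (1 / 2 + Complex.I * (0 : ℝ))) ^ (1 / 2 : ℂ)
        = ((√(2 * Real.pi) : ℝ) : ℂ) := by
      rw [Real.sqrt_eq_rpow, Complex.ofReal_cpow (by positivity)]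
      push_cast
      congr 1
      simp
      ring
    have h2 : ((√(2 * Real.pi) : ℝ) : ℂ) ^ 2 = 2 * Real.pi := by
      rw [← Complex.ofReal_pow, Real.sq_sqrt (by positivity)]
      push_cast
      ring
    simp only [h0, Fintype.card_fin, Fin.prod_univ_two, h2, cons_val_zero, cons_val_one] at h
    have hπ : (2 * Real.pi : ℂ) ≠ 0 := by
      simp [Real.pi_ne_zero]
    rw [mul_assoc, div_mul_eq_mul_div, eq_div_iff hπ, ← h]
    ring
  rw [pairAverage, integral_cexp_neg_gaussForm_mul_det_columnShift
    (isHermitian_pairMatrix_mul_transpose Λ U), hC, laguerreFunctional_detPencil hn hpn hΛ, hN]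
  rw [mul_pow, mul_pow, div_pow, ← pow_mul]

end PairKernel

section RotatedPairs

variable {p : ℕ}

/-- Rotation by the angle `φ` in the plane spanned by a pair of vectors. -/
noncomputable def rotatePair (φ : ℝ) (U : (Fin p → ℝ) × (Fin p → ℝ)) :
    (Fin p → ℝ) × (Fin p → ℝ) :=
  (fun j => Real.cos φ * U.1 j + Real.sin φ * U.2 j,
    fun j => -Real.sin φ * U.1 j + Real.cos φ * U.2 j)

theorem rotatePair_rotatePair (φ ψ : ℝ) (U : (Fin p → ℝ) × (Fin p → ℝ)) :
    rotatePair φ (rotatePair ψ U) = rotatePair (φ + ψ) U := by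
  ext j <;> simp only [rotatePair, Real.cos_add, Real.sin_add] <;> ring

/-- The squared norm of a pair of vectors. -/
noncomputable def pairNormSq (U : (Fin p → ℝ) × (Fin p → ℝ)) : ℝ :=
  ∑ j, U.1 j ^ 2 + ∑ j, U.2 j ^ 2

theorem pairNormSq_nonneg (U : (Fin p → ℝ) × (Fin p → ℝ)) : 0 ≤ pairNormSq U := by
  unfold pairNormSq
  positivity

theorem pairNormSq_rotatePair (φ : ℝ) (U : (Fin p → ℝ) × (Fin p → ℝ)) :
    pairNormSq (rotatePair φ U) = pairNormSq U := by
  simp only [pairNormSq, rotatePair, ← Finset.sum_add_distrib]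
  refine Finset.sum_congr rfl fun j _ => ?_
  linear_combination (U.1 j ^ 2 + U.2 j ^ 2) * Real.sin_sq_add_cos_sq φ

theorem scaledDot_rotatePair_fst (Λ : Fin p → ℝ) (φ : ℝ) (U : (Fin p → ℝ) × (Fin p → ℝ)) :
    scaledDot Λ (rotatePair φ U).1 (rotatePair φ U).1 = Real.cos φ ^ 2 * scaledDot Λ U.1 U.1
      + Real.sin φ ^ 2 * scaledDot Λ U.2 U.2
      + 2 * Real.sin φ * Real.cos φ * scaledDot Λ U.1 U.2 := by
  simp only [scaledDot, rotatePair, Finset.mul_sum, ← Finset.sum_add_distrib]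
  exact Finset.sum_congr rfl fun j _ => by ring

theorem scaledDot_rotatePair_snd (Λ : Fin p → ℝ) (φ : ℝ) (U : (Fin p → ℝ) × (Fin p → ℝ)) :
    scaledDot Λ (rotatePair φ U).2 (rotatePair φ U).2 = Real.sin φ ^ 2 * scaledDot Λ U.1 U.1
      + Real.cos φ ^ 2 * scaledDot Λ U.2 U.2
      - 2 * Real.sin φ * Real.cos φ * scaledDot Λ U.1 U.2 := by
  simp only [scaledDot, rotatePair, Finset.mul_sum, ← Finset.sum_add_distrib,
    ← Finset.sum_sub_distrib]
  exact Finset.sum_congr rfl fun j _ => by ring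

theorem scaledDot_rotatePair (Λ : Fin p → ℝ) (φ : ℝ) (U : (Fin p → ℝ) × (Fin p → ℝ)) :
    scaledDot Λ (rotatePair φ U).1 (rotatePair φ U).2
      = Real.cos (2 * φ) * scaledDot Λ U.1 U.2
        - Real.sin (2 * φ) * ((scaledDot Λ U.1 U.1 - scaledDot Λ U.2 U.2) / 2) := by
  rw [Real.cos_two_mul', Real.sin_two_mul]
  simp only [scaledDot, rotatePair, ← Finset.sum_sub_distrib, Finset.sum_div, Finset.mul_sum]
  exact Finset.sum_congr rfl fun j _ => by ring

theorem exists_scaledDot_rotatePair_eq_zero (Λ : Fin p → ℝ) (U : (Fin p → ℝ) × (Fin p → ℝ)) :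
    ∃ φ, scaledDot Λ (rotatePair φ U).1 (rotatePair φ U).2 = 0 := by
  set z : ℂ := ⟨(scaledDot Λ U.1 U.1 - scaledDot Λ U.2 U.2) / 2, scaledDot Λ U.1 U.2⟩ with hz
  refine ⟨z.arg / 2, ?_⟩
  rw [scaledDot_rotatePair, mul_div_cancel₀ _ two_ne_zero]
  have h1 := Complex.norm_mul_cos_arg z
  have h2 := Complex.norm_mul_sin_arg z
  simp only [hz] at h1 h2
  rw [← hz] at h1 h2
  rw [← h1, ← h2]
  ring

theorem pairMatrix_rotatePair_mul_transpose (Λ : Fin p → ℝ) (φ : ℝ)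
    (U : (Fin p → ℝ) × (Fin p → ℝ)) :
    pairMatrix Λ (rotatePair φ U) * (pairMatrix Λ (rotatePair φ U))ᵀ
      = pairMatrix Λ U * (pairMatrix Λ U)ᵀ := by
  ext i j
  simp only [mul_apply, pairMatrix, rotatePair, of_apply, transpose_apply, Fin.sum_univ_two,
    cons_val_zero, cons_val_one]
  linear_combination √(Λ i) * √(Λ j) * (U.1 i * U.1 j + U.2 i * U.2 j)
    * Real.sin_sq_add_cos_sq φ

theorem pairAverage_rotatePair (n : ℕ) (Λ : Fin p → ℝ) (x₁ : ℂ) (φ : ℝ)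
    (U : (Fin p → ℝ) × (Fin p → ℝ)) :
    pairAverage n Λ x₁ (rotatePair φ U) = pairAverage n Λ x₁ U := by
  rw [pairAverage, pairMatrix_rotatePair_mul_transpose, pairAverage]

/-- The kernel dual to `pairAverage`, at the diagonal matrix with entries `r`. -/
noncomputable def dualKernel (n : ℕ) (Λ : Fin p → ℝ) (x₁ : ℂ) (r : ℝ × ℝ)
    (U : (Fin p → ℝ) × (Fin p → ℝ)) : ℂ :=
  Complex.exp (-Complex.I * (r.1 * scaledDot Λ U.1 U.1 + r.2 * scaledDot Λ U.2 U.2))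
    * (coeffZero n Λ x₁
      - 2 * Complex.I * ∑ j, coeffOne n Λ x₁ j * (r.1 * U.1 j ^ 2 + r.2 * U.2 j ^ 2)
      - 2 * (r.1 * r.2) * ∑ j, ∑ l ∈ Finset.univ.erase j, coeffTwo n Λ x₁ j l
        * ((U.1 j : ℂ) * U.2 l - U.1 l * U.2 j) ^ 2)

theorem rotatePair_add_pi (φ : ℝ) (U : (Fin p → ℝ) × (Fin p → ℝ)) :
    rotatePair (φ + Real.pi) U = -rotatePair φ U := by
  ext j <;> simp [rotatePair] <;> ring

theorem dualKernel_neg (n : ℕ) (Λ : Fin p → ℝ) (x₁ : ℂ) (r : ℝ × ℝ)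
    (U : (Fin p → ℝ) × (Fin p → ℝ)) : dualKernel n Λ x₁ r (-U) = dualKernel n Λ x₁ r U := by
  simp [dualKernel, scaledDot]

theorem dualKernel_rotatePair_of_scaledDot_eq_zero (n : ℕ) (Λ : Fin p → ℝ) (x₁ : ℂ)
    {U : (Fin p → ℝ) × (Fin p → ℝ)} (hU : scaledDot Λ U.1 U.2 = 0) (x : (ℝ × ℝ) × ℝ) :
    dualKernel n Λ x₁ x.1 (rotatePair (x.2 / 2) U)
      = twistedQuadratic (scaledDot Λ U.1 U.1) (scaledDot Λ U.2 U.2) (coeffZero n Λ x₁)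
        (-(2 * Complex.I) * ∑ j, coeffOne n Λ x₁ j * (U.1 j : ℂ) ^ 2)
        (-(2 * Complex.I) * ∑ j, coeffOne n Λ x₁ j * (U.2 j : ℂ) ^ 2)
        (-(4 * Complex.I) * ∑ j, coeffOne n Λ x₁ j * ((U.1 j : ℂ) * U.2 j))
        (-2 * ∑ j, ∑ l ∈ Finset.univ.erase j, coeffTwo n Λ x₁ j l
          * ((U.1 j : ℂ) * U.2 l - U.1 l * U.2 j) ^ 2) (spectralEntries x) := by
  obtain ⟨⟨a, b⟩, θ⟩ := x
  have hcs := Complex.sin_sq_add_cos_sq ((θ / 2 : ℝ) : ℂ)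
  have hc : ((Real.cos θ : ℝ) : ℂ) = Complex.cos ((θ / 2 : ℝ) : ℂ) ^ 2
      - Complex.sin ((θ / 2 : ℝ) : ℂ) ^ 2 := by
    rw [← Complex.cos_two_mul']
    push_cast
    congr 1
    ring
  have hs : ((Real.sin θ : ℝ) : ℂ) = 2 * Complex.sin ((θ / 2 : ℝ) : ℂ)
      * Complex.cos ((θ / 2 : ℝ) : ℂ) := by
    rw [← Complex.sin_two_mul]
    push_cast
    congr 1
    ring
  have hcs' : ((Real.cos θ : ℝ) : ℂ) ^ 2 + ((Real.sin θ : ℝ) : ℂ) ^ 2 = 1 := by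
    push_cast
    exact Complex.cos_sq_add_sin_sq _
  simp only [dualKernel, twistedQuadratic, spectralEntries, scaledDot_rotatePair_fst,
    scaledDot_rotatePair_snd, hU]
  congr 1
  · congr 1
    push_cast at hc hs hcs hcs' ⊢
    rw [hc]
    linear_combination (-Complex.I * ((a + b) / 2) * (scaledDot Λ U.1 U.1 + scaledDot Λ U.2 U.2))
      * hcs
  · have h2 : ∑ j, ∑ l ∈ Finset.univ.erase j, coeffTwo n Λ x₁ j l
          * (((rotatePair (θ / 2) U).1 j : ℂ) * (rotatePair (θ / 2) U).2 l
            - (rotatePair (θ / 2) U).1 l * (rotatePair (θ / 2) U).2 j) ^ 2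
        = ∑ j, ∑ l ∈ Finset.univ.erase j, coeffTwo n Λ x₁ j l
          * ((U.1 j : ℂ) * U.2 l - U.1 l * U.2 j) ^ 2 := by
      refine Finset.sum_congr rfl fun j _ => Finset.sum_congr rfl fun l _ => ?_
      congr 2
      simp only [rotatePair, Complex.ofReal_add, Complex.ofReal_mul, Complex.ofReal_cos,
        Complex.ofReal_sin, Complex.ofReal_neg]
      linear_combination ((U.1 j : ℂ) * U.2 l - U.1 l * U.2 j) * hcs
    have h1 : ∑ j, coeffOne n Λ x₁ j * ((a : ℂ) * (rotatePair (θ / 2) U).1 j ^ 2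
          + b * (rotatePair (θ / 2) U).2 j ^ 2)
        = ((a + b) / 2 + (a - b) / 2 * (Real.cos θ : ℝ)) * ∑ j, coeffOne n Λ x₁ j * (U.1 j : ℂ) ^ 2
          + ((a + b) / 2 - (a - b) / 2 * (Real.cos θ : ℝ))
            * ∑ j, coeffOne n Λ x₁ j * (U.2 j : ℂ) ^ 2
          + 2 * ((a - b) / 2 * (Real.sin θ : ℝ))
            * ∑ j, coeffOne n Λ x₁ j * ((U.1 j : ℂ) * U.2 j) := by
      rw [hc, hs]
      simp only [Finset.mul_sum, ← Finset.sum_add_distrib]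
      refine Finset.sum_congr rfl fun j _ => ?_
      simp only [rotatePair, Complex.ofReal_add, Complex.ofReal_mul, Complex.ofReal_cos,
        Complex.ofReal_sin, Complex.ofReal_neg]
      linear_combination (coeffOne n Λ x₁ j * ((a + b) / 2) * ((U.1 j : ℂ) ^ 2 + (U.2 j : ℂ) ^ 2))
        * hcs
    rw [h2, h1]
    simp only [Complex.ofReal_add, Complex.ofReal_sub, Complex.ofReal_mul, Complex.ofReal_div,
      Complex.ofReal_ofNat]
    generalize ∑ j, ∑ l ∈ Finset.univ.erase j, coeffTwo n Λ x₁ j l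
          * ((U.1 j : ℂ) * U.2 l - U.1 l * U.2 j) ^ 2 = T
    linear_combination (-2 * T * ((a - b) / 2) ^ 2) * hcs'

theorem le_one_add_mul_one_add_sq {a b q : ℝ} (ha : 0 ≤ a) (hb : 0 ≤ b) (hq : 0 ≤ q) :
    1 ≤ (1 + a) * (1 + b) * (1 + q) ^ 2 ∧ (a + b) * q ≤ (1 + a) * (1 + b) * (1 + q) ^ 2 ∧
      a * b * q ^ 2 ≤ (1 + a) * (1 + b) * (1 + q) ^ 2 := by
  have hab : 0 ≤ a * b := mul_nonneg ha hb
  have h1 : (1 + a) * (1 + b) = 1 + a + b + a * b := by ring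
  have h2 : (1 + q) ^ 2 = 1 + 2 * q + q ^ 2 := by ring
  have hq2 : 0 ≤ q ^ 2 := sq_nonneg q
  rw [h1, h2]
  refine ⟨one_le_mul_of_one_le_of_one_le (by linarith) (by linarith),
    mul_le_mul (by linarith) (by linarith) hq (by linarith),
    mul_le_mul (by linarith) (by linarith) hq2 (by linarith)⟩

theorem exists_norm_dualKernel_le (n : ℕ) (Λ : Fin p → ℝ) (x₁ : ℂ) :
    ∃ K : ℝ, 0 ≤ K ∧ ∀ r : ℝ × ℝ, 0 ≤ r.1 → 0 ≤ r.2 → ∀ U : (Fin p → ℝ) × (Fin p → ℝ),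
      ‖dualKernel n Λ x₁ r U‖ ≤ K * ((1 + r.1) * (1 + r.2)) * (1 + pairNormSq U) ^ 2 := by
  have hA1 : 0 ≤ ∑ j, ‖coeffOne n Λ x₁ j‖ := by positivity
  have hA2 : 0 ≤ ∑ j, ∑ l ∈ Finset.univ.erase j, ‖coeffTwo n Λ x₁ j l‖ :=
    Finset.sum_nonneg fun j _ => Finset.sum_nonneg fun l _ => norm_nonneg _
  refine ⟨‖coeffZero n Λ x₁‖ + 2 * ∑ j, ‖coeffOne n Λ x₁ j‖
    + 2 * ∑ j, ∑ l ∈ Finset.univ.erase j, ‖coeffTwo n Λ x₁ j l‖,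
    by linarith [norm_nonneg (coeffZero n Λ x₁)], ?_⟩
  intro r h1 h2 U
  set q := pairNormSq U with hq
  have hq0 : 0 ≤ q := pairNormSq_nonneg U
  have hu : ∀ j, U.1 j ^ 2 + U.2 j ^ 2 ≤ q := fun j => by
    rw [hq, pairNormSq, ← Finset.sum_add_distrib]
    exact Finset.single_le_sum (f := fun j => U.1 j ^ 2 + U.2 j ^ 2)
      (fun i _ => by positivity) (Finset.mem_univ j)
  have he : ‖Complex.exp (-Complex.I * (r.1 * scaledDot Λ U.1 U.1 + r.2 * scaledDot Λ U.2 U.2))‖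
      = 1 := by
    rw [Complex.norm_exp]
    simp
  have t1 : ‖∑ j, coeffOne n Λ x₁ j * ((r.1 : ℂ) * U.1 j ^ 2 + r.2 * U.2 j ^ 2)‖
      ≤ (∑ j, ‖coeffOne n Λ x₁ j‖) * ((r.1 + r.2) * q) := by
    rw [Finset.sum_mul]
    refine (norm_sum_le _ _).trans (Finset.sum_le_sum fun j _ => ?_)
    rw [norm_mul]
    refine mul_le_mul_of_nonneg_left ?_ (norm_nonneg _)
    have : ((r.1 : ℂ) * U.1 j ^ 2 + r.2 * U.2 j ^ 2)
        = ((r.1 * U.1 j ^ 2 + r.2 * U.2 j ^ 2 : ℝ) : ℂ) := by push_cast; ring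
    rw [this, Complex.norm_real, Real.norm_of_nonneg (by positivity)]
    nlinarith [hu j, sq_nonneg (U.1 j), sq_nonneg (U.2 j)]
  have t2 : ‖∑ j, ∑ l ∈ Finset.univ.erase j, coeffTwo n Λ x₁ j l
        * ((U.1 j : ℂ) * U.2 l - U.1 l * U.2 j) ^ 2‖
      ≤ (∑ j, ∑ l ∈ Finset.univ.erase j, ‖coeffTwo n Λ x₁ j l‖) * q ^ 2 := by
    simp only [Finset.sum_mul]
    refine (norm_sum_le _ _).trans (Finset.sum_le_sum fun j _ => ?_)
    refine (norm_sum_le _ _).trans (Finset.sum_le_sum fun l _ => ?_)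
    rw [norm_mul]
    refine mul_le_mul_of_nonneg_left ?_ (norm_nonneg _)
    have : ((U.1 j : ℂ) * U.2 l - U.1 l * U.2 j) ^ 2
        = (((U.1 j * U.2 l - U.1 l * U.2 j) ^ 2 : ℝ) : ℂ) := by push_cast; ring
    rw [this, Complex.norm_real, Real.norm_of_nonneg (by positivity)]
    calc (U.1 j * U.2 l - U.1 l * U.2 j) ^ 2
        ≤ (U.1 j ^ 2 + U.2 j ^ 2) * (U.1 l ^ 2 + U.2 l ^ 2) := by
          nlinarith [sq_nonneg (U.1 j * U.1 l + U.2 j * U.2 l)]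
      _ ≤ q * q := mul_le_mul (hu j) (hu l) (by positivity) hq0
      _ = q ^ 2 := by ring
  have hw : 0 ≤ r.1 * r.2 := mul_nonneg h1 h2
  rw [dualKernel, norm_mul, he, one_mul]
  refine (norm_sub_le _ _).trans ?_
  refine (add_le_add_left (norm_sub_le _ _) _).trans ?_
  have n1 : ‖(2 : ℂ) * Complex.I * ∑ j, coeffOne n Λ x₁ j * ((r.1 : ℂ) * U.1 j ^ 2 + r.2 * U.2 j ^ 2)‖
      ≤ 2 * ((∑ j, ‖coeffOne n Λ x₁ j‖) * ((r.1 + r.2) * q)) := by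
    rw [norm_mul, norm_mul, Complex.norm_I, mul_one, Complex.norm_ofNat]
    exact mul_le_mul_of_nonneg_left t1 (by norm_num)
  have n2 : ‖(2 : ℂ) * (r.1 * r.2) * ∑ j, ∑ l ∈ Finset.univ.erase j, coeffTwo n Λ x₁ j l
        * ((U.1 j : ℂ) * U.2 l - U.1 l * U.2 j) ^ 2‖
      ≤ 2 * (r.1 * r.2) * ((∑ j, ∑ l ∈ Finset.univ.erase j, ‖coeffTwo n Λ x₁ j l‖) * q ^ 2) := by
    rw [norm_mul, norm_mul, Complex.norm_ofNat, ← Complex.ofReal_mul, Complex.norm_real,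
      Real.norm_of_nonneg hw]
    exact mul_le_mul_of_nonneg_left t2 (by positivity)
  obtain ⟨hX1, hX2, hX3⟩ := le_one_add_mul_one_add_sq h1 h2 hq0
  have e1 := mul_le_mul_of_nonneg_left hX1 (norm_nonneg (coeffZero n Λ x₁))
  have e2 := mul_le_mul_of_nonneg_left hX2 hA1
  have e3 := mul_le_mul_of_nonneg_left hX3 hA2
  linarith

end RotatedPairs

section DualRepresentation

theorem integrableOn_rpow_mul_one_add_sq_mul_exp {m : ℝ} (hm : -1 < m) :
    IntegrableOn (fun r : ℝ => r ^ m * (1 + r) ^ 2 * Real.exp (-r / 2)) (Set.Ioi 0) := by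
  have h : ∀ s : ℝ, -1 < s → IntegrableOn (fun r : ℝ => r ^ s * Real.exp (-r / 2)) (Set.Ioi 0) := by
    intro s hs
    have := integrableOn_rpow_mul_exp_neg_mul_rpow hs one_pos (b := 1 / 2) (by norm_num)
    refine this.congr_fun (fun r _ => ?_) measurableSet_Ioi
    simp only [Real.rpow_one]
    congr 2
    ring
  refine (((h m hm).add ((h (m + 1) (by linarith)).const_mul 2)).add
    (h (m + 2) (by linarith))).congr_fun (fun r hr => ?_) measurableSet_Ioi
  have hr' : (0 : ℝ) < r := hr
  simp only [Pi.add_apply]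
  rw [Real.rpow_add hr', Real.rpow_one, Real.rpow_add hr', Real.rpow_two]
  ring

theorem integrableOn_eigenDensity_mul {m : ℝ} (hm : -1 < m) :
    IntegrableOn (fun r : ℝ × ℝ => eigenDensity m r * ((1 + r.1) * (1 + r.2)))
      (Set.Ioi 0 ×ˢ Set.Ioi 0) := by
  have h := integrableOn_rpow_mul_one_add_sq_mul_exp hm
  have h2 := Integrable.mul_prod h h
  rw [Measure.prod_restrict, ← Measure.volume_eq_prod] at h2
  refine Integrable.mono' h2 ?_ (ae_restrict_of_forall_mem
    (measurableSet_Ioi.prod measurableSet_Ioi) fun r hr => ?_)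
  · exact ((measurable_eigenDensity m).mul (by fun_prop)).aestronglyMeasurable
  · obtain ⟨h1, h2⟩ := hr
    have h1 : 0 < r.1 := h1
    have h2 : 0 < r.2 := h2
    have ha : |r.1 - r.2| ≤ (1 + r.1) * (1 + r.2) := by
      rw [abs_le]
      constructor <;> nlinarith [mul_pos h1 h2]
    rw [eigenDensity, Real.mul_rpow h1.le h2.le, Real.norm_of_nonneg (by positivity),
      show -(r.1 + r.2) / 2 = -r.1 / 2 + -r.2 / 2 by ring, Real.exp_add]
    calc |r.1 - r.2| * (r.1 ^ m * r.2 ^ m) * (Real.exp (-r.1 / 2) * Real.exp (-r.2 / 2))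
          * ((1 + r.1) * (1 + r.2))
        = |r.1 - r.2| * (r.1 ^ m * r.2 ^ m * (Real.exp (-r.1 / 2) * Real.exp (-r.2 / 2))
          * ((1 + r.1) * (1 + r.2))) := by ring
      _ ≤ ((1 + r.1) * (1 + r.2)) * (r.1 ^ m * r.2 ^ m
          * (Real.exp (-r.1 / 2) * Real.exp (-r.2 / 2)) * ((1 + r.1) * (1 + r.2))) :=
          mul_le_mul_of_nonneg_right ha (by positivity)
      _ = _ := by ring

theorem integrable_eigenDensity_mul_eigenMeasure {m : ℝ} (hm : -1 < m) :
    Integrable (fun x : (ℝ × ℝ) × ℝ => eigenDensity m x.1 * ((1 + x.1.1) * (1 + x.1.2)))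
      eigenMeasure :=
  (integrableOn_eigenDensity_mul hm).comp_fst _

variable {p : ℕ}

theorem ae_eigenMeasure_norm_le {n : ℕ} {Λ : Fin p → ℝ} {x₁ : ℂ} {K : ℝ}
    (hK : ∀ r : ℝ × ℝ, 0 ≤ r.1 → 0 ≤ r.2 → ∀ U : (Fin p → ℝ) × (Fin p → ℝ),
      ‖dualKernel n Λ x₁ r U‖ ≤ K * ((1 + r.1) * (1 + r.2)) * (1 + pairNormSq U) ^ 2) (m : ℝ) :
    ∀ᵐ x ∂eigenMeasure, ∀ U : (Fin p → ℝ) × (Fin p → ℝ),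
      ‖(eigenDensity m x.1 : ℂ) * dualKernel n Λ x₁ x.1 (rotatePair (x.2 / 2) U)‖
        ≤ eigenDensity m x.1 * ((1 + x.1.1) * (1 + x.1.2)) * (K * (1 + pairNormSq U) ^ 2) := by
  unfold eigenMeasure
  rw [Measure.prod_restrict]
  refine ae_restrict_of_forall_mem
    ((measurableSet_Ioi.prod measurableSet_Ioi).prod measurableSet_Ioo) fun x hx U => ?_
  obtain ⟨⟨h1, h2⟩, -⟩ := hx
  have h1 : 0 < x.1.1 := h1
  have h2 : 0 < x.1.2 := h2
  have he : 0 ≤ eigenDensity m x.1 := by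
    unfold eigenDensity
    positivity
  rw [norm_mul, Complex.norm_real, Real.norm_of_nonneg he]
  have h := hK x.1 h1.le h2.le (rotatePair (x.2 / 2) U)
  rw [pairNormSq_rotatePair] at h
  refine (mul_le_mul_of_nonneg_left h he).trans_eq ?_
  ring

theorem measurable_eigenDensity_mul_dualKernel (m : ℝ) (n : ℕ) (Λ : Fin p → ℝ) (x₁ : ℂ) :
    Measurable fun z : ((ℝ × ℝ) × ℝ) × ((Fin p → ℝ) × (Fin p → ℝ)) =>
      (eigenDensity m z.1.1 : ℂ) * dualKernel n Λ x₁ z.1.1 (rotatePair (z.1.2 / 2) z.2) := by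
  refine (Complex.measurable_ofReal.comp ((measurable_eigenDensity m).comp (by fun_prop))).mul
    (Continuous.measurable ?_)
  unfold dualKernel scaledDot rotatePair
  fun_prop

theorem integrable_eigenDensity_mul_dualKernel {m : ℝ} (hm : -1 < m) (n : ℕ) (Λ : Fin p → ℝ)
    (x₁ : ℂ) (U : (Fin p → ℝ) × (Fin p → ℝ)) :
    Integrable (fun x => (eigenDensity m x.1 : ℂ)
      * dualKernel n Λ x₁ x.1 (rotatePair (x.2 / 2) U)) eigenMeasure := by
  obtain ⟨K, -, hK⟩ := exists_norm_dualKernel_le n Λ x₁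
  refine ((integrable_eigenDensity_mul_eigenMeasure hm).mul_const _).mono'
    ((measurable_eigenDensity_mul_dualKernel m n Λ x₁).comp
      measurable_prodMk_right).aestronglyMeasurable
    ((ae_eigenMeasure_norm_le hK m).mono fun x hx => hx U)

theorem setIntegral_Ioo_add_of_periodic {g : ℝ → ℂ} (hg : Function.Periodic g (2 * Real.pi))
    (a : ℝ) : ∫ θ in Set.Ioo (-Real.pi) Real.pi, g (θ + a)
      = ∫ θ in Set.Ioo (-Real.pi) Real.pi, g θ := by
  have hle : -Real.pi ≤ Real.pi := by linarith [Real.pi_pos]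
  rw [← integral_Ioc_eq_integral_Ioo, ← integral_Ioc_eq_integral_Ioo,
    ← intervalIntegral.integral_of_le hle, ← intervalIntegral.integral_of_le hle,
    intervalIntegral.integral_comp_add_right]
  have h := hg.intervalIntegral_add_eq (-Real.pi + a) (-Real.pi)
  rw [show -Real.pi + a + 2 * Real.pi = Real.pi + a by ring,
    show -Real.pi + 2 * Real.pi = Real.pi by ring] at h
  exact h

theorem integral_dualKernel_rotatePair {m : ℝ} (hm : -1 < m) (n : ℕ) (Λ : Fin p → ℝ)
    (x₁ : ℂ) (φ : ℝ) (U : (Fin p → ℝ) × (Fin p → ℝ)) :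
    ∫ x, (eigenDensity m x.1 : ℂ)
        * dualKernel n Λ x₁ x.1 (rotatePair (x.2 / 2) (rotatePair φ U)) ∂eigenMeasure
      = ∫ x, (eigenDensity m x.1 : ℂ)
        * dualKernel n Λ x₁ x.1 (rotatePair (x.2 / 2) U) ∂eigenMeasure := by
  have h1 := integrable_eigenDensity_mul_dualKernel hm n Λ x₁ U
  have h2 := integrable_eigenDensity_mul_dualKernel hm n Λ x₁ (rotatePair φ U)
  unfold eigenMeasure at h1 h2 ⊢
  rw [integral_prod _ h1, integral_prod _ h2]
  refine integral_congr_ae (ae_of_all _ fun r => ?_)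
  have hper : Function.Periodic (fun θ : ℝ => (eigenDensity m r : ℂ)
      * dualKernel n Λ x₁ r (rotatePair (θ / 2) U)) (2 * Real.pi) := by
    intro θ
    simp only
    rw [show (θ + 2 * Real.pi) / 2 = θ / 2 + Real.pi by ring, rotatePair_add_pi, dualKernel_neg]
  refine Eq.trans ?_ (setIntegral_Ioo_add_of_periodic hper (2 * φ))
  refine integral_congr_ae (ae_of_all _ fun θ => ?_)
  simp only [rotatePair_rotatePair]
  rw [show (θ + 2 * φ) / 2 = θ / 2 + φ by ring]

theorem pairAverage_eq_integral_dualKernel {n : ℕ} (hn : 2 ≤ n) (hpn : p ≤ n) {Λ : Fin p → ℝ}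
    (hΛ : ∀ j, 0 < Λ j) (x₁ : ℂ) (U : (Fin p → ℝ) × (Fin p → ℝ)) :
    16 * Real.pi * pairAverage n Λ x₁ U = ((√(2 * Real.pi) : ℝ) : ℂ) ^ (p * n)
      * ∫ x, (eigenDensity (((n : ℝ) - 3) / 2) x.1 : ℂ)
        * dualKernel n Λ x₁ x.1 (rotatePair (x.2 / 2) U) ∂eigenMeasure := by
  have hn' : (2 : ℝ) ≤ n := by exact_mod_cast hn
  obtain ⟨φ, hφ⟩ := exists_scaledDot_rotatePair_eq_zero Λ U
  rw [← integral_dualKernel_rotatePair (by linarith) n Λ x₁ φ, ← pairAverage_rotatePair n Λ x₁ φ]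
  generalize rotatePair φ U = V at hφ
  rw [integral_congr_ae (ae_of_all _ fun x => congrArg (fun t => (eigenDensity (((n : ℝ) - 3) / 2)
    x.1 : ℂ) * t) (dualKernel_rotatePair_of_scaledDot_eq_zero n Λ x₁ hφ x)),
    integral_eigenMeasure_quadratic hn, pairAverage_of_scaledDot_eq_zero hn hpn hΛ x₁ hφ]
  have := one_add_two_I_mul_ne_zero (scaledDot Λ V.1 V.1)
  have := one_add_two_I_mul_ne_zero (scaledDot Λ V.2 V.2)
  generalize ∑ j, ∑ l ∈ Finset.univ.erase j, coeffTwo n Λ x₁ j l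
          * ((V.1 j : ℂ) * V.2 l - V.1 l * V.2 j) ^ 2 = T
  generalize ((Real.pi / (1 / 2 + Complex.I * scaledDot Λ V.1 V.1)) ^ (1 / 2 : ℂ)) = G₁
  generalize ((Real.pi / (1 / 2 + Complex.I * scaledDot Λ V.2 V.2)) ^ (1 / 2 : ℂ)) = G₂
  generalize ((√(2 * Real.pi) : ℝ) : ℂ) ^ (p * n) = N
  generalize (2 * Real.pi : ℂ) ^ n = L
  field_simp
  ring_nf
  simp only [Complex.I_sq]
  ring

end DualRepresentation

section DualGaussian

variable {p : ℕ}

theorem integral_comp_rotatePair (φ : ℝ) {E : Type*} [NormedAddCommGroup E] [NormedSpace ℝ E]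
    (f : (Fin p → ℝ) × (Fin p → ℝ) → E) :
    ∫ U, f (rotatePair φ U) = ∫ U, f U := by
  have hmp := volume_measurePreserving_sumPiEquivProdPi (fun _ : Fin p ⊕ Fin p => ℝ)
  set e := MeasurableEquiv.sumPiEquivProdPi (fun _ : Fin p ⊕ Fin p => ℝ)
  rw [← hmp.integral_comp e.measurableEmbedding, ← hmp.integral_comp e.measurableEmbedding]
  set Q : Matrix (Fin p ⊕ Fin p) (Fin p ⊕ Fin p) ℝ :=
    fromBlocks (Real.cos φ • 1) (Real.sin φ • 1) (-Real.sin φ • 1) (Real.cos φ • 1) with hQdef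
  have hQ : Qᵀ * Q = 1 := by
    rw [hQdef, fromBlocks_transpose, fromBlocks_multiply, ← fromBlocks_one]
    congr 1 <;> simp only [transpose_smul, transpose_one, Matrix.smul_mul, Matrix.mul_smul,
      Matrix.one_mul, smul_smul, ← add_smul]
    · rw [show Real.cos φ * Real.cos φ + -Real.sin φ * -Real.sin φ = 1 by
        linear_combination Real.sin_sq_add_cos_sq φ, one_smul]
    · rw [show Real.sin φ * Real.cos φ + Real.cos φ * -Real.sin φ = 0 by ring, zero_smul]
    · rw [show Real.cos φ * Real.sin φ + -Real.sin φ * Real.cos φ = 0 by ring, zero_smul]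
    · rw [show Real.sin φ * Real.sin φ + Real.cos φ * Real.cos φ = 1 by
        linear_combination Real.sin_sq_add_cos_sq φ, one_smul]
  rw [← integral_comp_orthogonal_mulVec hQ (fun y => f (e y))]
  congr 1 with y
  congr 1
  ext j
  · change _ = (Q *ᵥ y) (Sum.inl j)
    rw [hQdef, fromBlocks_mulVec]
    simp [rotatePair, smul_mulVec, e, MeasurableEquiv.sumPiEquivProdPi, Equiv.sumPiEquivProdPi]
  · change _ = (Q *ᵥ y) (Sum.inr j)
    rw [hQdef, fromBlocks_mulVec]
    simp [rotatePair, smul_mulVec, neg_mulVec, e, MeasurableEquiv.sumPiEquivProdPi,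
      Equiv.sumPiEquivProdPi]

theorem pi_div_neg_I_mul_cpow {w : ℂ} (hw : 0 < w.im) :
    (Real.pi / (-Complex.I * w)) ^ (1 / 2 : ℂ)
      = (Real.pi * Complex.I) ^ (1 / 2 : ℂ) / w ^ (1 / 2 : ℂ) := by
  have hw0 : w ≠ 0 := fun h => by simp [h] at hw
  have hπ := Real.pi_pos
  have e : (Real.pi / (-Complex.I * w) : ℂ) = (Real.pi * Complex.I) / w := by
    field_simp
    rw [Complex.I_sq]
  have hI : (Real.pi * Complex.I : ℂ) ≠ 0 := by simp [hπ.ne']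
  have harg : (Real.pi * Complex.I : ℂ).arg = Real.pi / 2 := by
    rw [Complex.arg_real_mul _ hπ, Complex.arg_I]
  have hwarg : 0 < w.arg := by
    rcases (Complex.arg_nonneg_iff.mpr hw.le).lt_or_eq with h | h
    · exact h
    · rw [eq_comm, Complex.arg_eq_zero_iff] at h
      exact absurd h.2 hw.ne'
  have hwarg' := Complex.arg_le_pi w
  rw [e, Complex.cpow_def_of_ne_zero (div_ne_zero hI hw0), Complex.cpow_def_of_ne_zero hI,
    Complex.cpow_def_of_ne_zero hw0, ← Complex.exp_sub]
  congr 1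
  rw [← sub_mul]
  congr 1
  have hlog : Complex.log ((Real.pi * Complex.I) / w)
      = Complex.log (Complex.exp (Complex.log (Real.pi * Complex.I) - Complex.log w)) := by
    rw [Complex.exp_sub, Complex.exp_log hI, Complex.exp_log hw0]
  rw [hlog, Complex.log_exp] <;> rw [Complex.sub_im, Complex.log_im, Complex.log_im, harg] <;>
    linarith

theorem prod_pi_div_neg_I_mul_cpow (w₁ w₂ : Fin p → ℂ) (h₁ : ∀ j, 0 < (w₁ j).im)
    (h₂ : ∀ j, 0 < (w₂ j).im) :
    (∏ j, (Real.pi / (-Complex.I * w₁ j)) ^ (1 / 2 : ℂ))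
        * ∏ j, (Real.pi / (-Complex.I * w₂ j)) ^ (1 / 2 : ℂ)
      = (Real.pi * Complex.I) ^ p / ∏ j, (w₁ j ^ (1 / 2 : ℂ) * w₂ j ^ (1 / 2 : ℂ)) := by
  have hsq : ((Real.pi * Complex.I : ℂ) ^ (1 / 2 : ℂ)) * (Real.pi * Complex.I : ℂ) ^ (1 / 2 : ℂ)
      = Real.pi * Complex.I := by
    rw [← Complex.cpow_add _ _ (by simp [Real.pi_ne_zero])]
    norm_num
  have hc : (Real.pi * Complex.I : ℂ) ^ p = ∏ _j : Fin p, (Real.pi * Complex.I : ℂ) := by simp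
  rw [← Finset.prod_mul_distrib, hc, ← Finset.prod_div_distrib]
  refine Finset.prod_congr rfl fun j _ => ?_
  rw [pi_div_neg_I_mul_cpow (h₁ j), pi_div_neg_I_mul_cpow (h₂ j), div_mul_div_comm, hsq]

theorem cexp_pairNormSq_mul_cexp_scaledDot (Λ : Fin p → ℝ) (x₀ : ℂ) (r : ℝ × ℝ)
    (U : (Fin p → ℝ) × (Fin p → ℝ)) :
    Complex.exp (Complex.I * x₀ * pairNormSq U)
        * Complex.exp (-Complex.I * (r.1 * scaledDot Λ U.1 U.1 + r.2 * scaledDot Λ U.2 U.2))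
      = Complex.exp (-∑ j, (-Complex.I * (x₀ - Λ j * r.1)) * (U.1 j : ℂ) ^ 2)
        * Complex.exp (-∑ j, (-Complex.I * (x₀ - Λ j * r.2)) * (U.2 j : ℂ) ^ 2) := by
  rw [← Complex.exp_add, ← Complex.exp_add]
  congr 1
  simp only [pairNormSq, scaledDot]
  push_cast
  simp only [mul_add, Finset.mul_sum, ← Finset.sum_neg_distrib, ← Finset.sum_add_distrib]
  exact Finset.sum_congr rfl fun j _ => by ring

theorem integrable_mul_mul_cexp_neg_sum_sq (z : Fin p → ℂ) (hz : ∀ k, 0 < (z k).re) (i j : Fin p) :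
    Integrable fun y : Fin p → ℝ =>
      (y i : ℂ) * (y j : ℂ) * Complex.exp (-∑ k, z k * (y k : ℂ) ^ 2) := by
  have h : ∀ y : Fin p → ℝ, (y i : ℂ) * (y j : ℂ) * Complex.exp (-∑ k, z k * (y k : ℂ) ^ 2)
      = ∏ k, ((if k = i then (y k : ℂ) else 1) * (if k = j then (y k : ℂ) else 1)
          * Complex.exp (-z k * (y k : ℂ) ^ 2)) := by
    intro y
    rw [cexp_neg_sum_eq_prod, Finset.prod_mul_distrib, Finset.prod_mul_distrib]
    simp
  simp_rw [h]
  refine Integrable.fintype_prod (f := fun k (x : ℝ) =>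
    (if k = i then (x : ℂ) else 1) * (if k = j then (x : ℂ) else 1)
      * Complex.exp (-z k * (x : ℂ) ^ 2)) fun k => ?_
  split_ifs
  · simpa only [sq] using integrable_sq_mul_cexp_neg_mul_sq (hz k)
  · simpa only [mul_one] using integrable_mul_cexp_neg_mul_sq (hz k)
  · simpa only [one_mul] using integrable_mul_cexp_neg_mul_sq (hz k)
  · simpa only [one_mul] using integrable_cexp_neg_mul_sq (hz k)

/-- `f` is integrable with integral `v`. -/
def HasTotalIntegral {α : Type*} [MeasureSpace α] (f : α → ℂ) (v : ℂ) : Prop :=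
  Integrable f ∧ ∫ x, f x = v

section

variable {α : Type*} [MeasureSpace α]

theorem HasTotalIntegral.add {f g : α → ℂ} {a b : ℂ} (hf : HasTotalIntegral f a)
    (hg : HasTotalIntegral g b) : HasTotalIntegral (fun x => f x + g x) (a + b) :=
  ⟨hf.1.fun_add hg.1, by rw [integral_add hf.1 hg.1, hf.2, hg.2]⟩

theorem HasTotalIntegral.const_mul {f : α → ℂ} {a : ℂ} (hf : HasTotalIntegral f a) (c : ℂ) :
    HasTotalIntegral (fun x => c * f x) (c * a) :=
  ⟨hf.1.const_mul c, by rw [integral_const_mul, hf.2]⟩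

theorem HasTotalIntegral.sum {κ : Type*} {s : Finset κ} {f : κ → α → ℂ} {a : κ → ℂ}
    (hf : ∀ i ∈ s, HasTotalIntegral (f i) (a i)) :
    HasTotalIntegral (fun x => ∑ i ∈ s, f i x) (∑ i ∈ s, a i) :=
  ⟨integrable_finsetSum _ fun i hi => (hf i hi).1, by
    rw [integral_finsetSum _ fun i hi => (hf i hi).1]
    exact Finset.sum_congr rfl fun i hi => (hf i hi).2⟩

end

theorem HasTotalIntegral.prod_mul {f g : (Fin p → ℝ) → ℂ} {a b : ℂ} (hf : HasTotalIntegral f a)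
    (hg : HasTotalIntegral g b) :
    HasTotalIntegral (fun U : (Fin p → ℝ) × (Fin p → ℝ) => f U.1 * g U.2) (a * b) :=
  ⟨hf.1.mul_prod hg.1, by
    rw [Measure.volume_eq_prod, integral_prod_mul, hf.2, hg.2]⟩

/-- The sum of residue-type corrections obtained from the Gaussian integral of `dualKernel`. -/
noncomputable def resolventBracket (n : ℕ) (Λ : Fin p → ℝ) (x₀ x₁ : ℂ) (r : ℝ × ℝ) : ℂ :=
  coeffZero n Λ x₁
    + ∑ j, coeffOne n Λ x₁ j * (r.1 / (x₀ - Λ j * r.1) + r.2 / (x₀ - Λ j * r.2))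
    + ∑ j, ∑ l ∈ Finset.univ.erase j, coeffTwo n Λ x₁ j l
      * (r.1 * r.2 / ((x₀ - Λ j * r.1) * (x₀ - Λ l * r.2)))

theorem coeffTwo_comm (n : ℕ) (Λ : Fin p → ℝ) (x₁ : ℂ) (j l : Fin p) :
    coeffTwo n Λ x₁ j l = coeffTwo n Λ x₁ l j := by
  rw [coeffTwo, coeffTwo, Finset.erase_right_comm]
  ring

theorem sum_sum_erase_comm (f : Fin p → Fin p → ℂ) :
    ∑ j, ∑ l ∈ Finset.univ.erase j, f j l = ∑ j, ∑ l ∈ Finset.univ.erase j, f l j := by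
  refine Finset.sum_comm' fun j l => ?_
  simp [eq_comm]

theorem integral_cexp_mul_dualKernel (n : ℕ) (Λ : Fin p → ℝ) {x₀ : ℂ} (h₀ : 0 < x₀.im)
    (x₁ : ℂ) (r : ℝ × ℝ) :
    ∫ U : (Fin p → ℝ) × (Fin p → ℝ),
        Complex.exp (Complex.I * x₀ * pairNormSq U) * dualKernel n Λ x₁ r U
      = (Real.pi * Complex.I) ^ p
        / (∏ j, ((x₀ - Λ j * r.1) ^ (1 / 2 : ℂ) * (x₀ - Λ j * r.2) ^ (1 / 2 : ℂ)))
        * resolventBracket n Λ x₀ x₁ r := by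
  have him : ∀ (t : ℝ) j, 0 < (x₀ - Λ j * t).im := by
    intro t j
    simpa using h₀
  have hre : ∀ (t : ℝ) j, 0 < (-Complex.I * (x₀ - Λ j * t)).re := by
    intro t j
    simpa using h₀
  have hne : ∀ (t : ℝ) j, x₀ - Λ j * t ≠ 0 := fun t j h => by
    have := him t j
    simp [h] at this
  set E : ℝ → (Fin p → ℝ) → ℂ := fun t u =>
    Complex.exp (-∑ j, (-Complex.I * (x₀ - Λ j * t)) * (u j : ℂ) ^ 2) with hE
  set G : ℝ → ℂ := fun t => ∏ j, (Real.pi / (-Complex.I * (x₀ - Λ j * t))) ^ (1 / 2 : ℂ) with hG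
  have hE0 : ∀ t, HasTotalIntegral (E t) (G t) := fun t =>
    ⟨integrable_cexp_neg_sum_sq _ (hre t), integral_cexp_neg_sum_sq _ (hre t)⟩
  have hE1 : ∀ t i j, HasTotalIntegral (fun u : Fin p → ℝ => (u i : ℂ) * (u j : ℂ) * E t u)
      (if i = j then 1 / (2 * (-Complex.I * (x₀ - Λ i * t))) * G t else 0) := fun t i j =>
    ⟨integrable_mul_mul_cexp_neg_sum_sq _ (hre t) i j,
      integral_mul_mul_cexp_neg_sum_sq _ (hre t) i j⟩
  have hd : ∀ t j, HasTotalIntegral (fun u : Fin p → ℝ => (u j : ℂ) * (u j : ℂ) * E t u)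
      (1 / (2 * (-Complex.I * (x₀ - Λ j * t))) * G t) := fun t j => by
    simpa using hE1 t j j
  have hz := (((hE0 r.1).prod_mul (hE0 r.2)).const_mul (coeffZero n Λ x₁))
  have ho := (HasTotalIntegral.sum (s := Finset.univ) fun j _ =>
    ((((hd r.1 j).prod_mul (hE0 r.2)).const_mul (r.1 : ℂ)).add
      (((hE0 r.1).prod_mul (hd r.2 j)).const_mul (r.2 : ℂ))).const_mul
        (coeffOne n Λ x₁ j)).const_mul (-(2 * Complex.I))
  have ht := (HasTotalIntegral.sum (s := Finset.univ) fun j _ =>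
    HasTotalIntegral.sum (s := Finset.univ.erase j) fun l hl =>
      ((((hd r.1 j).prod_mul (hd r.2 l)).add ((hd r.1 l).prod_mul (hd r.2 j))).add
        (((hE1 r.1 j l).prod_mul (hE1 r.2 l j)).const_mul (-2))).const_mul
          (coeffTwo n Λ x₁ j l)).const_mul (-2 * (r.1 * r.2 : ℂ))
  have htot := ((hz.add ho).add ht).2
  refine (integral_congr_ae (ae_of_all _ fun U => ?_)).trans (htot.trans ?_)
  · simp only [dualKernel]
    rw [← mul_assoc, cexp_pairNormSq_mul_cexp_scaledDot]
    change E r.1 U.1 * E r.2 U.2 * _ = _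
    generalize E r.1 U.1 = e₁
    generalize E r.2 U.2 = e₂
    simp only [mul_add, Finset.mul_sum, ← Finset.sum_neg_distrib, sub_eq_add_neg]
    congr 1
    · congr 1
      · ring
      · exact Finset.sum_congr rfl fun j _ => by ring
    · exact Finset.sum_congr rfl fun j _ => Finset.sum_congr rfl fun l _ => by ring
  · rw [← prod_pi_div_neg_I_mul_cpow _ _ (him r.1) (him r.2)]
    change _ = G r.1 * G r.2 * _
    generalize G r.1 = g₁
    generalize G r.2 = g₂
    have h1 : -(2 * Complex.I) * ∑ j, coeffOne n Λ x₁ j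
          * (r.1 * (1 / (2 * (-Complex.I * (x₀ - Λ j * r.1))) * g₁ * g₂)
            + r.2 * (g₁ * (1 / (2 * (-Complex.I * (x₀ - Λ j * r.2))) * g₂)))
        = g₁ * g₂ * ∑ j, coeffOne n Λ x₁ j
          * (r.1 / (x₀ - Λ j * r.1) + r.2 / (x₀ - Λ j * r.2)) := by
      rw [Finset.mul_sum, Finset.mul_sum]
      refine Finset.sum_congr rfl fun j _ => ?_
      have hw₁ := hne r.1 j
      have hw₂ := hne r.2 j
      have := Complex.I_ne_zero
      generalize x₀ - Λ j * r.1 = w₁ at hw₁ ⊢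
      generalize x₀ - Λ j * r.2 = w₂ at hw₂ ⊢
      field_simp
      ring
    have h2 : -2 * (r.1 * r.2 : ℂ) * ∑ j, ∑ l ∈ Finset.univ.erase j, coeffTwo n Λ x₁ j l
          * (1 / (2 * (-Complex.I * (x₀ - Λ j * r.1))) * g₁
              * (1 / (2 * (-Complex.I * (x₀ - Λ l * r.2))) * g₂)
            + 1 / (2 * (-Complex.I * (x₀ - Λ l * r.1))) * g₁
              * (1 / (2 * (-Complex.I * (x₀ - Λ j * r.2))) * g₂)
            + -2 * ((if j = l then 1 / (2 * (-Complex.I * (x₀ - Λ j * r.1))) * g₁ else 0)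
              * (if l = j then 1 / (2 * (-Complex.I * (x₀ - Λ l * r.2))) * g₂ else 0)))
        = g₁ * g₂ * ∑ j, ∑ l ∈ Finset.univ.erase j, coeffTwo n Λ x₁ j l
          * (r.1 * r.2 / ((x₀ - Λ j * r.1) * (x₀ - Λ l * r.2))) := by
      have hs : ∀ j, ∀ l ∈ Finset.univ.erase j, coeffTwo n Λ x₁ j l
          * (1 / (2 * (-Complex.I * (x₀ - Λ j * r.1))) * g₁
              * (1 / (2 * (-Complex.I * (x₀ - Λ l * r.2))) * g₂)
            + 1 / (2 * (-Complex.I * (x₀ - Λ l * r.1))) * g₁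
              * (1 / (2 * (-Complex.I * (x₀ - Λ j * r.2))) * g₂)
            + -2 * ((if j = l then 1 / (2 * (-Complex.I * (x₀ - Λ j * r.1))) * g₁ else 0)
              * (if l = j then 1 / (2 * (-Complex.I * (x₀ - Λ l * r.2))) * g₂ else 0)))
          = -(g₁ * g₂ / 4) * (coeffTwo n Λ x₁ j l * (1 / ((x₀ - Λ j * r.1) * (x₀ - Λ l * r.2))))
            + -(g₁ * g₂ / 4)
              * (coeffTwo n Λ x₁ l j * (1 / ((x₀ - Λ l * r.1) * (x₀ - Λ j * r.2)))) := by
        intro j l hl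
        have hjl : j ≠ l := (Finset.ne_of_mem_erase hl).symm
        have h3 := hne r.1 j
        have h4 := hne r.2 j
        have h5 := hne r.1 l
        have h6 := hne r.2 l
        rw [if_neg hjl, coeffTwo_comm n Λ x₁ l j]
        generalize x₀ - Λ j * r.1 = w₁ at h3 ⊢
        generalize x₀ - Λ j * r.2 = w₂ at h4 ⊢
        generalize x₀ - Λ l * r.1 = w₃ at h5 ⊢
        generalize x₀ - Λ l * r.2 = w₄ at h6 ⊢
        field_simp
        simp only [Complex.I_sq]
        ring
      rw [Finset.sum_congr rfl fun j _ => Finset.sum_congr rfl (hs j)]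
      simp only [Finset.sum_add_distrib]
      rw [← sum_sum_erase_comm (fun j l => -(g₁ * g₂ / 4)
        * (coeffTwo n Λ x₁ j l * (1 / ((x₀ - Λ j * r.1) * (x₀ - Λ l * r.2)))))]
      simp only [Finset.mul_sum, ← Finset.sum_add_distrib]
      refine Finset.sum_congr rfl fun j _ => Finset.sum_congr rfl fun l _ => ?_
      ring
    rw [h1, h2, resolventBracket]
    ring

theorem directIntegrand_eq (n : ℕ) (Λ : Fin p → ℝ) (x₀ x₁ : ℂ) (r : ℝ × ℝ) :
    directIntegrand p n Λ x₀ x₁ r = eigenDensity (((n : ℝ) - 3) / 2) r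
      / (∏ j, ((x₀ - Λ j * r.1) ^ (1 / 2 : ℂ) * (x₀ - Λ j * r.2) ^ (1 / 2 : ℂ)))
      * resolventBracket n Λ x₀ x₁ r := by
  rw [directIntegrand, eigenDensity]
  congr 1
  · push_cast
    rfl
  · simp only [mul_add (_ / _), Finset.sum_add_distrib]
    rw [resolventBracket, add_right_comm]
    congr 1
    · congr 1
      · rw [coeffZero, laguerreMoment, Finset.mul_sum]
        refine Finset.sum_congr rfl fun k _ => ?_
        simp only [zero_le, if_true, Nat.sub_zero]
        ring
      · simp only [coeffOne, laguerreMoment, Finset.mul_sum, Finset.sum_mul]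
        rw [Finset.sum_comm]
        exact Finset.sum_congr rfl fun j _ => Finset.sum_congr rfl fun k _ => by ring
    · simp only [coeffTwo, laguerreMoment, Finset.mul_sum, Finset.sum_mul]
      rw [Finset.sum_comm]
      refine Finset.sum_congr rfl fun j _ => ?_
      rw [Finset.sum_comm]
      exact Finset.sum_congr rfl fun l _ => Finset.sum_congr rfl fun k _ => by ring

end DualGaussian

section Assembly

variable {p : ℕ}

/-- The matrix `W Wᵀ` for `W = sqrtScale Λ y`. -/
noncomputable def scaledGram {n : ℕ} (Λ : Fin p → ℝ) (y : Fin n → Fin p → ℝ) :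
    Matrix (Fin p) (Fin p) ℝ :=
  of (sqrtScale Λ y) * (of (sqrtScale Λ y))ᵀ

theorem isHermitian_scaledGram {n : ℕ} (Λ : Fin p → ℝ) (y : Fin n → Fin p → ℝ) :
    (scaledGram Λ y).IsHermitian := by
  rw [scaledGram, IsHermitian, conjTranspose_eq_transpose_of_trivial, transpose_mul,
    transpose_transpose]

theorem smul_one_sub_scaledGram {n : ℕ} (Λ : Fin p → ℝ) (x₁ : ℂ) (y : Fin n → Fin p → ℝ) :
    x₁ • (1 : Matrix (Fin p) (Fin p) ℂ) - (scaledGram Λ y).map Complex.ofReal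
      = columnShift (fun j => √(Λ j)) (x₁ • 1) y := by
  ext i j
  simp [columnShift, scaledGram, sqrtScale, mul_apply, vecMulVec_apply, Matrix.sum_apply]

theorem dotProduct_mul_transpose_mulVec {κ : Type*} [Fintype κ] (B : Matrix (Fin p) κ ℝ)
    (u : Fin p → ℝ) : u ⬝ᵥ (B * Bᵀ) *ᵥ u = ∑ k, (∑ j, B j k * u j) ^ 2 := by
  rw [← mulVec_mulVec, dotProduct_mulVec, vecMul_eq_sum]
  simp [dotProduct, sq, mulVec, Finset.sum_apply, mul_comm]

theorem gaussForm_mul_transpose {κ : Type*} [Fintype κ] (z c : ℂ) (B : Matrix (Fin p) κ ℝ)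
    (u : Fin p → ℝ) : gaussForm z c (B * Bᵀ) u
      = z * ((∑ j, u j ^ 2 : ℝ) : ℂ) + c * ((∑ k, (∑ j, B j k * u j) ^ 2 : ℝ) : ℂ) := by
  rw [gaussForm, dotProduct_mul_transpose_mulVec]
  simp [dotProduct, sq]

theorem cexp_mul_cexp_neg_gaussForm_scaledGram {n : ℕ} (Λ : Fin p → ℝ) (x₀ : ℂ)
    (y : Fin n → Fin p → ℝ) (U : (Fin p → ℝ) × (Fin p → ℝ)) :
    Complex.exp (-(1 / 2) * ((∑ c, ∑ j, y c j ^ 2 : ℝ) : ℂ))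
        * (Complex.exp (-gaussForm (-Complex.I * x₀) Complex.I (scaledGram Λ y) U.1)
          * Complex.exp (-gaussForm (-Complex.I * x₀) Complex.I (scaledGram Λ y) U.2))
      = Complex.exp (Complex.I * x₀ * pairNormSq U)
        * ∏ c, Complex.exp (-gaussForm (1 / 2) Complex.I
          (pairMatrix Λ U * (pairMatrix Λ U)ᵀ) (y c)) := by
  rw [← Complex.exp_sum, ← Complex.exp_add, ← Complex.exp_add, ← Complex.exp_add]
  congr 1
  simp only [scaledGram, gaussForm_mul_transpose, Fin.sum_univ_two, of_apply, sqrtScale,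
    pairMatrix, cons_val_zero, cons_val_one, pairNormSq, Finset.sum_neg_distrib,
    Finset.sum_add_distrib]
  have e : ∀ (u : Fin p → ℝ), ∑ c, (∑ j, √(Λ j) * y c j * u j) ^ 2
      = ∑ c, (∑ j, √(Λ j) * u j * y c j) ^ 2 := fun u =>
    Finset.sum_congr rfl fun c _ => by
      congr 1
      exact Finset.sum_congr rfl fun j _ => by ring
  rw [e, e]
  simp only [Complex.ofReal_add, Complex.ofReal_sum, ← Finset.mul_sum, Finset.sum_add_distrib]
  ring

theorem norm_cexp_I_mul_pairNormSq (x₀ : ℂ) (U : (Fin p → ℝ) × (Fin p → ℝ)) :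
    ‖Complex.exp (Complex.I * x₀ * pairNormSq U)‖ = Real.exp (-x₀.im * pairNormSq U) := by
  rw [Complex.norm_exp]
  simp

theorem integrable_exp_neg_pairNormSq {b : ℝ} (hb : 0 < b) :
    Integrable fun U : (Fin p → ℝ) × (Fin p → ℝ) => Real.exp (-b * pairNormSq U) := by
  have h : Integrable fun u : Fin p → ℝ => Real.exp (-b * ∑ j, u j ^ 2) := by
    simp_rw [Finset.mul_sum, Real.exp_sum]
    exact Integrable.fintype_prod (f := fun _ t => Real.exp (-b * t ^ 2)) fun _ =>
      integrable_exp_neg_mul_sq hb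
  refine (h.mul_prod h).congr (ae_of_all _ fun U => ?_)
  simp only [pairNormSq, mul_add, Real.exp_add]

theorem integrable_one_add_pairNormSq_sq_mul_exp {b : ℝ} (hb : 0 < b) :
    Integrable fun U : (Fin p → ℝ) × (Fin p → ℝ) =>
      (1 + pairNormSq U) ^ 2 * Real.exp (-b * pairNormSq U) := by
  have h := (integrable_exp_neg_pairNormSq (p := p) (half_pos hb)).const_mul
    (2 * (1 + 4 * (4 / b ^ 2)))
  refine h.mono' ?_ (ae_of_all _ fun U => ?_)
  · refine Continuous.aestronglyMeasurable ?_
    unfold pairNormSq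
    fun_prop
  · have hq := pairNormSq_nonneg U
    generalize pairNormSq U = q at hq ⊢
    rw [Real.norm_of_nonneg (by positivity)]
    have h1 : (b / 2 * q) ^ 2 / 2 ≤ Real.exp (b / 2 * q) := by
      have := Real.quadratic_le_exp_of_nonneg (x := b / 2 * q) (by positivity)
      have : 0 ≤ b / 2 * q := by positivity
      linarith
    have h2 : 1 ≤ Real.exp (b / 2 * q) := Real.one_le_exp (by positivity)
    have h3 : (1 + q) ^ 2 ≤ 2 * (1 + 4 * (4 / b ^ 2)) * Real.exp (b / 2 * q) := by
      have h4 : q ^ 2 = 8 / b ^ 2 * ((b / 2 * q) ^ 2 / 2) := by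
        field_simp
        ring
      have h5 : q ^ 2 ≤ 8 / b ^ 2 * Real.exp (b / 2 * q) := by
        rw [h4]
        exact mul_le_mul_of_nonneg_left h1 (by positivity)
      have h6 : 8 / b ^ 2 * Real.exp (b / 2 * q) = 2 * (4 / b ^ 2) * Real.exp (b / 2 * q) := by
        ring
      have h7 : 0 ≤ 4 / b ^ 2 * Real.exp (b / 2 * q) := by positivity
      nlinarith [sq_nonneg (1 - q)]
    calc (1 + q) ^ 2 * Real.exp (-b * q)
        ≤ 2 * (1 + 4 * (4 / b ^ 2)) * Real.exp (b / 2 * q) * Real.exp (-b * q) :=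
          mul_le_mul_of_nonneg_right h3 (Real.exp_pos _).le
      _ = 2 * (1 + 4 * (4 / b ^ 2)) * Real.exp (-(b / 2) * q) := by
          rw [mul_assoc, ← Real.exp_add]
          congr 2
          ring

theorem integrable_cexp_mul_prod_mul_det (n : ℕ) (Λ : Fin p → ℝ) {x₀ : ℂ} (h₀ : 0 < x₀.im)
    (x₁ : ℂ) :
    Integrable fun z : (Fin n → Fin p → ℝ) × ((Fin p → ℝ) × (Fin p → ℝ)) =>
      Complex.exp (Complex.I * x₀ * pairNormSq z.2)
        * ((∏ c, Complex.exp (-gaussForm (1 / 2) Complex.I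
          (pairMatrix Λ z.2 * (pairMatrix Λ z.2)ᵀ) (z.1 c)))
        * (columnShift (fun j => √(Λ j)) (x₁ • 1) z.1).det) := by
  obtain ⟨K, -, hK⟩ := norm_prod_mul_det_columnShift_le n (fun j => √(Λ j))
    (x₁ • (1 : Matrix (Fin p) (Fin p) ℂ))
  have h := ((integrable_exp_neg_sum_sum_sq (ι := Fin p) n
    (by norm_num : (0 : ℝ) < 1 / 4)).const_mul K).mul_prod (integrable_exp_neg_pairNormSq (p := p) h₀)
  refine h.mono' (Continuous.aestronglyMeasurable ?_) (ae_of_all _ fun z => ?_)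
  · simp only [gaussForm_mul_transpose, pairMatrix, Fin.sum_univ_two, of_apply, cons_val_zero,
      cons_val_one, pairNormSq]
    refine Continuous.mul (by fun_prop) (Continuous.mul ?_
      ((continuous_det_columnShift n _ _).comp continuous_fst))
    fun_prop
  · rw [norm_mul, norm_cexp_I_mul_pairNormSq, mul_comm]
    exact mul_le_mul_of_nonneg_right (hK _ _) (Real.exp_pos _).le

theorem integral_cexp_mul_prod_mul_det {n : ℕ} (Λ : Fin p → ℝ) {x₀ : ℂ} (h₀ : 0 < x₀.im)
    (x₁ : ℂ) (y : Fin n → Fin p → ℝ) :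
    ∫ U : (Fin p → ℝ) × (Fin p → ℝ), Complex.exp (Complex.I * x₀ * pairNormSq U)
        * ((∏ c, Complex.exp (-gaussForm (1 / 2) Complex.I
          (pairMatrix Λ U * (pairMatrix Λ U)ᵀ) (y c)))
        * (columnShift (fun j => √(Λ j)) (x₁ • 1) y).det)
      = (Real.pi * Complex.I) ^ p * (Complex.exp (-(1 / 2) * ((∑ c, ∑ j, y c j ^ 2 : ℝ) : ℂ))
        * ((x₁ • (1 : Matrix (Fin p) (Fin p) ℂ) - (scaledGram Λ y).map Complex.ofReal).det
          / (x₀ • (1 : Matrix (Fin p) (Fin p) ℂ) - (scaledGram Λ y).map Complex.ofReal).det)) := by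
  have h := integral_prod_cexp_neg_gaussForm (isHermitian_scaledGram Λ y) h₀
  rw [Fintype.card_fin] at h
  rw [smul_one_sub_scaledGram Λ x₁ y]
  generalize (columnShift (fun j => √(Λ j)) (x₁ • (1 : Matrix (Fin p) (Fin p) ℂ)) y).det = d
  have h2 := cexp_mul_cexp_neg_gaussForm_scaledGram Λ x₀ y
  simp_rw [← mul_assoc, ← h2]
  rw [integral_mul_const, integral_const_mul, h]
  ring

/-- Integrating out the Gaussian matrix, with the inverse determinant written as a Gaussian
integral over a pair of vectors. -/
theorem integral_wishart_eq_integral_pairAverage {n : ℕ} {Λ : Fin p → ℝ} (hΛ : ∀ j, 0 < Λ j)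
    {x₀ : ℂ} (h₀ : 0 < x₀.im) (x₁ : ℂ) :
    (((√(2 * Real.pi) : ℝ) : ℂ) ^ (p * n)) * (Real.pi * Complex.I) ^ p
      * ∫ W, (x₁ • (1 : Matrix (Fin p) (Fin p) ℂ) - (of W * (of W)ᵀ).map Complex.ofReal).det
        / (x₀ • (1 : Matrix (Fin p) (Fin p) ℂ) - (of W * (of W)ᵀ).map Complex.ofReal).det
        ∂(wishartMeasureReal p n Λ)
      = ∫ U, Complex.exp (Complex.I * x₀ * pairNormSq U) * pairAverage n Λ x₁ U := by
  have hN : (((√(2 * Real.pi) : ℝ) : ℂ) ^ (p * n)) ≠ 0 :=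
    pow_ne_zero _ (Complex.ofReal_ne_zero.mpr (Real.sqrt_pos.mpr Real.two_pi_pos).ne')
  have hswap := integral_integral_swap (f := fun (y : Fin n → Fin p → ℝ)
      (U : (Fin p → ℝ) × (Fin p → ℝ)) => Complex.exp (Complex.I * x₀ * pairNormSq U)
        * ((∏ c, Complex.exp (-gaussForm (1 / 2) Complex.I
          (pairMatrix Λ U * (pairMatrix Λ U)ᵀ) (y c)))
        * (columnShift (fun j => √(Λ j)) (x₁ • 1) y).det))
    (integrable_cexp_mul_prod_mul_det n Λ h₀ x₁)
  simp only [integral_cexp_mul_prod_mul_det Λ h₀ x₁, integral_const_mul] at hswap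
  rw [integral_wishartMeasureReal hΛ]
  generalize (((√(2 * Real.pi) : ℝ) : ℂ) ^ (p * n)) = N at hN ⊢
  rw [mul_comm N, mul_assoc, mul_inv_cancel_left₀ hN]
  exact hswap

end Assembly

section DoubleIntegral

variable {p : ℕ}

theorem integrable_cexp_mul_eigenDensity_mul_dualKernel {m : ℝ} (hm : -1 < m) (n : ℕ)
    (Λ : Fin p → ℝ) {x₀ : ℂ} (h₀ : 0 < x₀.im) (x₁ : ℂ) :
    Integrable (fun z : ((ℝ × ℝ) × ℝ) × ((Fin p → ℝ) × (Fin p → ℝ)) =>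
      Complex.exp (Complex.I * x₀ * pairNormSq z.2)
        * ((eigenDensity m z.1.1 : ℂ) * dualKernel n Λ x₁ z.1.1 (rotatePair (z.1.2 / 2) z.2)))
      (eigenMeasure.prod volume) := by
  obtain ⟨K, -, hK⟩ := exists_norm_dualKernel_le n Λ x₁
  have h := (integrable_eigenDensity_mul_eigenMeasure hm).mul_prod
    ((integrable_one_add_pairNormSq_sq_mul_exp (p := p) h₀).const_mul K)
  have hae := (Measure.quasiMeasurePreserving_fst (μ := eigenMeasure)
    (ν := (volume : Measure ((Fin p → ℝ) × (Fin p → ℝ))))).ae (ae_eigenMeasure_norm_le hK m)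
  refine h.mono' (Measurable.aestronglyMeasurable (Measurable.mul ?_
    (measurable_eigenDensity_mul_dualKernel m n Λ x₁))) (hae.mono fun z hz => ?_)
  · unfold pairNormSq
    fun_prop
  · rw [norm_mul, norm_cexp_I_mul_pairNormSq]
    refine (mul_le_mul_of_nonneg_left (hz z.2) (Real.exp_pos _).le).trans_eq ?_
    ring

theorem integral_cexp_mul_eigenDensity_mul_dualKernel (n : ℕ) (Λ : Fin p → ℝ) {x₀ : ℂ}
    (h₀ : 0 < x₀.im) (x₁ : ℂ) (r : ℝ × ℝ) (φ : ℝ) :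
    ∫ U : (Fin p → ℝ) × (Fin p → ℝ), Complex.exp (Complex.I * x₀ * pairNormSq U)
        * ((eigenDensity (((n : ℝ) - 3) / 2) r : ℂ) * dualKernel n Λ x₁ r (rotatePair φ U))
      = (Real.pi * Complex.I) ^ p * directIntegrand p n Λ x₀ x₁ r := by
  have h := integral_comp_rotatePair φ fun U : (Fin p → ℝ) × (Fin p → ℝ) =>
    Complex.exp (Complex.I * x₀ * pairNormSq U)
      * ((eigenDensity (((n : ℝ) - 3) / 2) r : ℂ) * dualKernel n Λ x₁ r U)
  simp only [pairNormSq_rotatePair] at h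
  rw [h]
  simp_rw [mul_left_comm (Complex.exp _)]
  rw [integral_const_mul, integral_cexp_mul_dualKernel n Λ h₀, directIntegrand_eq]
  ring

theorem integrable_directIntegrand_eigenMeasure {n : ℕ} (hn : 2 ≤ n) (Λ : Fin p → ℝ) {x₀ : ℂ}
    (h₀ : 0 < x₀.im) (x₁ : ℂ) :
    Integrable (fun x => directIntegrand p n Λ x₀ x₁ x.1) eigenMeasure := by
  have hn' : (2 : ℝ) ≤ n := by exact_mod_cast hn
  have h := (integrable_cexp_mul_eigenDensity_mul_dualKernel
    (by linarith : -1 < ((n : ℝ) - 3) / 2) n Λ h₀ x₁).integral_prod_left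
  simp only [integral_cexp_mul_eigenDensity_mul_dualKernel n Λ h₀] at h
  have hP : ((Real.pi : ℂ) * Complex.I) ^ p ≠ 0 := pow_ne_zero _ (by simp [Real.pi_ne_zero])
  exact (integrable_const_mul_iff (isUnit_iff_ne_zero.mpr hP) _).mp h

theorem integrableOn_directIntegrand {n : ℕ} (hn : 2 ≤ n) (Λ : Fin p → ℝ) {x₀ : ℂ}
    (h₀ : 0 < x₀.im) (x₁ : ℂ) :
    IntegrableOn (directIntegrand p n Λ x₀ x₁) (Set.Ioi (0 : ℝ) ×ˢ Set.Ioi (0 : ℝ)) := by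
  have h := (integrable_directIntegrand_eigenMeasure hn Λ h₀ x₁).integral_prod_left
  simp only [integral_const] at h
  have hc : (volume.restrict (Set.Ioo (-Real.pi) Real.pi)).real Set.univ ≠ 0 := by
    have := Real.pi_pos
    rw [measureReal_restrict_apply_univ, Real.volume_real_Ioo_of_le (by linarith)]
    linarith
  exact (integrable_smul_iff hc _).mp h

theorem integral_directIntegrand_eigenMeasure (n : ℕ) (Λ : Fin p → ℝ) (x₀ x₁ : ℂ) :
    ∫ x, directIntegrand p n Λ x₀ x₁ x.1 ∂eigenMeasure
      = 2 * Real.pi * ∫ r in Set.Ioi (0 : ℝ) ×ˢ Set.Ioi (0 : ℝ), directIntegrand p n Λ x₀ x₁ r := by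
  have hc : (volume.restrict (Set.Ioo (-Real.pi) Real.pi)).real Set.univ = 2 * Real.pi := by
    rw [measureReal_restrict_apply_univ, Real.volume_real_Ioo_of_le (by linarith [Real.pi_pos])]
    ring
  rw [eigenMeasure, integral_fun_fst, hc, Complex.real_smul]
  push_cast
  rfl

theorem integral_cexp_mul_pairAverage {n : ℕ} (hn : 2 ≤ n) (hpn : p ≤ n) {Λ : Fin p → ℝ}
    (hΛ : ∀ j, 0 < Λ j) {x₀ : ℂ} (h₀ : 0 < x₀.im) (x₁ : ℂ) :
    16 * Real.pi * ∫ U, Complex.exp (Complex.I * x₀ * pairNormSq U) * pairAverage n Λ x₁ U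
      = ((√(2 * Real.pi) : ℝ) : ℂ) ^ (p * n) * ((Real.pi * Complex.I) ^ p * (2 * Real.pi
        * ∫ r in Set.Ioi (0 : ℝ) ×ˢ Set.Ioi (0 : ℝ), directIntegrand p n Λ x₀ x₁ r)) := by
  have hn' : (2 : ℝ) ≤ n := by exact_mod_cast hn
  have : SFinite eigenMeasure := by
    unfold eigenMeasure
    infer_instance
  have hswap := integral_integral_swap (μ := eigenMeasure) (ν := volume)
    (f := fun (x : (ℝ × ℝ) × ℝ) (U : (Fin p → ℝ) × (Fin p → ℝ)) =>
      Complex.exp (Complex.I * x₀ * pairNormSq U)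
        * ((eigenDensity (((n : ℝ) - 3) / 2) x.1 : ℂ)
          * dualKernel n Λ x₁ x.1 (rotatePair (x.2 / 2) U)))
    (integrable_cexp_mul_eigenDensity_mul_dualKernel (by linarith) n Λ h₀ x₁)
  simp only [integral_cexp_mul_eigenDensity_mul_dualKernel n Λ h₀] at hswap
  rw [← integral_directIntegrand_eigenMeasure, ← integral_const_mul, ← integral_const_mul, hswap,
    ← integral_const_mul]
  refine integral_congr_ae (ae_of_all _ fun U => ?_)
  simp only
  rw [mul_left_comm, pairAverage_eq_integral_dualKernel hn hpn hΛ, integral_const_mul,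
    mul_left_comm]

end DoubleIntegral

/-- For `1 ≤ p ≤ n`, `n ≥ 2`, positive `Λ₁,…,Λ_p`, and `x₀, x₁ ∈ ℂ` with `Im x₀ > 0`,
the generating function `Z₁(x₀,x₁) = ∫ det(x₁ − WWᵀ)/det(x₀ − WWᵀ) dμ₁(W)` equals
`(1/8) ∬_{(0,∞)²} directIntegrand dr_a dr_b`, the double integral converging absolutely. -/
theorem generating_function_real_wishart_direct
    (p n : ℕ) (hp : 1 ≤ p) (hpn : p ≤ n) (hn : 2 ≤ n)
    (Λ : Fin p → ℝ) (hΛ : ∀ j, 0 < Λ j)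
    (x₀ x₁ : ℂ) (h₀ : 0 < x₀.im) :
    IntegrableOn (directIntegrand p n Λ x₀ x₁) (Set.Ioi (0 : ℝ) ×ˢ Set.Ioi (0 : ℝ)) ∧
    (∫ W, (x₁ • (1 : Matrix (Fin p) (Fin p) ℂ) -
            (Matrix.of W * (Matrix.of W)ᵀ).map Complex.ofReal).det /
          (x₀ • (1 : Matrix (Fin p) (Fin p) ℂ) -
            (Matrix.of W * (Matrix.of W)ᵀ).map Complex.ofReal).det
        ∂(wishartMeasureReal p n Λ))
      = (1 / 8) *
          ∫ r in Set.Ioi (0 : ℝ) ×ˢ Set.Ioi (0 : ℝ), directIntegrand p n Λ x₀ x₁ r := by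
  refine ⟨integrableOn_directIntegrand hn Λ h₀ x₁, ?_⟩
  have hN : (((√(2 * Real.pi) : ℝ) : ℂ) ^ (p * n)) ≠ 0 :=
    pow_ne_zero _ (Complex.ofReal_ne_zero.mpr (Real.sqrt_pos.mpr Real.two_pi_pos).ne')
  have hP : ((Real.pi : ℂ) * Complex.I) ^ p ≠ 0 := pow_ne_zero _ (by simp [Real.pi_ne_zero])
  have hpi : (Real.pi : ℂ) ≠ 0 := Complex.ofReal_ne_zero.mpr Real.pi_ne_zero
  have h := integral_cexp_mul_pairAverage hn hpn hΛ h₀ x₁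
  rw [← integral_wishart_eq_integral_pairAverage hΛ h₀ x₁] at h
  generalize (((√(2 * Real.pi) : ℝ) : ℂ) ^ (p * n)) = N at hN h
  generalize ((Real.pi : ℂ) * Complex.I) ^ p = P at hP h
  refine mul_left_cancel₀ (mul_ne_zero (mul_ne_zero hN hP) hpi) ?_
  linear_combination h / 16
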